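/- Let K ≥ 0 and h₁ ∈ (−1,1), and let (v,h) be a classical solution of the fluid–particle system on [0,∞). Set E₀ = ∫_{−1}^{1} v₀(y)² dy + g₀² + K(h₀−h₁)², C = 10(E₀ + √E₀), κ₁(t) = 2/(1 + max{2, (1−h₀)/(1+h₀)}·exp(C + 2Kt)) and κ₂(t) = 2/(1 + max{2, (1+h₀)/(1−h₀)}·exp(C + 2Kt)). Then for every t ≥ 0 one has −1 + κ₁(t) ≤ h(t) ≤ 1 − κ₂(t). -/

import Mathlib

open Real Set MeasureTheory Filter

/-- A classical solution of the simplified fluid–particle interaction system on `[0,∞)`,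
with feedback constant `K ≥ 0` and target position `h₁ ∈ (-1,1)`.
`v t y` is the fluid velocity, `h t` the particle position; `vt`, `vy`, `vyy` are the
time derivative, the spatial derivative (for `y ≠ h t`) and the second spatial derivative
of `v`, while `vyL t`, `vyR t` are the one-sided spatial derivatives of `v t` at `y = h t`. -/
structure FluidParticleSol (K h₁ : ℝ) where
  v : ℝ → ℝ → ℝ
  h : ℝ → ℝ
  vt : ℝ → ℝ → ℝ
  vy : ℝ → ℝ → ℝ
  vyy : ℝ → ℝ → ℝ
  vyL : ℝ → ℝ
  vyR : ℝ → ℝ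
  hK : 0 ≤ K
  hh₁ : h₁ ∈ Set.Ioo (-1 : ℝ) 1
  h_in : ∀ t, 0 ≤ t → h t ∈ Set.Ioo (-1 : ℝ) 1
  h_C2 : ContDiff ℝ 2 h
  v_cont : ContinuousOn (fun p : ℝ × ℝ => v p.1 p.2) (Set.Ici 0 ×ˢ Set.Icc (-1) 1)
  hasDeriv_t : ∀ t, 0 ≤ t → ∀ y ∈ Set.Icc (-1 : ℝ) 1, HasDerivAt (fun s => v s y) (vt t y) t
  vt_cont : ∀ y ∈ Set.Icc (-1 : ℝ) 1, ContinuousOn (fun t => vt t y) (Set.Ici 0)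
  hasDeriv_y : ∀ t, 0 ≤ t → ∀ y ∈ Set.Ioo (-1 : ℝ) 1, y ≠ h t →
      HasDerivAt (fun x => v t x) (vy t y) y
  hasDeriv_yL : ∀ t, 0 ≤ t → HasDerivWithinAt (fun x => v t x) (vyL t) (Set.Iic (h t)) (h t)
  hasDeriv_yR : ∀ t, 0 ≤ t → HasDerivWithinAt (fun x => v t x) (vyR t) (Set.Ici (h t)) (h t)
  vy_contL : ∀ t, 0 ≤ t → ContinuousOn (fun y => vy t y) (Set.Ico (-1) (h t))
  vy_contR : ∀ t, 0 ≤ t → ContinuousOn (fun y => vy t y) (Set.Ioc (h t) 1)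
  vy_limL : ∀ t, 0 ≤ t →
      Filter.Tendsto (fun y => vy t y) (nhdsWithin (h t) (Set.Iio (h t))) (nhds (vyL t))
  vy_limR : ∀ t, 0 ≤ t →
      Filter.Tendsto (fun y => vy t y) (nhdsWithin (h t) (Set.Ioi (h t))) (nhds (vyR t))
  hasDeriv_yy : ∀ t, 0 ≤ t → ∀ y ∈ Set.Ioo (-1 : ℝ) 1, y ≠ h t →
      HasDerivAt (fun x => vy t x) (vyy t y) y
  pde : ∀ t, 0 ≤ t → ∀ y ∈ Set.Ioo (-1 : ℝ) 1, y ≠ h t →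
      vt t y + v t y * vy t y = vyy t y
  bc_left : ∀ t, 0 ≤ t → v t (-1) = 0
  bc_right : ∀ t, 0 ≤ t → v t 1 = 0
  ode1 : ∀ t, 0 ≤ t → deriv h t = v t (h t)
  ode2 : ∀ t, 0 ≤ t → deriv (deriv h) t = vyR t - vyL t + K * (h₁ - h t)

open Topology

/-- A continuous function all of whose backward difference quotients are asymptotically
nonpositive is nonincreasing between the endpoints. -/
lemma le_of_backward_slope_nonpos {f : ℝ → ℝ} {a b : ℝ} (hab : a ≤ b)
    (hf : ContinuousOn f (Icc a b))
    (h : ∀ t ∈ Ioc a b, ∀ η > 0, ∀ᶠ δ in 𝓝[>] (0 : ℝ), f t - f (t - δ) ≤ η * δ) :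
    f b ≤ f a := by
  by_contra! hlt
  have hab' : a < b := lt_of_le_of_ne hab (by rintro rfl; exact lt_irrefl _ hlt)
  set η := (f b - f a) / (2 * (b - a)) with hη
  have hba : 0 < b - a := by linarith
  have hηpos : 0 < η := by apply div_pos <;> linarith
  have hηeq : η * (b - a) = (f b - f a) / 2 := by rw [hη]; field_simp
  set F : ℝ → ℝ := fun t => f t - η * (t - a) with hF
  have hFc : ContinuousOn F (Icc a b) := by
    apply hf.sub; fun_prop
  have hcl : IsClosed (Icc a b ∩ F ⁻¹' (Ici (F b))) :=
    hFc.preimage_isClosed_of_isClosed isClosed_Icc isClosed_Ici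
  have hcomp : IsCompact (Icc a b ∩ F ⁻¹' (Ici (F b))) :=
    isCompact_Icc.of_isClosed_subset hcl inter_subset_left
  obtain ⟨t0, ⟨⟨ht1, ht2⟩, ht3⟩, hmin⟩ :=
    hcomp.exists_isLeast ⟨b, ⟨hab, le_rfl⟩, le_refl (F b)⟩
  have hFa : F a < F b := by simp only [hF]; linarith
  have ha0 : a < t0 := lt_of_le_of_ne ht1 (by rintro rfl; exact absurd ht3 (not_le.2 hFa))
  have hev := h t0 ⟨ha0, ht2⟩ η hηpos
  have hev2 : ∀ᶠ δ in 𝓝[>] (0 : ℝ), δ ∈ Ioo 0 (t0 - a) :=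
    Ioo_mem_nhdsGT (by linarith)
  obtain ⟨δ, h1, h2, h3⟩ := (hev.and hev2).exists
  have h4 : F b ≤ F t0 := ht3
  have h5 : F b ≤ F (t0 - δ) := by
    have : F t0 ≤ F (t0 - δ) := by simp only [hF]; linarith
    linarith
  have := hmin ⟨⟨by linarith, by linarith⟩, h5⟩
  linarith

/-- First and second order necessary conditions at an interior local maximum. -/
lemma IsLocalMax.deriv_conditions {f f' : ℝ → ℝ} {f2 x : ℝ} (hmax : IsLocalMax f x)
    (hf : ∀ᶠ y in 𝓝 x, HasDerivAt f (f' y) y) (hf' : HasDerivAt f' f2 x) :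
    f' x = 0 ∧ f2 ≤ 0 := by
  have h0 : f' x = 0 := hmax.hasDerivAt_eq_zero hf.self_of_nhds
  refine ⟨h0, ?_⟩
  by_contra! hpos
  have hEq : deriv f =ᶠ[𝓝 x] f' := hf.mono fun y hy => hy.deriv
  have hd2 : deriv (deriv f) x = f2 := by rw [hEq.deriv_eq, hf'.deriv]
  have hmin := isLocalMin_of_deriv_deriv_pos (f := f) (x₀ := x) (by rw [hd2]; exact hpos)
    (by rw [hEq.self_of_nhds, h0]) hf.self_of_nhds.continuousAt
  have hconst : f =ᶠ[𝓝 x] fun _ => f x := by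
    filter_upwards [hmax, hmin] with y h1 h2 using le_antisymm h1 h2
  have h1 : deriv f =ᶠ[𝓝 x] fun _ => 0 := by
    have := hconst.deriv
    simpa using this
  have := h1.deriv_eq
  rw [hd2] at this
  simp at this
  linarith

lemma HasDerivAt.nonneg_of_backward_le {f : ℝ → ℝ} {f' t : ℝ} (hf : HasDerivAt f f' t)
    (h : ∀ᶠ s in 𝓝[<] t, f s ≤ f t) : 0 ≤ f' := by
  have h1 := hf.hasDerivWithinAt (s := Iio t)
  rw [hasDerivWithinAt_iff_tendsto_slope' (by simp)] at h1
  refine ge_of_tendsto h1 ?_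
  filter_upwards [h, self_mem_nhdsWithin] with s hs hst
  rw [slope_def_field]
  have : s < t := hst
  exact div_nonneg_of_nonpos (by linarith) (by linarith)

set_option maxHeartbeats 1000000 in
/-- Comparison with a concave modulus: a solution of `v_t + σ v v_y = v_yy` between two
differentiable curves, with differentiable boundary values and Lipschitz initial data,
has slopes bounded above uniformly in time. -/
lemma exists_slope_bound_between_curves {v vt vy vyy : ℝ → ℝ → ℝ} {p q p' q' al be : ℝ → ℝ}
    {σ T N G Q M₀ c : ℝ} (hN0 : 0 ≤ N) (hG0 : 0 ≤ G) (hQ0 : 0 ≤ Q) (hM0 : 0 ≤ M₀) (hc : 0 < c)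
    (hv : Continuous fun z : ℝ × ℝ => v z.1 z.2) (hpc : Continuous p) (hqc : Continuous q)
    (hN : ∀ t ∈ Icc 0 T, ∀ y ∈ Icc (p t) (q t), |v t y| ≤ N) (hσ : |σ| ≤ 1)
    (hgap : ∀ t ∈ Icc 0 T, p t + c ≤ q t)
    (hR : ∀ t ∈ Icc 0 T, -1 ≤ p t ∧ q t ≤ 1)
    (hp : ∀ t ∈ Ioc 0 T, HasDerivAt p (p' t) t) (hp' : ∀ t ∈ Ioc 0 T, |p' t| ≤ Q)
    (hq : ∀ t ∈ Ioc 0 T, HasDerivAt q (q' t) t) (hq' : ∀ t ∈ Ioc 0 T, |q' t| ≤ Q)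
    (hal : ∀ t ∈ Ioc 0 T, HasDerivAt (fun s => v s (p s)) (al t) t)
    (hal' : ∀ t ∈ Ioc 0 T, |al t| ≤ G)
    (hbe : ∀ t ∈ Ioc 0 T, HasDerivAt (fun s => v s (q s)) (be t) t)
    (hbe' : ∀ t ∈ Ioc 0 T, |be t| ≤ G)
    (ht : ∀ t ∈ Ioc 0 T, ∀ y ∈ Ioo (p t) (q t), HasDerivAt (fun s => v s y) (vt t y) t)
    (hy : ∀ t ∈ Ioc 0 T, ∀ y ∈ Ioo (p t) (q t), HasDerivAt (fun x => v t x) (vy t y) y)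
    (hyy : ∀ t ∈ Ioc 0 T, ∀ y ∈ Ioo (p t) (q t), HasDerivAt (fun x => vy t x) (vyy t y) y)
    (pde : ∀ t ∈ Ioc 0 T, ∀ y ∈ Ioo (p t) (q t),
      vt t y + σ * (v t y * vy t y) = vyy t y)
    (h0 : ∀ x y, p 0 ≤ y → y ≤ x → x ≤ q 0 → v 0 x - v 0 y ≤ M₀ * (x - y)) :
    ∃ A, 0 ≤ A ∧ ∀ t ∈ Icc 0 T, ∀ x y, p t ≤ y → y ≤ x → x ≤ q t →
      v t x - v t y ≤ A * (x - y) := by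
  set L := N + Q + 1 with hL
  have hLpos : 0 < L := by positivity
  set m := G + M₀ + 2 * N / c + 1 with hm
  have hNc : 0 ≤ 2 * N / c := by positivity
  set A := m * exp (2 * L) with hA
  have hmpos : 0 < m := by positivity
  have hApos : 0 < A := by positivity
  set d : ℝ → ℝ := fun r => A * exp (-(L * r)) with hd
  set ψ : ℝ → ℝ := fun r => A / L * (1 - exp (-(L * r))) with hψ
  have hdm : ∀ r, r ≤ 2 → m ≤ d r := by
    intro r hr
    simp only [hd, hA]
    rw [mul_assoc, ← exp_add]
    have : 1 ≤ exp (2 * L + -(L * r)) := one_le_exp (by nlinarith)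
    nlinarith
  have hdpos : ∀ r, 0 < d r := fun r => by simp only [hd]; positivity
  have hψd : ∀ r, HasDerivAt ψ (d r) r := by
    intro r
    have h1 : HasDerivAt (fun r => exp (-(L * r))) (exp (-(L * r)) * (-(L * 1))) r :=
      ((hasDerivAt_id r).const_mul L).neg.exp
    have h2 := (h1.const_sub 1).const_mul (A / L)
    have e : A / L * (-(exp (-(L * r)) * (-(L * 1)))) = A * exp (-(L * r)) := by field_simp
    exact h2.congr_deriv e
  have hdd : ∀ r, HasDerivAt d (-(L * d r)) r := by
    intro r
    have h1 : HasDerivAt (fun r => exp (-(L * r))) (exp (-(L * r)) * (-(L * 1))) r :=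
      ((hasDerivAt_id r).const_mul L).neg.exp
    have e : A * (exp (-(L * r)) * (-(L * 1))) = -(L * (A * exp (-(L * r)))) := by ring
    exact (h1.const_mul A).congr_deriv e
  have hψm : ∀ r, 0 ≤ r → r ≤ 2 → m * r ≤ ψ r := by
    intro r hr hr2
    have h1 : r * d r ≤ ψ r := by
      have h2 : L * r + 1 ≤ exp (L * r) := add_one_le_exp _
      have h3 : exp (L * r) * exp (-(L * r)) = 1 := by rw [← exp_add]; simp
      have h4 : 0 < exp (-(L * r)) := exp_pos _
      have h5 : L * r * exp (-(L * r)) ≤ 1 - exp (-(L * r)) := by nlinarith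
      have h6 : r * d r = A / L * (L * r * exp (-(L * r))) := by
        simp only [hd]; field_simp
      rw [h6]
      exact mul_le_mul_of_nonneg_left h5 (by positivity)
    nlinarith [hdm r hr2]
  have hψA : ∀ r, ψ r ≤ A * r := by
    intro r
    have h2 : -(L * r) + 1 ≤ exp (-(L * r)) := add_one_le_exp _
    have h6 : A * r = A / L * (L * r) := by field_simp
    rw [h6]
    exact mul_le_mul_of_nonneg_left (by linarith) (by positivity)
  have hψ0 : ψ 0 = 0 := by simp [hψ]
  have hψc : Continuous ψ := continuous_iff_continuousAt.2 fun r => (hψd r).continuousAt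
  refine ⟨A, hApos.le, ?_⟩
  set K : Set (ℝ × ℝ × ℝ) :=
    {z | z.1 ∈ Icc 0 T ∧ p z.1 ≤ z.2.2 ∧ z.2.2 ≤ z.2.1 ∧ z.2.1 ≤ q z.1} with hK
  have hKc : IsCompact K := by
    refine (isCompact_Icc.prod (isCompact_Icc.prod isCompact_Icc)
      : IsCompact (Icc 0 T ×ˢ (Icc (-1 : ℝ) 1 ×ˢ Icc (-1 : ℝ) 1))).of_isClosed_subset ?_ ?_
    · refine (isClosed_Icc.preimage continuous_fst).inter (IsClosed.inter ?_ (IsClosed.inter ?_ ?_))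
      · exact isClosed_le (hpc.comp continuous_fst) (continuous_snd.comp continuous_snd)
      · exact isClosed_le (continuous_snd.comp continuous_snd) (continuous_fst.comp continuous_snd)
      · exact isClosed_le (continuous_fst.comp continuous_snd) (hqc.comp continuous_fst)
    · rintro ⟨t, x, y⟩ ⟨h1, h2, h3, h4⟩
      have := hR t h1
      simp only at h1 h2 h3 h4
      exact ⟨h1, ⟨by simp only; linarith, by simp only; linarith⟩,
        ⟨by simp only; linarith, by simp only; linarith⟩⟩
  set W : ℝ × ℝ × ℝ → ℝ := fun z => v z.1 z.2.1 - v z.1 z.2.2 - ψ (z.2.1 - z.2.2) with hW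
  have hWc : Continuous W := by
    have h1 : Continuous fun z : ℝ × ℝ × ℝ => v z.1 z.2.1 :=
      hv.comp (continuous_fst.prodMk (continuous_fst.comp continuous_snd))
    have h2 : Continuous fun z : ℝ × ℝ × ℝ => v z.1 z.2.2 :=
      hv.comp (continuous_fst.prodMk (continuous_snd.comp continuous_snd))
    exact (h1.sub h2).sub (hψc.comp (by fun_prop))
  suffices hWle : ∀ z ∈ K, W z ≤ 0 by
    intro t ht' x y h1 h2 h3
    have := hWle (t, x, y) ⟨ht', h1, h2, h3⟩
    have h4 := hψA (x - y)
    simp only [hW] at this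
    linarith
  by_contra! hcon
  obtain ⟨z1, hz1K, hz1⟩ := hcon
  obtain ⟨⟨t0, x0, y0⟩, hz0K, hmax⟩ := hKc.exists_isMaxOn ⟨z1, hz1K⟩ hWc.continuousOn
  have hW0 : 0 < W (t0, x0, y0) := lt_of_lt_of_le hz1 (hmax hz1K)
  obtain ⟨ht0, hpy, hyx, hxq⟩ := hz0K
  simp only at ht0 hpy hyx hxq
  have hr2 : x0 - y0 ≤ 2 := by have := hR t0 ht0; linarith
  have hyx' : y0 < x0 := by
    rcases hyx.lt_or_eq with h | h
    · exact h
    · subst h; simp [hW, hψ0] at hW0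
  have ht0' : t0 ∈ Ioc 0 T := by
    refine ⟨lt_of_le_of_ne ht0.1 ?_, ht0.2⟩
    rintro rfl
    have h1 := h0 x0 y0 hpy hyx hxq
    have h2 := hψm (x0 - y0) (by linarith) hr2
    simp only [hW] at hW0
    have : M₀ * (x0 - y0) ≤ m * (x0 - y0) :=
      mul_le_mul_of_nonneg_right (by rw [hm]; linarith) (by linarith)
    linarith
  set r := x0 - y0 with hr
  have hdr := hdpos r
  have hNx : |σ * v t0 x0| ≤ N := by
    rw [abs_mul]
    have := hN t0 ht0 x0 ⟨by linarith, hxq⟩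
    nlinarith [abs_nonneg σ, abs_nonneg (v t0 x0)]
  have hNy : |σ * v t0 y0| ≤ N := by
    rw [abs_mul]
    have := hN t0 ht0 y0 ⟨hpy, by linarith⟩
    nlinarith [abs_nonneg σ, abs_nonneg (v t0 y0)]
  have hx : ∃ (X : ℝ → ℝ) (X' ax : ℝ), X t0 = x0 ∧ HasDerivAt X X' t0 ∧
      HasDerivAt (fun s => v s (X s)) ax t0 ∧
      (∀ᶠ s in 𝓝 t0, s ≤ T → 0 ≤ s → X s ≤ q s) ∧
      (ax - d r * X' ≤ -((Q + 1) * d r) ∨ (x0 = q t0 ∧ ax - d r * X' ≤ G + Q * d r)) := by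
    rcases hxq.lt_or_eq with hlt | heq
    · have hin : x0 ∈ Ioo (p t0) (q t0) := ⟨by linarith, hlt⟩
      refine ⟨fun _ => x0, 0, vt t0 x0, rfl, hasDerivAt_const _ _, ht t0 ht0' x0 hin, ?_, ?_⟩
      · filter_upwards [hqc.continuousAt.eventually (lt_mem_nhds hlt)] with s hs _ _ using
          le_of_lt hs
      · left
        have hmx : IsLocalMax (fun x => v t0 x - ψ (x - y0)) x0 := by
          filter_upwards [Ioo_mem_nhds hyx' hlt] with x hx
          have := hmax (show (t0, x, y0) ∈ K from ⟨ht0, hpy, hx.1.le, hx.2.le⟩)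
          simp only [hW, mem_ofPred_eq] at this
          linarith
        have hcond := hmx.deriv_conditions (f' := fun x => vy t0 x - d (x - y0))
          (f2 := vyy t0 x0 - (-(L * d r))) ?_ ?_
        · have hpde := pde t0 ht0' x0 hin
          have h1 : vy t0 x0 = d r := by have := hcond.1; linarith
          have h2 := hcond.2
          have h3 := abs_le.1 hNx
          rw [h1] at hpde
          nlinarith
        · filter_upwards [Ioo_mem_nhds hin.1 hin.2] with x hx
          exact (hy t0 ht0' x hx).sub (HasDerivAt.comp_sub_const x y0 (hψd _))
        · exact (hyy t0 ht0' x0 hin).sub (HasDerivAt.comp_sub_const x0 y0 (hdd _))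
    · refine ⟨q, q' t0, be t0, heq.symm, hq t0 ht0', hbe t0 ht0', ?_, Or.inr ⟨heq, ?_⟩⟩
      · exact Eventually.of_forall fun s _ _ => le_rfl
      · have h1 := abs_le.1 (hbe' t0 ht0')
        have h2 := abs_le.1 (hq' t0 ht0')
        nlinarith
  have hyc : ∃ (Y : ℝ → ℝ) (Y' ay : ℝ), Y t0 = y0 ∧ HasDerivAt Y Y' t0 ∧
      HasDerivAt (fun s => v s (Y s)) ay t0 ∧
      (∀ᶠ s in 𝓝 t0, s ≤ T → 0 ≤ s → p s ≤ Y s) ∧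
      (-ay + d r * Y' ≤ -((Q + 1) * d r) ∨ (y0 = p t0 ∧ -ay + d r * Y' ≤ G + Q * d r)) := by
    rcases hpy.lt_or_eq with hlt | heq
    · have hin : y0 ∈ Ioo (p t0) (q t0) := ⟨hlt, by linarith⟩
      refine ⟨fun _ => y0, 0, vt t0 y0, rfl, hasDerivAt_const _ _, ht t0 ht0' y0 hin, ?_, ?_⟩
      · filter_upwards [hpc.continuousAt.eventually (gt_mem_nhds hlt)] with s hs _ _ using
          le_of_lt hs
      · left
        have hmx : IsLocalMax (fun y => -v t0 y - ψ (x0 - y)) y0 := by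
          filter_upwards [Ioo_mem_nhds hlt hyx'] with y hy
          have := hmax (show (t0, x0, y) ∈ K from ⟨ht0, hy.1.le, hy.2.le, hxq⟩)
          simp only [hW, mem_ofPred_eq] at this
          linarith
        have hcond := hmx.deriv_conditions (f' := fun y => -vy t0 y - -d (x0 - y))
          (f2 := -vyy t0 y0 - - -(-(L * d r))) ?_ ?_
        · have hpde := pde t0 ht0' y0 hin
          have h1 : vy t0 y0 = d r := by have := hcond.1; linarith
          have h2 := hcond.2
          have h3 := abs_le.1 hNy
          rw [h1] at hpde
          nlinarith
        · filter_upwards [Ioo_mem_nhds hin.1 hin.2] with y hy'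
          exact (hy t0 ht0' y hy').neg.sub (HasDerivAt.comp_const_sub x0 y (hψd _))
        · exact (hyy t0 ht0' y0 hin).neg.sub (HasDerivAt.comp_const_sub x0 y0 (hdd _)).neg
    · refine ⟨p, p' t0, al t0, heq, hp t0 ht0', hal t0 ht0', ?_, Or.inr ⟨heq.symm, ?_⟩⟩
      · exact Eventually.of_forall fun s _ _ => le_rfl
      · have h1 := abs_le.1 (hal' t0 ht0')
        have h2 := abs_le.1 (hp' t0 ht0')
        nlinarith
  obtain ⟨X, X', ax, hX0, hX', hax, hXq, hXc⟩ := hx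
  obtain ⟨Y, Y', ay, hY0, hY', hay, hYp, hYc⟩ := hyc
  have hder : HasDerivAt (fun s => W (s, X s, Y s)) (ax - ay - d r * (X' - Y')) t0 := by
    have h1 : HasDerivAt ψ (d r) (X t0 - Y t0) := by rw [hX0, hY0]; exact hψd _
    have h2 : HasDerivAt (fun s => ψ (X s - Y s)) (d r * (X' - Y')) t0 :=
      HasDerivAt.comp (h₂ := ψ) t0 h1 (hX'.sub hY')
    exact (hax.sub hay).sub h2
  have hnn := hder.nonneg_of_backward_le (by
    have h1 : ∀ᶠ s in 𝓝 t0, Y s < X s := by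
      have : Y t0 < X t0 := by rw [hX0, hY0]; exact hyx'
      exact hY'.continuousAt.eventually_lt hX'.continuousAt this
    have h2 : ∀ᶠ s in 𝓝 t0, 0 < s := lt_mem_nhds ht0'.1
    filter_upwards [nhdsWithin_le_nhds h1, nhdsWithin_le_nhds h2, nhdsWithin_le_nhds hXq,
      nhdsWithin_le_nhds hYp, self_mem_nhdsWithin] with s a1 a2 a3 a4 a5
    have a5' : s < t0 := a5
    have hsT : s ≤ T := by linarith [ht0.2]
    have := hmax (show (s, X s, Y s) ∈ K from ⟨⟨a2.le, hsT⟩, a4 hsT a2.le, a1.le, a3 hsT a2.le⟩)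
    rw [hX0, hY0]
    exact this)
  have hdG : G < d r := by
    have := hdm r hr2
    rw [hm] at this
    linarith
  rcases hXc with h1 | ⟨hxq', h1⟩ <;> rcases hYc with h2 | ⟨hyp', h2⟩
  · nlinarith
  · nlinarith
  · nlinarith
  · have h3 := hψm r (by linarith) hr2
    have h4 := hgap t0 ht0
    have h5 := abs_le.1 (hN t0 ht0 x0 ⟨by linarith, hxq⟩)
    have h6 := abs_le.1 (hN t0 ht0 y0 ⟨hpy, by linarith⟩)
    simp only [hW] at hW0
    have h7 : m * c ≤ m * r := mul_le_mul_of_nonneg_left (by rw [hr]; linarith) hmpos.le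
    have h8 : 2 * N ≤ m * c := by
      have : 2 * N = 2 * N / c * c := by field_simp
      rw [this]
      exact mul_le_mul_of_nonneg_right (by rw [hm]; linarith) hc.le
    linarith

lemma HasDerivAt.of_squeeze {f l u : ℝ → ℝ} {x d : ℝ} (hl : HasDerivAt l d x)
    (hu : HasDerivAt u d x) (hlx : l x = f x) (hux : u x = f x)
    (hlf : ∀ᶠ y in 𝓝 x, l y ≤ f y) (hfu : ∀ᶠ y in 𝓝 x, f y ≤ u y) : HasDerivAt f d x := by
  rw [hasDerivAt_iff_isLittleO] at hl hu ⊢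
  rw [Asymptotics.isLittleO_iff] at hl hu ⊢
  intro c hc
  filter_upwards [hl hc, hu hc, hlf, hfu] with y h1 h2 h3 h4
  rw [Real.norm_eq_abs, abs_le] at h1 h2 ⊢
  constructor <;> linarith [h1.1, h2.2]

lemma hasDerivAt_primitive {f : ℝ → ℝ} (hf : Continuous f) (a x : ℝ) :
    HasDerivAt (fun y => ∫ s in a..y, f s) (f x) x :=
  (hf.integral_hasStrictDerivAt a x).hasDerivAt

lemma continuous_primitive {f : ℝ → ℝ} (hf : Continuous f) (a : ℝ) :
    Continuous fun y => ∫ s in a..y, f s :=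
  continuous_iff_continuousAt.2 fun x => (hasDerivAt_primitive hf a x).continuousAt

/-- A continuous function touched from below at each interior point by solutions of the
differential inequality `q + σ u w' ≤ w''` lies below its chord once the potential
`∬ q + σ ∫ u² / 2` is subtracted. -/
lemma le_chord_of_touching_below {u q : ℝ → ℝ} {α β σ : ℝ} (hαβ : α < β) (hu : Continuous u)
    (hq : Continuous q)
    (h : ∀ y ∈ Ioo α β, ∃ (w wy : ℝ → ℝ) (wyy : ℝ), (∀ᶠ z in 𝓝 y, HasDerivAt w (wy z) z) ∧
      HasDerivAt wy wyy y ∧ (∀ᶠ z in 𝓝 y, w z - w y ≤ u z - u y) ∧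
      q y + σ * (u y * wy y) ≤ wyy) {Z : ℝ → ℝ}
    (hZ : Z = fun y => u y - ∫ x in α..y, ((∫ s in α..x, q s) + σ * (u x ^ 2 / 2)))
    {y : ℝ} (hy : y ∈ Icc α β) :
    (β - α) * Z y ≤ (β - y) * Z α + (y - α) * Z β := by
  have hQ : ∀ x, HasDerivAt (fun y => ∫ s in α..y, q s) (q x) x := hasDerivAt_primitive hq α
  have hQc : Continuous fun y => ∫ s in α..y, q s :=
    continuous_iff_continuousAt.2 fun x => (hQ x).continuousAt
  set R : ℝ → ℝ := fun x => (∫ s in α..x, q s) + σ * (u x ^ 2 / 2) with hR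
  have hRc : Continuous R := hQc.add (by fun_prop)
  set P : ℝ → ℝ := fun y => ∫ x in α..y, R x with hP
  have hPd : ∀ x, HasDerivAt P (R x) x := hasDerivAt_primitive hRc α
  have hPc : Continuous P := continuous_iff_continuousAt.2 fun x => (hPd x).continuousAt
  have hZc : Continuous Z := by rw [hZ]; exact hu.sub hPc
  by_contra! hcon
  have hy' : y ∈ Ioo α β := by
    refine ⟨lt_of_le_of_ne hy.1 ?_, lt_of_le_of_ne hy.2 ?_⟩
    · rintro rfl; simp at hcon
    · rintro rfl; simp at hcon
  obtain ⟨η, hη, hη'⟩ : ∃ η > 0, η * ((y - α) * (β - y)) <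
      (β - α) * Z y - ((β - y) * Z α + (y - α) * Z β) := by
    have h1 : 0 < (y - α) * (β - y) := mul_pos (by linarith [hy'.1]) (by linarith [hy'.2])
    refine ⟨((β - α) * Z y - ((β - y) * Z α + (y - α) * Z β)) / ((y - α) * (β - y)) / 2,
      by have : 0 < (β - α) * Z y - ((β - y) * Z α + (y - α) * Z β) := by linarith
         positivity, ?_⟩
    have h2 := h1.ne'
    rw [div_div, div_mul_eq_mul_div, div_lt_iff₀ (by positivity)]
    have : 0 < (β - α) * Z y - ((β - y) * Z α + (y - α) * Z β) := by linarith
    nlinarith [mul_pos this h1]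
  set κ : ℝ → ℝ := fun s => (β - s) * Z α + (s - α) * Z β + η * ((s - α) * (β - s)) with hκ
  set F : ℝ → ℝ := fun s => (β - α) * Z s - κ s with hF
  have hFc : Continuous F := by simp only [hF, hκ]; fun_prop
  obtain ⟨s, hs, hmax⟩ := isCompact_Icc.exists_isMaxOn ⟨y, hy⟩ hFc.continuousOn
  have hFy : 0 < F y := by simp only [hF, hκ]; linarith
  have hFs : 0 < F s := lt_of_lt_of_le hFy (hmax hy)
  have hs' : s ∈ Ioo α β := by
    refine ⟨lt_of_le_of_ne hs.1 ?_, lt_of_le_of_ne hs.2 ?_⟩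
    · rintro rfl; simp [hF, hκ] at hFs
    · rintro rfl; simp [hF, hκ] at hFs
  obtain ⟨w, wy, wyy, hw, hwy, hwu, hineq⟩ := h s hs'
  set κ' : ℝ → ℝ := fun s => -Z α + Z β + η * ((β - s) - (s - α)) with hκ'
  have hκd : ∀ r, HasDerivAt κ (κ' r) r := by
    intro r
    have h1 := ((hasDerivAt_id' r).const_sub β).mul_const (Z α)
    have h2 := ((hasDerivAt_id' r).sub_const α).mul_const (Z β)
    have h3 := ((((hasDerivAt_id' r).sub_const α).fun_mul
      ((hasDerivAt_id' r).const_sub β))).const_mul η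
    refine ((h1.add h2).add h3).congr_deriv ?_
    simp only [hκ']; ring
  have hκ'd : ∀ r, HasDerivAt κ' (-(2 * η)) r := by
    intro r
    have h3 := ((((hasDerivAt_id' r).const_sub β).fun_sub
      ((hasDerivAt_id' r).sub_const α))).const_mul η
    refine (h3.const_add (-Z α + Z β)).congr_deriv ?_
    ring
  have hba : 0 < β - α := by linarith
  have hsmax : ∀ᶠ z in 𝓝 s, F z ≤ F s := by
    filter_upwards [Ioo_mem_nhds hs'.1 hs'.2] with z hz
    exact hmax (Ioo_subset_Icc_self hz)
  have hZv : ∀ z, Z z = u z - P z := fun z => by rw [hZ]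
  have hlm : IsLocalMax (fun z => (β - α) * (w z - P z) - κ z) s := by
    filter_upwards [hsmax, hwu] with z h1 h2
    simp only [hF, hZv] at h1
    nlinarith
  have hwd : ∀ᶠ z in 𝓝 s, HasDerivAt (fun z => (β - α) * (w z - P z) - κ z)
      ((β - α) * (wy z - R z) - κ' z) z := by
    filter_upwards [hw] with z hz
    exact ((hz.sub (hPd z)).const_mul (β - α)).sub (hκd z)
  have hus : HasDerivAt u (wy s) s := by
    have hfirst : (β - α) * (wy s - R s) - κ' s = 0 := hlm.hasDerivAt_eq_zero hwd.self_of_nhds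
    have hup : HasDerivAt (fun z => u s - P s + P z + (κ z - κ s) / (β - α))
        (R s + κ' s / (β - α)) s :=
      ((hPd s).const_add _).add (((hκd s).sub_const _).div_const _)
    have he : R s + κ' s / (β - α) = wy s := by field_simp; linarith
    rw [he] at hup
    refine HasDerivAt.of_squeeze (l := fun z => u s + (w z - w s))
      ((hw.self_of_nhds.sub_const _).const_add _) hup (by simp) (by simp) ?_ ?_
    · filter_upwards [hwu] with z hz using by linarith
    · filter_upwards [hsmax] with z hz
      simp only [hF, hZv] at hz
      have : (β - α) * (u z - P z - (u s - P s)) ≤ κ z - κ s := by linarith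
      rw [← le_div_iff₀' hba] at this
      linarith
  have hRd : HasDerivAt R (q s + σ * (u s * wy s)) s := by
    refine ((hQ s).add (((hus.fun_pow 2).div_const 2).const_mul σ)).congr_deriv ?_
    push_cast; ring
  have h2 := (hlm.deriv_conditions hwd (((hwy.sub hRd).const_mul (β - α)).sub (hκ'd s))).2
  nlinarith

/-- Sup-convolution in the first variable. -/
lemma exists_sup_convolution {v : ℝ → ℝ → ℝ} (hv : Continuous fun z : ℝ × ℝ => v z.1 z.2)
    {a b : ℝ} (hab : a ≤ b) (ε : ℝ) :
    ∃ u : ℝ → ℝ → ℝ, (Continuous fun z : ℝ × ℝ => u z.1 z.2) ∧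
      (∀ t y, ∀ s ∈ Icc a b, v s y - (t - s) ^ 2 / (2 * ε) ≤ u t y) ∧
      ∀ t y, ∃ s ∈ Icc a b, u t y = v s y - (t - s) ^ 2 / (2 * ε) := by
  set f : ℝ × ℝ → ℝ → ℝ := fun z s => v s z.2 - (z.1 - s) ^ 2 / (2 * ε) with hf
  have hfc : Continuous fun p : (ℝ × ℝ) × ℝ => f p.1 p.2 := by
    have h1 : Continuous fun p : (ℝ × ℝ) × ℝ => v p.2 p.1.2 :=
      hv.comp (continuous_snd.prodMk (continuous_snd.comp continuous_fst))
    exact h1.sub (by fun_prop)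
  have hfz : ∀ z, ContinuousOn (f z) (Icc a b) := fun z =>
    (hfc.comp (continuous_const.prodMk continuous_id)).continuousOn
  refine ⟨fun t y => sSup (f (t, y) '' Icc a b), ?_, ?_, ?_⟩
  · exact isCompact_Icc.continuous_sSup hfc
  · intro t y s hs
    exact le_csSup (isCompact_Icc.image_of_continuousOn (hfz _)).bddAbove (mem_image_of_mem _ hs)
  · intro t y
    obtain ⟨s, hs, h⟩ := isCompact_Icc.exists_sSup_image_eq (nonempty_Icc.2 hab) (hfz (t, y))
    exact ⟨s, hs, h⟩

/-- Gap between a function and its chord over `[α, β]` at `y`, scaled by `β - α`. -/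
def chordGap (α β y : ℝ) (f : ℝ → ℝ) : ℝ := (β - y) * f α + (y - α) * f β - (β - α) * f y

lemma abs_chordGap_sub_le {α β y θ : ℝ} {f g : ℝ → ℝ} (hy : y ∈ Icc α β)
    (h : ∀ x ∈ Icc α β, |f x - g x| ≤ θ) :
    |chordGap α β y f - chordGap α β y g| ≤ 2 * (β - α) * θ := by
  have hαβ : α ≤ β := hy.1.trans hy.2
  have h1 := abs_le.1 (h α ⟨le_rfl, hαβ⟩)
  have h2 := abs_le.1 (h β ⟨hαβ, le_rfl⟩)
  have h3 := abs_le.1 (h y hy)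
  have e : chordGap α β y f - chordGap α β y g = (β - y) * (f α - g α) +
    (y - α) * (f β - g β) - (β - α) * (f y - g y) := by simp only [chordGap]; ring
  have a1 : 0 ≤ β - y := by linarith [hy.2]
  have a2 : 0 ≤ y - α := by linarith [hy.1]
  have a3 : 0 ≤ β - α := by linarith
  rw [e, abs_le]
  constructor <;> nlinarith [mul_le_mul_of_nonneg_left h1.1 a1, mul_le_mul_of_nonneg_left h1.2 a1,
    mul_le_mul_of_nonneg_left h2.1 a2, mul_le_mul_of_nonneg_left h2.2 a2,
    mul_le_mul_of_nonneg_left h3.1 a3, mul_le_mul_of_nonneg_left h3.2 a3]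

lemma abs_primitive_sub_le {α β θ : ℝ} {f g : ℝ → ℝ} (hf : Continuous f) (hg : Continuous g)
    (h : ∀ x ∈ Icc α β, |f x - g x| ≤ θ) {x : ℝ} (hx : x ∈ Icc α β) :
    |(∫ s in α..x, f s) - ∫ s in α..x, g s| ≤ (β - α) * θ := by
  rw [← intervalIntegral.integral_sub (hf.intervalIntegrable _ _) (hg.intervalIntegrable _ _)]
  have hθ : 0 ≤ θ := (abs_nonneg _).trans (h x hx)
  have h1 := intervalIntegral.norm_integral_le_of_norm_le_const (a := α) (b := x) (C := θ)
    (f := fun s => f s - g s) (fun s hs => by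
      rw [uIoc_of_le hx.1] at hs
      exact h s ⟨hs.1.le, hs.2.trans hx.2⟩)
  rw [Real.norm_eq_abs, abs_of_nonneg (by linarith [hx.1] : 0 ≤ x - α)] at h1
  refine h1.trans ?_
  nlinarith [hx.2]

lemma continuous_primitive_param {f : ℝ → ℝ → ℝ} (hf : Continuous fun z : ℝ × ℝ => f z.1 z.2)
    (a : ℝ) : Continuous fun z : ℝ × ℝ => ∫ s in a..z.2, f z.1 s := by
  have h : Continuous (Function.uncurry fun (z : ℝ × ℝ) (s : ℝ) => f z.1 s) :=
    hf.comp ((continuous_fst.comp continuous_fst).prodMk continuous_snd)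
  exact intervalIntegral.continuous_parametric_intervalIntegral_of_continuous h continuous_snd

lemma continuous_slice {f : ℝ → ℝ → ℝ} (hf : Continuous fun z : ℝ × ℝ => f z.1 z.2) (t : ℝ) :
    Continuous (f t) :=
  hf.comp (continuous_const.prodMk continuous_id)

lemma continuous_slice_left {f : ℝ → ℝ → ℝ} (hf : Continuous fun z : ℝ × ℝ => f z.1 z.2)
    (y : ℝ) : Continuous fun t => f t y :=
  hf.comp (continuous_id.prodMk continuous_const)

lemma continuous_chordGap {f : ℝ → ℝ → ℝ} (hf : Continuous fun z : ℝ × ℝ => f z.1 z.2)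
    (α β y : ℝ) : Continuous fun t => chordGap α β y (f t) := by
  have := continuous_slice_left hf
  have h1 := this α
  have h2 := this β
  have h3 := this y
  simp only [chordGap]
  fun_prop

lemma exists_approx_backward_chordGap_le {v vt vy vyy : ℝ → ℝ → ℝ}
    {a b t₁ t₂ α β σ N M θ : ℝ} (hv : Continuous fun z : ℝ × ℝ => v z.1 z.2)
    (ha : a < t₁) (h₁₂ : t₁ ≤ t₂) (hb : t₂ < b) (hαβ : α < β) (hσ : |σ| ≤ 1) (hθ : 0 < θ)
    (hN : ∀ s ∈ Icc a b, ∀ y ∈ Icc α β, |v s y| ≤ N)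
    (hM : ∀ s ∈ Ioo a b, ∀ y ∈ Ioo α β, |vy s y| ≤ M)
    (hvt : ∀ s ∈ Ioo a b, ∀ y ∈ Ioo α β, HasDerivAt (fun r => v r y) (vt s y) s)
    (hvy : ∀ s ∈ Ioo a b, ∀ y ∈ Ioo α β, HasDerivAt (fun x => v s x) (vy s y) y)
    (hvyy : ∀ s ∈ Ioo a b, ∀ y ∈ Ioo α β, HasDerivAt (fun x => vy s x) (vyy s y) y)
    (pde : ∀ s ∈ Ioo a b, ∀ y ∈ Ioo α β, vt s y + σ * (v s y * vy s y) = vyy s y) :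
    ∃ u : ℝ → ℝ → ℝ, (Continuous fun z : ℝ × ℝ => u z.1 z.2) ∧
      (∀ t ∈ Icc t₁ t₂, ∀ y ∈ Icc α β, v t y ≤ u t y ∧ u t y ≤ v t y + θ ∧ |u t y| ≤ N) ∧
      ∃ ε > 0, ∀ t ∈ Icc t₁ t₂, ∀ δ > 0, ∀ y ∈ Icc α β,
        chordGap α β y (fun x => ∫ r in α..x, ∫ p in α..r, u t p) -
          chordGap α β y (fun x => ∫ r in α..x, ∫ p in α..r, u (t - δ) p) ≤
        δ * (chordGap α β y (u t) - σ * chordGap α β y (fun x => ∫ r in α..x, u t r ^ 2 / 2) +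
          (θ * M + δ / (2 * ε)) * chordGap α β y (fun x => (x - α) ^ 2 / 2)) := by
  have hab : a ≤ b := by linarith
  have hN0 : 0 ≤ N := (abs_nonneg _).trans (hN a ⟨le_rfl, hab⟩ α ⟨le_rfl, hαβ.le⟩)
  obtain ⟨ρ, hρ, hρ'⟩ : ∃ ρ > 0, ∀ s ∈ Icc a b, ∀ t ∈ Icc a b, |s - t| < ρ → ∀ y ∈ Icc α β,
      |v s y - v t y| < θ := by
    have huc := (isCompact_Icc.prod isCompact_Icc : IsCompact (Icc a b ×ˢ Icc α β)
      ).uniformContinuousOn_of_continuous hv.continuousOn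
    rw [Metric.uniformContinuousOn_iff] at huc
    obtain ⟨ρ, hρ, h⟩ := huc θ hθ
    refine ⟨ρ, hρ, fun s hs t ht hst y hy => ?_⟩
    have := h (s, y) ⟨hs, hy⟩ (t, y) ⟨ht, hy⟩ (by
      rw [Prod.dist_eq, dist_self, max_eq_left dist_nonneg, Real.dist_eq]; exact hst)
    rwa [Real.dist_eq] at this
  obtain ⟨ρ₀, hρ₀, hρ₁, hρ₂, hρ₃⟩ : ∃ ρ₀ > 0, ρ₀ ≤ ρ ∧ ρ₀ ≤ t₁ - a ∧ ρ₀ ≤ b - t₂ := by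
    refine ⟨min ρ (min (t₁ - a) (b - t₂)), ?_, min_le_left _ _,
      (min_le_right _ _).trans (min_le_left _ _), (min_le_right _ _).trans (min_le_right _ _)⟩
    exact lt_min hρ (lt_min (by linarith) (by linarith))
  obtain ⟨ε, hε, hε'⟩ : ∃ ε > 0, 4 * N * ε < ρ₀ ^ 2 := by
    refine ⟨ρ₀ ^ 2 / (4 * (N + 1)), by positivity, ?_⟩
    rw [mul_div_assoc', div_lt_iff₀ (by positivity)]
    nlinarith [pow_pos hρ₀ 2]
  obtain ⟨u, huc, hule, hueq⟩ := exists_sup_convolution hv hab ε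
  have hmem : ∀ t ∈ Icc t₁ t₂, t ∈ Icc a b := fun t ht => ⟨by linarith [ht.1], by linarith [ht.2]⟩
  have hvu : ∀ t ∈ Icc t₁ t₂, ∀ y, v t y ≤ u t y := by
    intro t ht y
    have := hule t y t (hmem t ht)
    simpa using this
  have hstar : ∀ t ∈ Icc t₁ t₂, ∀ y ∈ Icc α β, ∃ s ∈ Ioo a b,
      u t y = v s y - (t - s) ^ 2 / (2 * ε) ∧ |v s y - v t y| < θ ∧ u t y ≤ v s y := by
    intro t ht y hy
    obtain ⟨s, hs, he⟩ := hueq t y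
    have h1 := hvu t ht y
    have h2 := abs_le.1 (hN s hs y hy)
    have h3 := abs_le.1 (hN t (hmem t ht) y hy)
    have h4 : (t - s) ^ 2 / (2 * ε) ≤ 2 * N := by linarith
    rw [div_le_iff₀ (by positivity)] at h4
    have h5 : |t - s| < ρ₀ := by
      refine abs_lt_of_sq_lt_sq ?_ hρ₀.le
      nlinarith
    have h6 := abs_lt.1 h5
    have h7 : 0 ≤ (t - s) ^ 2 / (2 * ε) := by positivity
    refine ⟨s, ⟨by linarith [ht.1, h6.2], by linarith [ht.2, h6.1]⟩, he, ?_, by linarith⟩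
    exact hρ' s hs t (hmem t ht) (by rw [abs_sub_comm]; linarith) y hy
  refine ⟨u, huc, ?_, ε, hε, ?_⟩
  · intro t ht y hy
    obtain ⟨s, hs, he, h1, h2⟩ := hstar t ht y hy
    have h3 := abs_lt.1 h1
    have h4 := hvu t ht y
    have h5 := abs_le.1 (hN s (Ioo_subset_Icc_self hs) y hy)
    have h6 := abs_le.1 (hN t (hmem t ht) y hy)
    exact ⟨h4, by linarith, abs_le.2 ⟨by linarith, by linarith⟩⟩
  intro t ht δ hδ y hy
  set κ := θ * M + δ / (2 * ε) with hκ
  set q : ℝ → ℝ := fun x => (u t x - u (t - δ) x) / δ - κ with hq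
  have huct := continuous_slice huc
  have hqc : Continuous q := by
    have h1 := huct t
    have h2 := huct (t - δ)
    simp only [hq]; fun_prop
  have hkey := le_chord_of_touching_below (σ := σ) hαβ (huct t) hqc (fun z hz => by
    obtain ⟨s, hs, he, h1, h2⟩ := hstar t ht z (Ioo_subset_Icc_self hz)
    refine ⟨v s, vy s, vyy s z, ?_, hvyy s hs z hz, ?_, ?_⟩
    · filter_upwards [Ioo_mem_nhds hz.1 hz.2] with x hx using hvy s hs x hx
    · refine Eventually.of_forall fun x => ?_
      have := hule t x s (Ioo_subset_Icc_self hs)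
      linarith
    · have hD : vt s z + (t - s) / ε = 0 := by
        have hlm : IsLocalMax (fun r => v r z - (t - r) ^ 2 / (2 * ε)) s := by
          filter_upwards [Ioo_mem_nhds hs.1 hs.2] with r hr
          have := hule t z r (Ioo_subset_Icc_self hr)
          linarith
        have hd : HasDerivAt (fun r => v r z - (t - r) ^ 2 / (2 * ε))
            (vt s z + (t - s) / ε) s := by
          have h3 := (((hasDerivAt_id' s).const_sub t).fun_pow 2).div_const (2 * ε)
          refine ((hvt s hs z hz).sub h3).congr_deriv ?_
          push_cast; field_simp; ring
        exact hlm.hasDerivAt_eq_zero hd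
      have hback : (u t z - u (t - δ) z) / δ ≤ vt s z + δ / (2 * ε) := by
        have h3 := hule (t - δ) z s (Ioo_subset_Icc_self hs)
        rw [div_le_iff₀ hδ, he]
        have h4 : vt s z = -((t - s) / ε) := by linarith
        have e : (vt s z + δ / (2 * ε)) * δ =
            (t - δ - s) ^ 2 / (2 * ε) - (t - s) ^ 2 / (2 * ε) := by
          rw [h4]; field_simp; ring
        rw [e]; linarith
      have herr : σ * (u t z * vy s z) - σ * (v s z * vy s z) ≤ θ * M := by
        have h3 : |u t z - v s z| ≤ θ := by
          have := hvu t ht z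
          have := abs_lt.1 h1
          rw [abs_le]; constructor <;> linarith
        have h4 := hM s hs z hz
        have e : σ * (u t z * vy s z) - σ * (v s z * vy s z) =
          σ * ((u t z - v s z) * vy s z) := by ring
        rw [e]
        refine (le_abs_self _).trans ?_
        rw [abs_mul, abs_mul]
        calc |σ| * (|u t z - v s z| * |vy s z|) ≤ 1 * (θ * M) := by gcongr
          _ = θ * M := one_mul _
      have := pde s hs z hz
      simp only [hq]
      linarith) rfl hy
  have hut2 : Continuous fun x => ∫ p in α..x, u t p :=
    continuous_primitive (huct t) α
  have hud2 : Continuous fun x => ∫ p in α..x, u (t - δ) p :=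
    continuous_primitive (huct (t - δ)) α
  have hsq : Continuous fun x => u t x ^ 2 / 2 := by have := huct t; fun_prop
  have hqI : ∀ x, ∫ s in α..x, q s =
      ((∫ s in α..x, u t s) - ∫ s in α..x, u (t - δ) s) / δ - κ * (x - α) := by
    intro x
    simp only [hq]
    have i1 := (huct t).intervalIntegrable (μ := volume) α x
    have i2 := (huct (t - δ)).intervalIntegrable (μ := volume) α x
    rw [intervalIntegral.integral_sub ((i1.sub i2).div_const _) (by simp),
      intervalIntegral.integral_div, intervalIntegral.integral_sub i1 i2]
    simp
    ring
  have hZe : ∀ x, u t x - ∫ x in α..x, ((∫ s in α..x, q s) + σ * (u t x ^ 2 / 2)) =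
      u t x - (((∫ r in α..x, ∫ p in α..r, u t p) - ∫ r in α..x, ∫ p in α..r, u (t - δ) p) / δ
        - κ * ((x - α) ^ 2 / 2)) - σ * ∫ r in α..x, u t r ^ 2 / 2 := by
    intro x
    simp only [hqI]
    have i1 := hut2.intervalIntegrable (μ := volume) α x
    have i2 := hud2.intervalIntegrable (μ := volume) α x
    have i3 := hsq.intervalIntegrable (μ := volume) α x
    have i4 : IntervalIntegrable (fun x => κ * (x - α)) volume α x :=
      (by fun_prop : Continuous fun x => κ * (x - α)).intervalIntegrable _ _
    rw [intervalIntegral.integral_add (((i1.sub i2).div_const _).sub i4) (i3.const_mul _),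
      intervalIntegral.integral_sub ((i1.sub i2).div_const _) i4,
      intervalIntegral.integral_div, intervalIntegral.integral_sub i1 i2,
      intervalIntegral.integral_const_mul, intervalIntegral.integral_const_mul,
      intervalIntegral.integral_comp_sub_right (fun x => x)]
    simp
    ring
  simp only [hZe] at hkey
  have hfin : 0 ≤ chordGap α β y (u t) - (chordGap α β y (fun x => ∫ r in α..x, ∫ p in α..r, u t p)
      - chordGap α β y (fun x => ∫ r in α..x, ∫ p in α..r, u (t - δ) p)) / δ
      + κ * chordGap α β y (fun x => (x - α) ^ 2 / 2)
      - σ * chordGap α β y (fun x => ∫ r in α..x, u t r ^ 2 / 2) := by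
    simp only [chordGap]
    field_simp
    field_simp at hkey
    linarith
  have h2 : (chordGap α β y (fun x => ∫ r in α..x, ∫ p in α..r, u t p)
      - chordGap α β y (fun x => ∫ r in α..x, ∫ p in α..r, u (t - δ) p)) / δ ≤
      chordGap α β y (u t) + κ * chordGap α β y (fun x => (x - α) ^ 2 / 2)
      - σ * chordGap α β y (fun x => ∫ r in α..x, u t r ^ 2 / 2) := by linarith
  rw [div_le_iff₀ hδ] at h2
  linarith

lemma HasDerivAt.eventually_abs_backward_sub_le {f : ℝ → ℝ} {f' t : ℝ} (hf : HasDerivAt f f' t)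
    {η : ℝ} (hη : 0 < η) : ∀ᶠ δ in 𝓝[>] (0 : ℝ), |f t - f (t - δ) - δ * f'| ≤ η * δ := by
  rw [hasDerivAt_iff_isLittleO, Asymptotics.isLittleO_iff] at hf
  have h1 : Tendsto (fun δ : ℝ => t - δ) (𝓝[>] 0) (𝓝 t) := by
    have : Continuous fun δ : ℝ => t - δ := by fun_prop
    simpa using (this.tendsto 0).mono_left nhdsWithin_le_nhds
  filter_upwards [h1.eventually (hf hη), self_mem_nhdsWithin] with δ hδ (hpos : 0 < δ)
  simp only [Real.norm_eq_abs, sub_sub_cancel_left, abs_neg, abs_of_pos hpos, smul_eq_mul] at hδ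
  rw [← abs_neg]
  convert hδ using 2
  ring

lemma chordGap_evolution_le {v vt vy vyy : ℝ → ℝ → ℝ}
    {a b t₁ t₂ α β σ N M : ℝ} (hv : Continuous fun z : ℝ × ℝ => v z.1 z.2)
    (ha : a < t₁) (h₁₂ : t₁ ≤ t₂) (hb : t₂ < b) (hαβ : α < β) (hσ : |σ| ≤ 1)
    (hN : ∀ s ∈ Icc a b, ∀ y ∈ Icc α β, |v s y| ≤ N)
    (hM : ∀ s ∈ Ioo a b, ∀ y ∈ Ioo α β, |vy s y| ≤ M)
    (hvt : ∀ s ∈ Ioo a b, ∀ y ∈ Ioo α β, HasDerivAt (fun r => v r y) (vt s y) s)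
    (hvy : ∀ s ∈ Ioo a b, ∀ y ∈ Ioo α β, HasDerivAt (fun x => v s x) (vy s y) y)
    (hvyy : ∀ s ∈ Ioo a b, ∀ y ∈ Ioo α β, HasDerivAt (fun x => vy s x) (vyy s y) y)
    (pde : ∀ s ∈ Ioo a b, ∀ y ∈ Ioo α β, vt s y + σ * (v s y * vy s y) = vyy s y)
    {y : ℝ} (hy : y ∈ Icc α β) :
    chordGap α β y (fun x => ∫ r in α..x, ∫ p in α..r, v t₂ p) -
      chordGap α β y (fun x => ∫ r in α..x, ∫ p in α..r, v t₁ p) ≤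
    ∫ t in t₁..t₂, (chordGap α β y (v t) -
      σ * chordGap α β y (fun x => ∫ r in α..x, v t r ^ 2 / 2)) := by
  set B := chordGap α β y (fun x => (x - α) ^ 2 / 2) with hB
  have hN0 : 0 ≤ N := (abs_nonneg _).trans
    (hN a ⟨le_rfl, by linarith⟩ α ⟨le_rfl, hαβ.le⟩)
  have hIc : ∀ w : ℝ → ℝ → ℝ, (Continuous fun z : ℝ × ℝ => w z.1 z.2) →
      Continuous fun t => chordGap α β y (fun x => ∫ r in α..x, ∫ p in α..r, w t p) := by
    intro w hw
    refine continuous_chordGap (f := fun t x => ∫ r in α..x, ∫ p in α..r, w t p) ?_ α β y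
    exact continuous_primitive_param (f := fun t r => ∫ p in α..r, w t p)
      (continuous_primitive_param hw α) α
  have hGc : ∀ w : ℝ → ℝ → ℝ, (Continuous fun z : ℝ × ℝ => w z.1 z.2) →
      Continuous fun t => chordGap α β y (w t) -
        σ * chordGap α β y (fun x => ∫ r in α..x, w t r ^ 2 / 2) := by
    intro w hw
    refine (continuous_chordGap hw α β y).sub (continuous_const.mul ?_)
    refine continuous_chordGap (f := fun t x => ∫ r in α..x, w t r ^ 2 / 2) ?_ α β y
    exact continuous_primitive_param (f := fun t r => w t r ^ 2 / 2)
      ((hw.pow 2).div_const 2) α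
  set ℓ := β - α with hℓ
  have hℓ0 : 0 < ℓ := by rw [hℓ]; linarith
  set C := 4 * ℓ ^ 3 + |M * B| * (t₂ - t₁) + (2 * ℓ + 2 * ℓ ^ 2 * N) * (t₂ - t₁) with hC
  have hC0 : 0 ≤ C := by
    have : 0 ≤ t₂ - t₁ := by linarith
    positivity
  suffices h : ∀ θ > 0, chordGap α β y (fun x => ∫ r in α..x, ∫ p in α..r, v t₂ p) -
      chordGap α β y (fun x => ∫ r in α..x, ∫ p in α..r, v t₁ p) ≤
      (∫ t in t₁..t₂, (chordGap α β y (v t) -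
        σ * chordGap α β y (fun x => ∫ r in α..x, v t r ^ 2 / 2))) + C * θ by
    refine le_of_forall_pos_le_add fun η hη => ?_
    refine (h (η / (C + 1)) (by positivity)).trans (add_le_add le_rfl ?_)
    rw [mul_div_assoc', div_le_iff₀ (by positivity)]
    nlinarith
  intro θ hθ
  obtain ⟨u, huc, huv, ε, hε, hstep⟩ := exists_approx_backward_chordGap_le hv ha h₁₂ hb hαβ hσ hθ
    hN hM hvt hvy hvyy pde
  set G : (ℝ → ℝ → ℝ) → ℝ → ℝ := fun w t => chordGap α β y (w t) -
        σ * chordGap α β y (fun x => ∫ r in α..x, w t r ^ 2 / 2) with hG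
  set I : (ℝ → ℝ → ℝ) → ℝ → ℝ := fun w t =>
    chordGap α β y (fun x => ∫ r in α..x, ∫ p in α..r, w t p) with hI
  have hGu : Continuous (G u) := hGc u huc
  have hGv : Continuous (G v) := hGc v hv
  have hmono : I u t₂ - (∫ t in t₁..t₂, G u t) - θ * M * B * t₂ ≤
      I u t₁ - (∫ t in t₁..t₁, G u t) - θ * M * B * t₁ := by
    refine le_of_backward_slope_nonpos
      (f := fun s => I u s - (∫ t in t₁..s, G u t) - θ * M * B * s) h₁₂ ?_ ?_
    · exact (((hIc u huc).sub (continuous_primitive hGu t₁)).sub (by fun_prop)).continuousOn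
    · intro t ht η hη
      have hd := hasDerivAt_primitive hGu t₁ t
      have hs : ∀ᶠ δ in 𝓝[>] (0 : ℝ), δ * (B / (2 * ε)) < η / 2 := by
        have h1 : Continuous fun δ : ℝ => δ * (B / (2 * ε)) := by fun_prop
        have h2 := h1.tendsto 0
        rw [zero_mul] at h2
        exact nhdsWithin_le_nhds (h2.eventually (gt_mem_nhds (by positivity)))
      filter_upwards [hd.eventually_abs_backward_sub_le (half_pos hη), hs,
        self_mem_nhdsWithin] with δ h1 h2 (h3 : 0 < δ)
      have h4 := hstep t (Ioc_subset_Icc_self ht) δ h3 y hy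
      have h5 := (abs_le.1 h1).1
      have h6 : δ * (δ * (B / (2 * ε))) ≤ δ * (η / 2) := mul_le_mul_of_nonneg_left h2.le h3.le
      have e : δ * (G u t + (θ * M + δ / (2 * ε)) * B) =
        δ * G u t + θ * M * B * δ + δ * (δ * (B / (2 * ε))) := by field_simp; ring
      have h7 : I u t - I u (t - δ) ≤ δ * (G u t + (θ * M + δ / (2 * ε)) * B) := h4
      rw [e] at h7
      linarith
  rw [intervalIntegral.integral_same] at hmono
  have hclose : ∀ t ∈ Icc t₁ t₂, ∀ x ∈ Icc α β, |u t x - v t x| ≤ θ := by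
    intro t ht x hx
    have := huv t ht x hx
    rw [abs_le]; constructor <;> linarith [this.1, this.2.1]
  have hIclose : ∀ t ∈ Icc t₁ t₂, |I u t - I v t| ≤ 2 * ℓ * (ℓ * (ℓ * θ)) := by
    intro t ht
    refine abs_chordGap_sub_le hy fun x hx => ?_
    refine abs_primitive_sub_le (continuous_primitive (continuous_slice huc t) α)
      (continuous_primitive (continuous_slice hv t) α) (fun r hr => ?_) hx
    exact abs_primitive_sub_le (continuous_slice huc t) (continuous_slice hv t)
      (hclose t ht) hr
  have hGclose : ∀ t ∈ Icc t₁ t₂, |G u t - G v t| ≤ 2 * ℓ * θ + 2 * ℓ * (ℓ * (N * θ)) := by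
    intro t ht
    have h1 := abs_chordGap_sub_le hy (hclose t ht)
    have hcu := continuous_slice huc t
    have hcv := continuous_slice hv t
    have h2 : |chordGap α β y (fun x => ∫ r in α..x, u t r ^ 2 / 2) -
        chordGap α β y (fun x => ∫ r in α..x, v t r ^ 2 / 2)| ≤ 2 * ℓ * (ℓ * (N * θ)) := by
      refine abs_chordGap_sub_le hy fun x hx => ?_
      refine abs_primitive_sub_le (by fun_prop) (by fun_prop) (fun r hr => ?_) hx
      have e : u t r ^ 2 / 2 - v t r ^ 2 / 2 = (u t r + v t r) / 2 * (u t r - v t r) := by ring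
      rw [e, abs_mul]
      have h3 := abs_le.1 (huv t ht r hr).2.2
      have h4 := abs_le.1 (hN t ⟨by linarith [ht.1], by linarith [ht.2]⟩ r hr)
      have h5 : |(u t r + v t r) / 2| ≤ N := by rw [abs_le]; constructor <;> linarith
      exact mul_le_mul h5 (hclose t ht r hr) (abs_nonneg _) hN0
    have e : G u t - G v t = (chordGap α β y (u t) - chordGap α β y (v t)) -
      σ * (chordGap α β y (fun x => ∫ r in α..x, u t r ^ 2 / 2) -
        chordGap α β y (fun x => ∫ r in α..x, v t r ^ 2 / 2)) := by simp only [hG]; ring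
    rw [e]
    refine (abs_sub _ _).trans (add_le_add h1 ?_)
    rw [abs_mul]
    exact (mul_le_of_le_one_left (abs_nonneg _) hσ).trans h2
  have hG_le : (∫ t in t₁..t₂, G u t) ≤
      (∫ t in t₁..t₂, G v t) + (2 * ℓ * θ + 2 * ℓ * (ℓ * (N * θ))) * (t₂ - t₁) := by
    have h1 : (∫ t in t₁..t₂, G u t) ≤
        ∫ t in t₁..t₂, (G v t + (2 * ℓ * θ + 2 * ℓ * (ℓ * (N * θ)))) := by
      refine intervalIntegral.integral_mono_on h₁₂ (hGu.intervalIntegrable _ _)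
        ((hGv.add continuous_const).intervalIntegrable _ _) fun t ht => ?_
      have := (abs_le.1 (hGclose t ht)).2
      linarith
    rw [intervalIntegral.integral_add (hGv.intervalIntegrable _ _) (by simp)] at h1
    simp only [intervalIntegral.integral_const, smul_eq_mul] at h1
    linarith
  have a1 := abs_le.1 (hIclose t₁ ⟨le_rfl, h₁₂⟩)
  have a2 := abs_le.1 (hIclose t₂ ⟨h₁₂, le_rfl⟩)
  have a3 : θ * M * B * (t₂ - t₁) ≤ |M * B| * (t₂ - t₁) * θ := by
    have := mul_le_mul_of_nonneg_right (le_abs_self (M * B))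
      (mul_nonneg hθ.le (by linarith : 0 ≤ t₂ - t₁))
    linarith
  change I v t₂ - I v t₁ ≤ (∫ t in t₁..t₂, G v t) + C * θ
  have e : C * θ = 2 * (2 * ℓ * (ℓ * (ℓ * θ))) + |M * B| * (t₂ - t₁) * θ +
    (2 * ℓ * θ + 2 * ℓ * (ℓ * (N * θ))) * (t₂ - t₁) := by rw [hC]; ring
  rw [e]
  linarith [a1.1, a1.2, a2.1, a2.2]

/-- Time-integrated weak form of `v_t + σ v v_y = v_yy`, tested against a hat function. -/
lemma chordGap_evolution {v vt vy vyy : ℝ → ℝ → ℝ}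
    {a b t₁ t₂ α β σ N M : ℝ} (hv : Continuous fun z : ℝ × ℝ => v z.1 z.2)
    (ha : a < t₁) (h₁₂ : t₁ ≤ t₂) (hb : t₂ < b) (hαβ : α < β) (hσ : |σ| ≤ 1)
    (hN : ∀ s ∈ Icc a b, ∀ y ∈ Icc α β, |v s y| ≤ N)
    (hM : ∀ s ∈ Ioo a b, ∀ y ∈ Ioo α β, |vy s y| ≤ M)
    (hvt : ∀ s ∈ Ioo a b, ∀ y ∈ Ioo α β, HasDerivAt (fun r => v r y) (vt s y) s)
    (hvy : ∀ s ∈ Ioo a b, ∀ y ∈ Ioo α β, HasDerivAt (fun x => v s x) (vy s y) y)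
    (hvyy : ∀ s ∈ Ioo a b, ∀ y ∈ Ioo α β, HasDerivAt (fun x => vy s x) (vyy s y) y)
    (pde : ∀ s ∈ Ioo a b, ∀ y ∈ Ioo α β, vt s y + σ * (v s y * vy s y) = vyy s y)
    {y : ℝ} (hy : y ∈ Icc α β) :
    chordGap α β y (fun x => ∫ r in α..x, ∫ p in α..r, v t₂ p) -
      chordGap α β y (fun x => ∫ r in α..x, ∫ p in α..r, v t₁ p) =
    ∫ t in t₁..t₂, (chordGap α β y (v t) -
      σ * chordGap α β y (fun x => ∫ r in α..x, v t r ^ 2 / 2)) := by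
  refine le_antisymm (chordGap_evolution_le hv ha h₁₂ hb hαβ hσ hN hM hvt hvy hvyy pde hy) ?_
  have hneg : ∀ f : ℝ → ℝ, chordGap α β y (fun x => -f x) = -chordGap α β y f := by
    intro f; simp only [chordGap]; ring
  have h := chordGap_evolution_le (v := fun t x => -v t x) (vt := fun t x => -vt t x)
    (vy := fun t x => -vy t x) (vyy := fun t x => -vyy t x) (σ := -σ) hv.neg ha h₁₂ hb hαβ
    (by rwa [abs_neg]) (fun s hs y hy => by rw [abs_neg]; exact hN s hs y hy)
    (fun s hs y hy => by rw [abs_neg]; exact hM s hs y hy)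
    (fun s hs y hy => (hvt s hs y hy).neg) (fun s hs y hy => (hvy s hs y hy).neg)
    (fun s hs y hy => (hvyy s hs y hy).neg)
    (fun s hs y hy => by have := pde s hs y hy; linarith) hy
  simp only [intervalIntegral.integral_neg, hneg, neg_sq] at h
  have e : ∫ t in t₁..t₂, (-chordGap α β y (v t) -
      -σ * chordGap α β y (fun x => ∫ r in α..x, v t r ^ 2 / 2)) =
      -∫ t in t₁..t₂, (chordGap α β y (v t) -
        σ * chordGap α β y (fun x => ∫ r in α..x, v t r ^ 2 / 2)) := by
    rw [← intervalIntegral.integral_neg]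
    congr 1
    ext t
    ring
  rw [e] at h
  linarith

lemma integral_swap_of_continuous {F : ℝ → ℝ → ℝ} (hF : Continuous fun z : ℝ × ℝ => F z.1 z.2)
    (a b c d : ℝ) : ∫ x in a..b, ∫ y in c..d, F x y = ∫ y in c..d, ∫ x in a..b, F x y := by
  refine intervalIntegral_intervalIntegral_swap ?_
  have h : IntegrableOn (fun z : ℝ × ℝ => F z.1 z.2) (uIcc a b ×ˢ uIcc c d) :=
    hF.continuousOn.integrableOn_compact (isCompact_uIcc.prod isCompact_uIcc)
  exact h.mono_set (prod_mono uIoc_subset_uIcc uIoc_subset_uIcc)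

lemma continuous_swap_args {F : ℝ → ℝ → ℝ} (hF : Continuous fun z : ℝ × ℝ => F z.1 z.2) :
    Continuous fun z : ℝ × ℝ => F z.2 z.1 := hF.comp continuous_swap

/-- Recovering `∬ f H` from `Γ = ∬ H + σ ∫ q - c (· - α)` by integrating by parts twice. -/
lemma iterated_integral_by_parts {f f' f'' H q : ℝ → ℝ} {α σ c : ℝ}
    (hf : ∀ x, HasDerivAt f (f' x) x) (hf' : ∀ x, HasDerivAt f' (f'' x) x)
    (hf'' : Continuous f'') (hH : Continuous H) (hq : Continuous q) (hfα : f α = 0) {Γ : ℝ → ℝ}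
    (hΓ : Γ = fun y => (∫ r in α..y, ∫ x in α..r, H x) + σ * (∫ x in α..y, q x) - c * (y - α))
    (z : ℝ) :
    ∫ r in α..z, ∫ x in α..r, f x * H x =
      f z * Γ z + ∫ r in α..z, (-(2 * (f' r * Γ r)) - σ * (f r * q r) +
        ∫ x in α..r, (f'' x * Γ x + σ * (f' x * q x))) := by
  have hfc : Continuous f := continuous_iff_continuousAt.2 fun x => (hf x).continuousAt
  have hfc' : Continuous f' := continuous_iff_continuousAt.2 fun x => (hf' x).continuousAt
  set U : ℝ → ℝ := fun r => ∫ x in α..r, H x with hU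
  have hUc : Continuous U := continuous_primitive hH α
  have hΓd : ∀ y, HasDerivAt Γ (U y + σ * q y - c) y := by
    intro y
    rw [hΓ]
    refine (((hasDerivAt_primitive hUc α y).add ((hasDerivAt_primitive hq α y).const_mul σ)).sub
      (((hasDerivAt_id' y).sub_const α).const_mul c)).congr_deriv ?_
    ring
  have hΓc : Continuous Γ := continuous_iff_continuousAt.2 fun x => (hΓd x).continuousAt
  have hΓα : Γ α = 0 := by simp [hΓ]
  set J : ℝ → ℝ := fun r => ∫ x in α..r, (f'' x * Γ x + σ * (f' x * q x)) with hJ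
  have hJd : ∀ y, HasDerivAt J (f'' y * Γ y + σ * (f' y * q y)) y :=
    hasDerivAt_primitive (by fun_prop) α
  have hJc : Continuous J := continuous_iff_continuousAt.2 fun x => (hJd x).continuousAt
  set D : ℝ → ℝ := fun y => f y * (U y - c) - f' y * Γ y + J y with hD
  have hDd : ∀ y, HasDerivAt D (f y * H y) y := by
    intro y
    refine ((((hf y).fun_mul ((hasDerivAt_primitive hH α y).sub_const c)).sub
      ((hf' y).fun_mul (hΓd y))).add (hJd y)).congr_deriv ?_
    simp only [hU]
    ring
  have hDc : Continuous D := continuous_iff_continuousAt.2 fun x => (hDd x).continuousAt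
  have hDe : ∀ r, ∫ x in α..r, f x * H x = D r := by
    intro r
    rw [intervalIntegral.integral_eq_sub_of_hasDerivAt (fun x _ => hDd x)
      ((hfc.mul hH).intervalIntegrable _ _)]
    simp [hD, hJ, hfα, hΓα]
  have hTd : ∀ y, HasDerivAt (fun z => f z * Γ z + ∫ r in α..z, (-(2 * (f' r * Γ r)) -
      σ * (f r * q r) + J r)) (D y) y := by
    intro y
    refine (((hf y).fun_mul (hΓd y)).add (hasDerivAt_primitive
      (f := fun r => -(2 * (f' r * Γ r)) - σ * (f r * q r) + J r) (by fun_prop) α y)).congr_deriv ?_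
    simp only [hD]
    ring
  simp only [hDe]
  rw [intervalIntegral.integral_eq_sub_of_hasDerivAt (fun x _ => hTd x)
    (hDc.intervalIntegrable _ _)]
  simp [hfα, hJ]

/-- Time-integrated weak form of `v_t + σ v v_y = v_yy` with vanishing left boundary value,
tested against `f` and integrated once more in space. -/
lemma weighted_evolution {v vt vy vyy : ℝ → ℝ → ℝ} {f f' f'' : ℝ → ℝ}
    {a b t₁ t₂ α z σ N M : ℝ} (hv : Continuous fun z : ℝ × ℝ => v z.1 z.2)
    (hf : ∀ x, HasDerivAt f (f' x) x) (hf' : ∀ x, HasDerivAt f' (f'' x) x)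
    (hf'' : Continuous f'') (hfα : f α = 0)
    (ha : a < t₁) (h₁₂ : t₁ ≤ t₂) (hb : t₂ < b) (hαz : α < z) (hσ : |σ| ≤ 1)
    (hN : ∀ s ∈ Icc a b, ∀ y ∈ Icc α z, |v s y| ≤ N)
    (hM : ∀ s ∈ Ioo a b, ∀ y ∈ Ioo α z, |vy s y| ≤ M)
    (hvα : ∀ s ∈ Icc a b, v s α = 0)
    (hvt : ∀ s ∈ Ioo a b, ∀ y ∈ Ioo α z, HasDerivAt (fun r => v r y) (vt s y) s)
    (hvy : ∀ s ∈ Ioo a b, ∀ y ∈ Ioo α z, HasDerivAt (fun x => v s x) (vy s y) y)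
    (hvyy : ∀ s ∈ Ioo a b, ∀ y ∈ Ioo α z, HasDerivAt (fun x => vy s x) (vyy s y) y)
    (pde : ∀ s ∈ Ioo a b, ∀ y ∈ Ioo α z, vt s y + σ * (v s y * vy s y) = vyy s y) :
    (∫ r in α..z, ∫ x in α..r, f x * v t₂ x) - (∫ r in α..z, ∫ x in α..r, f x * v t₁ x) =
    ∫ s in t₁..t₂, (f z * v s z + ∫ r in α..z, (-(2 * (f' r * v s r)) -
      σ * (f r * (v s r ^ 2 / 2)) +
        ∫ x in α..r, (f'' x * v s x + σ * (f' x * (v s x ^ 2 / 2))))) := by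
  have hfc : Continuous f := continuous_iff_continuousAt.2 fun x => (hf x).continuousAt
  have hfc' : Continuous f' := continuous_iff_continuousAt.2 fun x => (hf' x).continuousAt
  have hvl := continuous_slice_left hv
  have hvs := continuous_slice hv
  have hΓc : Continuous fun y => ∫ s in t₁..t₂, v s y :=
    intervalIntegral.continuous_parametric_intervalIntegral_of_continuous'
      (continuous_swap_args hv) t₁ t₂
  have hsq : Continuous fun z : ℝ × ℝ => v z.1 z.2 ^ 2 / 2 := (hv.pow 2).div_const 2
  have hsql := continuous_slice_left (f := fun s y => v s y ^ 2 / 2) hsq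
  set q : ℝ → ℝ := fun y => ∫ s in t₁..t₂, v s y ^ 2 / 2 with hq
  have hqc : Continuous q :=
    intervalIntegral.continuous_parametric_intervalIntegral_of_continuous'
      (continuous_swap_args (F := fun s y => v s y ^ 2 / 2) hsq) t₁ t₂
  set H : ℝ → ℝ := fun x => v t₂ x - v t₁ x with hH
  have hHc : Continuous H := (hvs t₂).sub (hvs t₁)
  set W : ℝ → ℝ := fun y => ∫ r in α..y, ∫ x in α..r, H x with hW
  have hWe : ∀ y, W y = (∫ r in α..y, ∫ x in α..r, v t₂ x) - ∫ r in α..y, ∫ x in α..r, v t₁ x := by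
    intro y
    rw [← intervalIntegral.integral_sub
      ((continuous_primitive (hvs t₂) α).intervalIntegrable _ _)
      ((continuous_primitive (hvs t₁) α).intervalIntegrable _ _)]
    refine intervalIntegral.integral_congr fun r _ => ?_
    exact intervalIntegral.integral_sub ((hvs t₂).intervalIntegrable _ _)
      ((hvs t₁).intervalIntegrable _ _)
  have hSc : ∀ y, Continuous fun s => ∫ r in α..y, v s r ^ 2 / 2 := fun y =>
    intervalIntegral.continuous_parametric_intervalIntegral_of_continuous'
      (f := fun s r => v s r ^ 2 / 2) hsq α y
  have hSq : ∀ y, ∫ s in t₁..t₂, ∫ r in α..y, v s r ^ 2 / 2 = ∫ r in α..y, q r := fun y =>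
    integral_swap_of_continuous (F := fun s r => v s r ^ 2 / 2) hsq _ _ _ _
  obtain ⟨c, hc⟩ : ∃ c, ∀ y ∈ Icc α z, ∫ s in t₁..t₂, v s y =
      W y + σ * (∫ x in α..y, q x) - c * (y - α) := by
    refine ⟨-((∫ s in t₁..t₂, v s z) - W z - σ * ∫ x in α..z, q x) / (z - α), fun y hy => ?_⟩
    have hev := chordGap_evolution hv ha h₁₂ hb hαz hσ hN hM hvt hvy hvyy pde hy
    have hgap : (∫ t in t₁..t₂, (chordGap α z y (v t) -
        σ * chordGap α z y (fun x => ∫ r in α..x, v t r ^ 2 / 2))) =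
        (y - α) * (∫ s in t₁..t₂, v s z) - (z - α) * (∫ s in t₁..t₂, v s y) -
        σ * ((y - α) * (∫ x in α..z, q x) - (z - α) * ∫ x in α..y, q x) := by
      rw [← hSq, ← hSq, ← intervalIntegral.integral_const_mul,
        ← intervalIntegral.integral_const_mul, ← intervalIntegral.integral_const_mul,
        ← intervalIntegral.integral_const_mul, ← intervalIntegral.integral_sub,
        ← intervalIntegral.integral_sub, ← intervalIntegral.integral_const_mul,
        ← intervalIntegral.integral_sub]
      · refine intervalIntegral.integral_congr fun s hs => ?_
        rw [uIcc_of_le h₁₂] at hs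
        have := hvα s ⟨by linarith [hs.1], by linarith [hs.2]⟩
        simp only [chordGap, this, intervalIntegral.integral_same]
        ring
      · have h1 := hvl z
        have h2 := hvl y
        exact Continuous.intervalIntegrable (by fun_prop) _ _
      · have h1 := hSc z
        have h2 := hSc y
        exact Continuous.intervalIntegrable (by fun_prop) _ _
      · exact ((hSc z).const_mul _).intervalIntegrable _ _
      · exact ((hSc y).const_mul _).intervalIntegrable _ _
      · exact ((hvl z).const_mul _).intervalIntegrable _ _
      · exact ((hvl y).const_mul _).intervalIntegrable _ _
    rw [hgap] at hev
    have hWα : W α = 0 := by simp [hW]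
    have e : chordGap α z y (fun x => ∫ r in α..x, ∫ p in α..r, v t₂ p) -
      chordGap α z y (fun x => ∫ r in α..x, ∫ p in α..r, v t₁ p) =
      (y - α) * W z - (z - α) * W y := by
      simp only [hWe, chordGap, intervalIntegral.integral_same]
      ring
    rw [e] at hev
    have hz : z - α ≠ 0 := by linarith
    field_simp
    linarith
  set Γ : ℝ → ℝ := fun y => W y + σ * (∫ x in α..y, q x) - c * (y - α) with hΓ
  have hparts := iterated_integral_by_parts hf hf' hf'' hHc hqc hfα hΓ z
  have hfv : ∀ t, Continuous fun x => f x * v t x := fun t => by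
    have := hvs t
    fun_prop
  have hlhs : (∫ r in α..z, ∫ x in α..r, f x * v t₂ x) -
      (∫ r in α..z, ∫ x in α..r, f x * v t₁ x) = ∫ r in α..z, ∫ x in α..r, f x * H x := by
    rw [← intervalIntegral.integral_sub
      ((continuous_primitive (hfv t₂) α).intervalIntegrable _ _)
      ((continuous_primitive (hfv t₁) α).intervalIntegrable _ _)]
    refine intervalIntegral.integral_congr fun r _ => ?_
    rw [← intervalIntegral.integral_sub ((hfv t₂).intervalIntegrable _ _)
      ((hfv t₁).intervalIntegrable _ _)]
    refine intervalIntegral.integral_congr fun x _ => ?_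
    simp only [hH]
    ring
  rw [hlhs, hparts]
  have hfx : Continuous fun p : ℝ × ℝ => f p.2 := hfc.comp continuous_snd
  have hfx' : Continuous fun p : ℝ × ℝ => f' p.2 := hfc'.comp continuous_snd
  have hfx'' : Continuous fun p : ℝ × ℝ => f'' p.2 := hf''.comp continuous_snd
  have hin : Continuous fun p : ℝ × ℝ => f'' p.2 * v p.1 p.2 +
      σ * (f' p.2 * (v p.1 p.2 ^ 2 / 2)) := by fun_prop
  have hinI := continuous_primitive_param
    (f := fun s x => f'' x * v s x + σ * (f' x * (v s x ^ 2 / 2))) hin α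
  have hc1 : Continuous fun p : ℝ × ℝ => -(2 * (f' p.2 * v p.1 p.2)) -
      σ * (f p.2 * (v p.1 p.2 ^ 2 / 2)) +
        ∫ x in α..p.2, (f'' x * v p.1 x + σ * (f' x * (v p.1 x ^ 2 / 2))) := by fun_prop
  rw [intervalIntegral.integral_add ((hvl z).const_mul _ |>.intervalIntegrable _ _)
    ((intervalIntegral.continuous_parametric_intervalIntegral_of_continuous' hc1 α z
      ).intervalIntegrable _ _), intervalIntegral.integral_const_mul,
    integral_swap_of_continuous hc1, hc z ⟨hαz.le, le_rfl⟩]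
  congr 1
  refine intervalIntegral.integral_congr fun r hr => ?_
  rw [uIcc_of_le hαz.le] at hr
  have hI1 : IntervalIntegrable (fun s => -(2 * (f' r * v s r)) - σ * (f r * (v s r ^ 2 / 2)))
      volume t₁ t₂ := by
    have h1 := hvl r
    exact Continuous.intervalIntegrable (by fun_prop) _ _
  rw [intervalIntegral.integral_add hI1
    ((intervalIntegral.continuous_parametric_intervalIntegral_of_continuous'
      hin α r).intervalIntegrable _ _), integral_swap_of_continuous hin]
  congr 1
  · rw [intervalIntegral.integral_sub, intervalIntegral.integral_neg,
      intervalIntegral.integral_const_mul, intervalIntegral.integral_const_mul,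
      intervalIntegral.integral_const_mul, intervalIntegral.integral_const_mul, hc r hr]
    · have h1 := hvl r
      exact Continuous.intervalIntegrable (by fun_prop) _ _
    · have h1 := hvl r
      exact Continuous.intervalIntegrable (by fun_prop) _ _
  · refine intervalIntegral.integral_congr fun x hx => ?_
    rw [uIcc_of_le hr.1] at hx
    have h1 := hvl x
    rw [intervalIntegral.integral_add (Continuous.intervalIntegrable (by fun_prop) _ _)
      (Continuous.intervalIntegrable (by fun_prop) _ _), intervalIntegral.integral_const_mul,
      intervalIntegral.integral_const_mul, intervalIntegral.integral_const_mul,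
      hc x ⟨hx.1, hx.2.trans hr.2⟩]

lemma hasDerivAt_along_curve {F F₁ F₂ : ℝ → ℝ → ℝ} {z : ℝ → ℝ} {t z' : ℝ}
    (h₁ : ∀ᶠ p : ℝ × ℝ in 𝓝 (t, z t), HasDerivAt (fun s => F s p.2) (F₁ p.1 p.2) p.1)
    (h₂ : ∀ᶠ p : ℝ × ℝ in 𝓝 (t, z t), HasDerivAt (F p.1) (F₂ p.1 p.2) p.2)
    (c₁ : Continuous fun p : ℝ × ℝ => F₁ p.1 p.2) (c₂ : Continuous fun p : ℝ × ℝ => F₂ p.1 p.2)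
    (hz : HasDerivAt z z' t) :
    HasDerivAt (fun s => F s (z s)) (F₁ t (z t) + F₂ t (z t) * z') t := by
  have h := hasStrictFDerivAt_uncurry_coprod (𝕜 := ℝ) (u := (t, z t)) (f := F)
    (f₁ := fun x y => ContinuousLinearMap.toSpanSingleton ℝ (F₁ x y))
    (f₂ := fun x y => ContinuousLinearMap.toSpanSingleton ℝ (F₂ x y))
    (by filter_upwards [h₁] with p hp using hp.hasFDerivAt)
    (by filter_upwards [h₂] with p hp using hp.hasFDerivAt)
    (by
      have : Continuous fun p : ℝ × ℝ => ContinuousLinearMap.toSpanSingleton ℝ (F₁ p.1 p.2) :=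
        (ContinuousLinearMap.toSpanSingletonCLE (𝕜 := ℝ) (E := ℝ)).continuous.comp c₁
      exact this.continuousAt)
    (by
      have : Continuous fun p : ℝ × ℝ => ContinuousLinearMap.toSpanSingleton ℝ (F₂ p.1 p.2) :=
        (ContinuousLinearMap.toSpanSingletonCLE (𝕜 := ℝ) (E := ℝ)).continuous.comp c₂
      exact this.continuousAt)
  have h2 := h.hasFDerivAt.comp_hasDerivAt t ((hasDerivAt_id' t).prodMk hz)
  refine h2.congr_deriv ?_
  simp [Function.HasUncurry.uncurry, mul_comm]

lemma HasDerivWithinAt.tendsto_left_quotient {f : ℝ → ℝ} {f' x : ℝ}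
    (hf : HasDerivWithinAt f f' (Iic x) x) :
    Tendsto (fun ρ => (f x - f (x - ρ)) / ρ) (𝓝[>] 0) (𝓝 f') := by
  rw [hasDerivWithinAt_iff_tendsto_slope] at hf
  have h1 : Tendsto (fun ρ : ℝ => x - ρ) (𝓝[>] 0) (𝓝[Iic x \ {x}] x) := by
    refine tendsto_nhdsWithin_iff.2 ⟨?_, ?_⟩
    · have : Continuous fun δ : ℝ => x - δ := by fun_prop
      simpa using (this.tendsto 0).mono_left nhdsWithin_le_nhds
    · filter_upwards [self_mem_nhdsWithin] with ρ (hρ : 0 < ρ)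
      exact ⟨by simp [hρ.le], by simp [hρ.ne']⟩
  refine (hf.comp h1).congr fun ρ => ?_
  simp only [Function.comp, slope_def_field]
  rw [← neg_div_neg_eq]
  congr 1 <;> ring

/-- A solution of `v_t + σ v v_y = v_yy` on the moving domain `-1 < y < h t`, `0 < t < T`,
that is Lipschitz in space uniformly in time, vanishes at `y = -1`, and has one-sided slope
`vl` at the moving boundary. The function `v` is given on the whole plane. -/
structure IsLeftSolution (v vt vy vyy : ℝ → ℝ → ℝ) (h g vl : ℝ → ℝ) (σ T N M : ℝ) : Prop where
  cont : Continuous fun z : ℝ × ℝ => v z.1 z.2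
  h_cont : Continuous h
  g_cont : Continuous g
  abs_σ : |σ| ≤ 1
  h_deriv : ∀ t ∈ Ioo 0 T, HasDerivAt h (g t) t
  h_mem : ∀ t ∈ Ioo 0 T, h t ∈ Ioo (-1) 1
  bound : ∀ t ∈ Ioo 0 T, ∀ y, |v t y| ≤ N
  lip : ∀ t ∈ Ioo 0 T, ∀ x y, |v t x - v t y| ≤ M * |x - y|
  left : ∀ t ∈ Ioo 0 T, v t (-1) = 0
  deriv_t : ∀ t ∈ Ioo 0 T, ∀ y ∈ Ioo (-1) (h t), HasDerivAt (fun s => v s y) (vt t y) t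
  deriv_y : ∀ t ∈ Ioo 0 T, ∀ y ∈ Ioo (-1) (h t), HasDerivAt (fun x => v t x) (vy t y) y
  deriv_yy : ∀ t ∈ Ioo 0 T, ∀ y ∈ Ioo (-1) (h t), HasDerivAt (fun x => vy t x) (vyy t y) y
  pde : ∀ t ∈ Ioo 0 T, ∀ y ∈ Ioo (-1) (h t), vt t y + σ * (v t y * vy t y) = vyy t y
  deriv_left : ∀ t ∈ Ioo 0 T, HasDerivWithinAt (v t) (vl t) (Iic (h t)) (h t)

lemma HasDerivAt.abs_le_of_lip {f : ℝ → ℝ} {f' x M : ℝ} (hf : HasDerivAt f f' x)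
    (h : ∀ x y, |f x - f y| ≤ M * |x - y|) : |f'| ≤ M := by
  have hM : 0 ≤ M := by
    have := (abs_nonneg _).trans (h 1 0)
    simpa using this
  have := hf.le_of_lip' hM (Eventually.of_forall fun y => by
    simpa [Real.norm_eq_abs] using h y x)
  simpa using this

namespace IsLeftSolution

variable {v vt vy vyy : ℝ → ℝ → ℝ} {h g vl : ℝ → ℝ} {σ T N M : ℝ}

lemma hasDerivAt_weighted (S : IsLeftSolution v vt vy vyy h g vl σ T N M) {f f' f'' : ℝ → ℝ}
    (hf : ∀ x, HasDerivAt f (f' x) x) (hf' : ∀ x, HasDerivAt f' (f'' x) x)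
    (hf'' : Continuous f'') (hfα : f (-1) = 0) {B b₁ : ℝ → ℝ → ℝ}
    (hB : B = fun s z => ∫ r in (-1)..z, ∫ x in (-1)..r, f x * v s x)
    (hb : b₁ = fun s z => f z * v s z + ∫ r in (-1)..z, (-(2 * (f' r * v s r)) -
      σ * (f r * (v s r ^ 2 / 2)) +
        ∫ x in (-1)..r, (f'' x * v s x + σ * (f' x * (v s x ^ 2 / 2)))))
    (hbc : Continuous fun p : ℝ × ℝ => b₁ p.1 p.2)
    {t z : ℝ} (ht : t ∈ Ioo 0 T) (hz : z ∈ Ioo (-1) (h t)) :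
    HasDerivAt (fun s => B s z) (b₁ t z) t := by
  have hnear : ∀ᶠ s in 𝓝 t, s ∈ Ioo 0 T ∧ z < h s :=
    (show ∀ᶠ s in 𝓝 t, s ∈ Ioo 0 T from Ioo_mem_nhds ht.1 ht.2).and
      (S.h_cont.continuousAt.eventually (lt_mem_nhds hz.2))
  obtain ⟨e, he, hball⟩ := Metric.eventually_nhds_iff.1 hnear
  have hI : ∀ s ∈ Icc (t - e / 2) (t + e / 2), s ∈ Ioo 0 T ∧ z < h s := fun s hs => by
    refine hball ?_
    rw [Real.dist_eq, abs_lt]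
    constructor <;> linarith [hs.1, hs.2]
  have hI' : ∀ s ∈ Ioo (t - e / 2) (t + e / 2), ∀ y ∈ Ioo (-1) z,
      s ∈ Ioo 0 T ∧ y ∈ Ioo (-1) (h s) := fun s hs y hy =>
    ⟨(hI s (Ioo_subset_Icc_self hs)).1, hy.1,
      hy.2.trans (hI s (Ioo_subset_Icc_self hs)).2⟩
  have hbs : Continuous fun s => b₁ s z := continuous_slice_left hbc z
  have hev : ∀ s ∈ Ioo (t - e / 4) (t + e / 2), B s z =
      B (t - e / 4) z + ∫ r in (t - e / 4)..s, b₁ r z := by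
    intro s hs
    have := weighted_evolution (a := t - e / 2) (b := t + e / 2) (t₁ := t - e / 4) (t₂ := s)
      S.cont hf hf' hf'' hfα (by linarith) hs.1.le hs.2 hz.1 S.abs_σ
      (fun s hs y _ => S.bound s (hI s hs).1 y)
      (fun s hs y hy => (S.deriv_y s (hI' s hs y hy).1 y (hI' s hs y hy).2).abs_le_of_lip
        (S.lip s (hI' s hs y hy).1))
      (fun s hs => S.left s (hI s hs).1)
      (fun s hs y hy => S.deriv_t s (hI' s hs y hy).1 y (hI' s hs y hy).2)
      (fun s hs y hy => S.deriv_y s (hI' s hs y hy).1 y (hI' s hs y hy).2)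
      (fun s hs y hy => S.deriv_yy s (hI' s hs y hy).1 y (hI' s hs y hy).2)
      (fun s hs y hy => S.pde s (hI' s hs y hy).1 y (hI' s hs y hy).2)
    simp only [hB, hb]
    linarith
  have hd := (hasDerivAt_primitive hbs (t - e / 4) t).const_add (B (t - e / 4) z)
  refine hd.congr_of_eventuallyEq ?_
  filter_upwards [Ioo_mem_nhds (by linarith : t - e / 4 < t) (by linarith : t < t + e / 2)]
    with s hs using hev s hs

end IsLeftSolution

namespace IsLeftSolution

variable {v vt vy vyy : ℝ → ℝ → ℝ} {h g vl : ℝ → ℝ} {σ T N M : ℝ}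

lemma abs_slope_le (S : IsLeftSolution v vt vy vyy h g vl σ T N M) {t : ℝ} (ht : t ∈ Ioo 0 T) :
    |vl t| ≤ M := by
  refine le_of_tendsto (S.deriv_left t ht).tendsto_left_quotient.abs ?_
  filter_upwards [self_mem_nhdsWithin] with ρ (hρ : 0 < ρ)
  have := S.lip t ht (h t) (h t - ρ)
  rw [sub_sub_cancel, abs_of_pos hρ] at this
  rwa [abs_div, abs_of_pos hρ, div_le_iff₀ hρ]

lemma intervalIntegrable_slope (S : IsLeftSolution v vt vy vyy h g vl σ T N M) {t₁ t₂ : ℝ}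
    (h₁ : 0 < t₁) (h₁₂ : t₁ ≤ t₂) (h₂ : t₂ < T) : IntervalIntegrable vl volume t₁ t₂ := by
  rw [intervalIntegrable_iff_integrableOn_Ioc_of_le h₁₂]
  have hmem : ∀ s ∈ Ioc t₁ t₂, s ∈ Ioo 0 T := fun s hs => ⟨h₁.trans hs.1, hs.2.trans_lt h₂⟩
  have hmeas : AEStronglyMeasurable vl (volume.restrict (Ioc t₁ t₂)) := by
    refine aestronglyMeasurable_of_tendsto_ae (𝓝[>] (0 : ℝ))
      (f := fun ρ s => (v s (h s) - v s (h s - ρ)) / ρ) (fun ρ => ?_) ?_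
    · have c1 : Continuous fun s => v s (h s) := S.cont.comp (continuous_id.prodMk S.h_cont)
      have c2 : Continuous fun s => v s (h s - ρ) :=
        S.cont.comp (continuous_id.prodMk (S.h_cont.sub continuous_const))
      exact ((c1.sub c2).div_const ρ).aestronglyMeasurable
    · filter_upwards [ae_restrict_mem measurableSet_Ioc] with s hs
      exact (S.deriv_left s (hmem s hs)).tendsto_left_quotient
  refine Integrable.of_bound hmeas M ?_
  filter_upwards [ae_restrict_mem measurableSet_Ioc] with s hs
  exact S.abs_slope_le (hmem s hs)

/-- Evolution of `∫_{-1}^{h t} f v` along the moving boundary. -/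
lemma evolution (S : IsLeftSolution v vt vy vyy h g vl σ T N M) {f f' f'' : ℝ → ℝ}
    (hf : ∀ x, HasDerivAt f (f' x) x) (hf' : ∀ x, HasDerivAt f' (f'' x) x)
    (hf'' : Continuous f'') (hfα : f (-1) = 0) {t₁ t₂ : ℝ}
    (h₁ : 0 < t₁) (h₁₂ : t₁ ≤ t₂) (h₂ : t₂ < T) :
    (∫ x in (-1)..h t₂, f x * v t₂ x) - (∫ x in (-1)..h t₁, f x * v t₁ x) =
    ∫ s in t₁..t₂, (f (h s) * vl s - f' (h s) * v s (h s) - σ * (f (h s) * (v s (h s) ^ 2 / 2)) +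
      g s * (f (h s) * v s (h s)) +
      ∫ x in (-1)..h s, (f'' x * v s x + σ * (f' x * (v s x ^ 2 / 2)))) := by
  have hfc : Continuous f := continuous_iff_continuousAt.2 fun x => (hf x).continuousAt
  have hfc' : Continuous f' := continuous_iff_continuousAt.2 fun x => (hf' x).continuousAt
  have hv := S.cont
  have hg := S.g_cont
  have hh := S.h_cont
  have hmem : ∀ s ∈ Icc t₁ t₂, s ∈ Ioo 0 T := fun s hs => ⟨h₁.trans_le hs.1, hs.2.trans_lt h₂⟩
  have hfv : Continuous fun p : ℝ × ℝ => f p.2 * v p.1 p.2 := by fun_prop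
  set A : ℝ → ℝ → ℝ := fun s r => ∫ x in (-1)..r, f x * v s x with hA
  have hAc : Continuous fun p : ℝ × ℝ => A p.1 p.2 :=
    continuous_primitive_param (f := fun s x => f x * v s x) hfv (-1)
  set B : ℝ → ℝ → ℝ := fun s z => ∫ r in (-1)..z, A s r with hB
  have hBc : Continuous fun p : ℝ × ℝ => B p.1 p.2 := continuous_primitive_param hAc (-1)
  set D : ℝ → ℝ → ℝ := fun s r =>
    ∫ x in (-1)..r, (f'' x * v s x + σ * (f' x * (v s x ^ 2 / 2))) with hD
  have hDc : Continuous fun p : ℝ × ℝ => D p.1 p.2 :=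
    continuous_primitive_param (f := fun s x => f'' x * v s x + σ * (f' x * (v s x ^ 2 / 2)))
      (by fun_prop) (-1)
  set c : ℝ → ℝ → ℝ := fun s r =>
    -(2 * (f' r * v s r)) - σ * (f r * (v s r ^ 2 / 2)) + D s r with hc
  have hcc : Continuous fun p : ℝ × ℝ => c p.1 p.2 := by
    simp only [hc]
    fun_prop
  set k : ℝ → ℝ → ℝ := fun s r => c s r + g s * (f r * v s r) with hk
  have hkc : Continuous fun p : ℝ × ℝ => k p.1 p.2 := by
    simp only [hk]
    fun_prop
  set P : ℝ → ℝ → ℝ := fun s z => ∫ r in (-1)..z, k s r with hP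
  have hPc : Continuous fun p : ℝ × ℝ => P p.1 p.2 := continuous_primitive_param hkc (-1)
  set w : ℝ → ℝ → ℝ := fun s z => f z * v s z + P s z with hw
  have hwc : Continuous fun p : ℝ × ℝ => w p.1 p.2 := by
    simp only [hw]
    fun_prop
  set b₁ : ℝ → ℝ → ℝ := fun s z => f z * v s z + ∫ r in (-1)..z, c s r with hb
  have hbc : Continuous fun p : ℝ × ℝ => b₁ p.1 p.2 :=
    hfv.add (continuous_primitive_param hcc (-1))
  have hwb : ∀ s z, b₁ s z + A s z * g s = w s z := by
    intro s z
    simp only [hb, hA, hw, hP, hk]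
    rw [intervalIntegral.integral_add ((continuous_slice hcc s).intervalIntegrable _ _)
      (((continuous_slice (f := fun s x => f x * v s x) hfv s).const_mul
        (g s)).intervalIntegrable _ _),
      intervalIntegral.integral_const_mul]
    ring
  have hshift : ∀ ρ, Continuous fun s => w s (h s - ρ) := fun ρ =>
    hwc.comp (continuous_id.prodMk (hh.sub continuous_const))
  have hshift₀ : Continuous fun s => w s (h s) := hwc.comp (continuous_id.prodMk hh)
  have hpos : ∀ᶠ ρ in 𝓝[>] (0 : ℝ), ∀ s ∈ Icc t₁ t₂, -1 < h s - ρ := by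
    obtain ⟨s₀, hs₀, hmin⟩ := isCompact_Icc.exists_isMinOn (nonempty_Icc.2 h₁₂) hh.continuousOn
    have h3 : (0 : ℝ) < h s₀ + 1 := by linarith [(S.h_mem s₀ (hmem s₀ hs₀)).1]
    filter_upwards [Ioo_mem_nhdsGT h3] with ρ hρ s hs
    have := hmin hs
    simp only [mem_ofPred_eq] at this
    linarith [hρ.2]
  have hstep : ∀ᶠ ρ in 𝓝[>] (0 : ℝ),
      B t₂ (h t₂ - ρ) - B t₁ (h t₁ - ρ) = ∫ s in t₁..t₂, w s (h s - ρ) := by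
    filter_upwards [hpos, self_mem_nhdsWithin] with ρ hρ (hρ0 : 0 < ρ)
    refine (intervalIntegral.integral_eq_sub_of_hasDerivAt (f := fun s => B s (h s - ρ))
      (fun s hs => ?_) ((hshift ρ).intervalIntegrable _ _)).symm
    rw [uIcc_of_le h₁₂] at hs
    rw [← hwb]
    have hs' := hmem s hs
    have hmemz : h s - ρ ∈ Ioo (-1) (h s) := ⟨hρ s hs, by linarith⟩
    refine hasDerivAt_along_curve (z := fun s => h s - ρ) (F₁ := b₁) (F₂ := A) ?_ ?_ hbc hAc
      ((S.h_deriv s hs').sub_const ρ)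
    · have e1 : ∀ᶠ p : ℝ × ℝ in 𝓝 (s, h s - ρ), p.1 ∈ Ioo 0 T :=
        continuous_fst.continuousAt.eventually (Ioo_mem_nhds hs'.1 hs'.2)
      have e2 : ∀ᶠ p : ℝ × ℝ in 𝓝 (s, h s - ρ), -1 < p.2 :=
        continuous_snd.continuousAt.eventually (lt_mem_nhds hmemz.1)
      have e3 : ∀ᶠ p : ℝ × ℝ in 𝓝 (s, h s - ρ), 0 < h p.1 - p.2 := by
        have : Continuous fun p : ℝ × ℝ => h p.1 - p.2 := by fun_prop
        exact this.continuousAt.eventually (lt_mem_nhds (by simpa using hρ0))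
      filter_upwards [e1, e2, e3] with p h1 h2 h3
      exact S.hasDerivAt_weighted hf hf' hf'' hfα hB hb hbc h1 ⟨h2, by linarith⟩
    · exact Eventually.of_forall fun p => hasDerivAt_primitive (continuous_slice hAc p.1) _ _
  have hzero : B t₂ (h t₂) - B t₁ (h t₁) = ∫ s in t₁..t₂, w s (h s) := by
    have cR : Continuous fun ρ => ∫ s in t₁..t₂, w s (h s - ρ) :=
      intervalIntegral.continuous_parametric_intervalIntegral_of_continuous'
        (f := fun ρ s => w s (h s - ρ)) (hwc.comp
          (continuous_snd.prodMk ((hh.comp continuous_snd).sub continuous_fst))) t₁ t₂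
    have cB : ∀ t, Continuous (B t) := continuous_slice hBc
    have cL : Continuous fun ρ => B t₂ (h t₂ - ρ) - B t₁ (h t₁ - ρ) := by
      have := cB t₁
      have := cB t₂
      fun_prop
    have l1 := (cL.tendsto 0).mono_left (nhdsWithin_le_nhds (s := Ioi 0))
    have l2 := (cR.tendsto 0).mono_left (nhdsWithin_le_nhds (s := Ioi 0))
    have := tendsto_nhds_unique (l1.congr' hstep) l2
    simpa using this
  have hL : Tendsto (fun ρ => (B t₂ (h t₂) - B t₂ (h t₂ - ρ)) / ρ -
      (B t₁ (h t₁) - B t₁ (h t₁ - ρ)) / ρ) (𝓝[>] 0) (𝓝 (A t₂ (h t₂) - A t₁ (h t₁))) := by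
    have : ∀ t, Tendsto (fun ρ => (B t (h t) - B t (h t - ρ)) / ρ) (𝓝[>] 0) (𝓝 (A t (h t))) :=
      fun t => (hasDerivAt_primitive (continuous_slice hAc t) (-1)
        (h t)).hasDerivWithinAt.tendsto_left_quotient
    exact (this t₂).sub (this t₁)
  obtain ⟨Ck, hCk⟩ := (isCompact_Icc.prod isCompact_Icc).exists_bound_of_continuousOn
    (s := Icc t₁ t₂ ×ˢ Icc (-1 : ℝ) 1) hkc.continuousOn
  obtain ⟨Cf, hCf⟩ := isCompact_Icc.exists_bound_of_continuousOn (s := Icc (-1 : ℝ) 1)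
    hfc.continuousOn
  obtain ⟨Cf', hCf'⟩ := isCompact_Icc.exists_bound_of_continuousOn (s := Icc (-1 : ℝ) 1)
    hfc'.continuousOn
  have hR : Tendsto (fun ρ => ∫ s in t₁..t₂, (w s (h s) - w s (h s - ρ)) / ρ) (𝓝[>] 0)
      (𝓝 (∫ s in t₁..t₂, (f' (h s) * v s (h s) + f (h s) * vl s + k s (h s)))) := by
    refine intervalIntegral.tendsto_integral_filter_of_dominated_convergence
      (fun _ => Cf * M + Cf' * N + Ck) ?_ ?_ (by simp) ?_
    · exact Eventually.of_forall fun ρ =>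
        ((hshift₀.sub (hshift ρ)).div_const ρ).aestronglyMeasurable
    · filter_upwards [hpos, self_mem_nhdsWithin] with ρ hρ (hρ0 : 0 < ρ)
      refine Eventually.of_forall fun s hs => ?_
      rw [uIoc_of_le h₁₂] at hs
      have hsI : s ∈ Icc t₁ t₂ := Ioc_subset_Icc_self hs
      have hs' := hmem s hsI
      have hz := S.h_mem s hs'
      have hρs := hρ s hsI
      have hzI : ∀ x ∈ Icc (h s - ρ) (h s), x ∈ Icc (-1 : ℝ) 1 := fun x hx =>
        ⟨by linarith [hx.1], by linarith [hx.2, hz.2]⟩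
      have i1 : |P s (h s) - P s (h s - ρ)| ≤ Ck * ρ := by
        simp only [hP]
        rw [intervalIntegral.integral_interval_sub_left
          ((continuous_slice hkc s).intervalIntegrable _ _)
          ((continuous_slice hkc s).intervalIntegrable _ _)]
        have := intervalIntegral.norm_integral_le_of_norm_le_const (a := h s - ρ) (b := h s)
          (C := Ck) (f := k s) (fun x hx => by
            rw [uIoc_of_le (by linarith)] at hx
            exact hCk (s, x) ⟨hsI, hzI x (Ioc_subset_Icc_self hx)⟩)
        simpa [abs_of_pos hρ0] using this
      have i2 : |f (h s) - f (h s - ρ)| ≤ Cf' * ρ := by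
        have := (convex_Icc (h s - ρ) (h s)).norm_image_sub_le_of_norm_hasDerivWithin_le
          (f := f) (f' := f') (C := Cf') (fun x _ => (hf x).hasDerivWithinAt)
          (fun x hx => hCf' x (hzI x hx)) (left_mem_Icc.2 (by linarith))
          (right_mem_Icc.2 (by linarith))
        simpa [Real.norm_eq_abs, abs_of_pos hρ0] using this
      have i3 := S.lip s hs' (h s) (h s - ρ)
      rw [sub_sub_cancel, abs_of_pos hρ0] at i3
      have i4 := S.bound s hs' (h s)
      have i5 : |f (h s - ρ)| ≤ Cf := hCf _ (hzI _ (left_mem_Icc.2 (by linarith)))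
      have hCf0 : 0 ≤ Cf := (abs_nonneg _).trans i5
      have hCf'0 : 0 ≤ Cf' * ρ := (abs_nonneg _).trans i2
      have e : w s (h s) - w s (h s - ρ) = f (h s - ρ) * (v s (h s) - v s (h s - ρ)) +
          (f (h s) - f (h s - ρ)) * v s (h s) + (P s (h s) - P s (h s - ρ)) := by
        simp only [hw]; ring
      rw [Real.norm_eq_abs, abs_div, abs_of_pos hρ0, div_le_iff₀ hρ0, e]
      have m1 := mul_le_mul i5 i3 (abs_nonneg _) hCf0
      have m2 := mul_le_mul i2 i4 (abs_nonneg _) hCf'0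
      rw [← abs_mul] at m1 m2
      calc _ ≤ _ := abs_add_three _ _ _
        _ ≤ Cf * (M * ρ) + Cf' * ρ * N + Ck * ρ := by linarith
        _ = _ := by ring
    · refine Eventually.of_forall fun s hs => ?_
      rw [uIoc_of_le h₁₂] at hs
      have hs' := hmem s (Ioc_subset_Icc_self hs)
      have hd : HasDerivWithinAt (w s) (f' (h s) * v s (h s) + f (h s) * vl s + k s (h s))
          (Iic (h s)) (h s) :=
        ((hf (h s)).hasDerivWithinAt.mul (S.deriv_left s hs')).add
          (hasDerivAt_primitive (continuous_slice hkc s) (-1) (h s)).hasDerivWithinAt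
      exact hd.tendsto_left_quotient
  have heq := tendsto_nhds_unique (hL.congr' ?_) hR
  · rw [heq]
    refine intervalIntegral.integral_congr fun s _ => ?_
    simp only [hk, hc]
    ring
  · filter_upwards [hstep] with ρ hρ
    rw [intervalIntegral.integral_div, intervalIntegral.integral_sub
      (hshift₀.intervalIntegrable _ _)
      ((hshift ρ).intervalIntegrable _ _), ← hρ, ← hzero]
    ring

end IsLeftSolution

lemma exists_abs_slope_bound_between_curves {v vt vy vyy : ℝ → ℝ → ℝ}
    {p q p' q' al be : ℝ → ℝ} {T N G Q M₀ c : ℝ}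
    (hN0 : 0 ≤ N) (hG0 : 0 ≤ G) (hQ0 : 0 ≤ Q) (hM0 : 0 ≤ M₀) (hc : 0 < c)
    (hv : Continuous fun z : ℝ × ℝ => v z.1 z.2) (hpc : Continuous p) (hqc : Continuous q)
    (hN : ∀ t ∈ Icc 0 T, ∀ y ∈ Icc (p t) (q t), |v t y| ≤ N)
    (hgap : ∀ t ∈ Icc 0 T, p t + c ≤ q t)
    (hR : ∀ t ∈ Icc 0 T, -1 ≤ p t ∧ q t ≤ 1)
    (hp : ∀ t ∈ Ioc 0 T, HasDerivAt p (p' t) t) (hp' : ∀ t ∈ Ioc 0 T, |p' t| ≤ Q)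
    (hq : ∀ t ∈ Ioc 0 T, HasDerivAt q (q' t) t) (hq' : ∀ t ∈ Ioc 0 T, |q' t| ≤ Q)
    (hal : ∀ t ∈ Ioc 0 T, HasDerivAt (fun s => v s (p s)) (al t) t)
    (hal' : ∀ t ∈ Ioc 0 T, |al t| ≤ G)
    (hbe : ∀ t ∈ Ioc 0 T, HasDerivAt (fun s => v s (q s)) (be t) t)
    (hbe' : ∀ t ∈ Ioc 0 T, |be t| ≤ G)
    (ht : ∀ t ∈ Ioc 0 T, ∀ y ∈ Ioo (p t) (q t), HasDerivAt (fun s => v s y) (vt t y) t)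
    (hy : ∀ t ∈ Ioc 0 T, ∀ y ∈ Ioo (p t) (q t), HasDerivAt (fun x => v t x) (vy t y) y)
    (hyy : ∀ t ∈ Ioc 0 T, ∀ y ∈ Ioo (p t) (q t), HasDerivAt (fun x => vy t x) (vyy t y) y)
    (pde : ∀ t ∈ Ioc 0 T, ∀ y ∈ Ioo (p t) (q t), vt t y + v t y * vy t y = vyy t y)
    (h0 : ∀ x y, p 0 ≤ y → y ≤ x → x ≤ q 0 → |v 0 x - v 0 y| ≤ M₀ * (x - y)) :
    ∃ A, 0 ≤ A ∧ ∀ t ∈ Icc 0 T, ∀ x y, p t ≤ y → y ≤ x → x ≤ q t →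
      |v t x - v t y| ≤ A * (x - y) := by
  obtain ⟨A, hA, h1⟩ := exists_slope_bound_between_curves (σ := 1) hN0 hG0 hQ0 hM0 hc hv hpc hqc
    hN (by simp) hgap hR hp hp' hq hq' hal hal' hbe hbe' ht hy hyy
    (fun t ht y hy => by rw [one_mul]; exact pde t ht y hy)
    (fun x y a b c => (le_abs_self _).trans (h0 x y a b c))
  obtain ⟨A', hA', h2⟩ := exists_slope_bound_between_curves (σ := -1)
    (v := fun t y => -v t y) (vt := fun t y => -vt t y) (vy := fun t y => -vy t y)
    (vyy := fun t y => -vyy t y) (al := fun t => -al t) (be := fun t => -be t)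
    hN0 hG0 hQ0 hM0 hc hv.neg hpc hqc
    (fun t ht y hy => by rw [abs_neg]; exact hN t ht y hy) (by simp) hgap hR hp hp' hq hq'
    (fun t ht => (hal t ht).neg) (fun t ht => by rw [abs_neg]; exact hal' t ht)
    (fun t ht => (hbe t ht).neg) (fun t ht => by rw [abs_neg]; exact hbe' t ht)
    (fun t h y hy => (ht t h y hy).neg) (fun t h y h' => (hy t h y h').neg)
    (fun t h y hy => (hyy t h y hy).neg)
    (fun t ht y hy => by linarith [pde t ht y hy])
    (fun x y a b c => by linarith [neg_abs_le (v 0 x - v 0 y), h0 x y a b c])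
  refine ⟨max A A', hA.trans (le_max_left _ _), fun t ht x y a b c => abs_le.2 ⟨?_, ?_⟩⟩
  · have := h2 t ht x y a b c
    nlinarith [le_max_right A A']
  · have := h1 t ht x y a b c
    nlinarith [le_max_left A A']

lemma abs_sub_le_of_abs_deriv_le {f f' : ℝ → ℝ} {a b M : ℝ} (hf : ContinuousOn f (Icc a b))
    (hd : ∀ x ∈ Ioo a b, HasDerivAt f (f' x) x) (hM : ∀ x ∈ Ioo a b, |f' x| ≤ M)
    {x y : ℝ} (hy : a ≤ y) (hyx : y ≤ x) (hx : x ≤ b) : |f x - f y| ≤ M * (x - y) := by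
  rcases hyx.eq_or_lt with rfl | hlt
  · simp
  · obtain ⟨c, hc, he⟩ := exists_hasDerivAt_eq_slope f f' hlt
      (hf.mono (Icc_subset_Icc hy hx)) (fun z hz => hd z (Ioo_subset_Ioo hy hx hz))
    have h1 := hM c (Ioo_subset_Ioo hy hx hc)
    have h2 : 0 < x - y := by linarith
    rwa [he, abs_div, abs_of_pos h2, div_le_iff₀ h2] at h1

namespace FluidParticleSol

variable {K h₁ : ℝ} (S : FluidParticleSol K h₁)

/-- Extension of the fluid velocity to the whole plane by clamping both arguments. -/
def ext (t y : ℝ) : ℝ := S.v (max t 0) (max (-1) (min y 1))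

lemma clamp_mem (y : ℝ) : max (-1) (min y 1) ∈ Icc (-1 : ℝ) 1 :=
  ⟨le_max_left _ _, max_le (by norm_num) (min_le_right _ _)⟩

lemma continuous_ext : Continuous fun z : ℝ × ℝ => S.ext z.1 z.2 := by
  have : Continuous fun z : ℝ × ℝ => (max z.1 0, max (-1) (min z.2 1)) := by fun_prop
  exact S.v_cont.comp_continuous this fun z => ⟨mem_Ici.2 (le_max_right _ _), clamp_mem _⟩

lemma ext_eq {t y : ℝ} (ht : 0 ≤ t) (hy : y ∈ Icc (-1 : ℝ) 1) : S.ext t y = S.v t y := by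
  simp [ext, ht, hy.1, hy.2]

lemma ext_clamp (t y : ℝ) : S.ext t (max (-1) (min y 1)) = S.ext t y := by
  have := clamp_mem y
  simp [ext]

lemma ext_neg_one {t : ℝ} (ht : 0 ≤ t) : S.ext t (-1) = 0 := by
  rw [S.ext_eq ht (by norm_num), S.bc_left t ht]

lemma ext_one {t : ℝ} (ht : 0 ≤ t) : S.ext t 1 = 0 := by
  rw [S.ext_eq ht (by norm_num), S.bc_right t ht]

lemma h_mem_Icc {t : ℝ} (ht : 0 ≤ t) : S.h t ∈ Icc (-1 : ℝ) 1 := Ioo_subset_Icc_self (S.h_in t ht)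

lemma ext_h {t : ℝ} (ht : 0 ≤ t) : S.ext t (S.h t) = deriv S.h t := by
  rw [S.ext_eq ht (S.h_mem_Icc ht), S.ode1 t ht]

lemma h_hasDerivAt (t : ℝ) : HasDerivAt S.h (deriv S.h t) t :=
  (S.h_C2.differentiable (by norm_num) t).hasDerivAt

lemma contDiff_deriv_h : ContDiff ℝ 1 (deriv S.h) :=
  ((contDiff_succ_iff_deriv (n := 1)).1 (by simpa [one_add_one_eq_two] using S.h_C2)).2.2

lemma deriv_h_hasDerivAt (t : ℝ) : HasDerivAt (deriv S.h) (deriv (deriv S.h) t) t :=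
  (S.contDiff_deriv_h.differentiable (by norm_num) t).hasDerivAt

lemma continuous_h : Continuous S.h := S.h_C2.continuous

lemma continuous_deriv_h : Continuous (deriv S.h) := S.contDiff_deriv_h.continuous

lemma continuous_deriv_deriv_h : Continuous (deriv (deriv S.h)) :=
  S.contDiff_deriv_h.continuous_deriv le_rfl

lemma ext_hasDerivAt_t {t y : ℝ} (ht : 0 < t) (hy : y ∈ Icc (-1 : ℝ) 1) :
    HasDerivAt (fun s => S.ext s y) (S.vt t y) t := by
  refine (S.hasDeriv_t t ht.le y hy).congr_of_eventuallyEq ?_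
  filter_upwards [lt_mem_nhds ht] with s hs using S.ext_eq hs.le hy

lemma ext_hasDerivAt_y {t y : ℝ} (ht : 0 ≤ t) (hy : y ∈ Ioo (-1 : ℝ) 1) (hne : y ≠ S.h t) :
    HasDerivAt (S.ext t) (S.vy t y) y := by
  refine (S.hasDeriv_y t ht y hy hne).congr_of_eventuallyEq ?_
  filter_upwards [Ioo_mem_nhds hy.1 hy.2] with x hx using S.ext_eq ht (Ioo_subset_Icc_self hx)

lemma ext_hasDerivWithinAt_left {t : ℝ} (ht : 0 ≤ t) :
    HasDerivWithinAt (S.ext t) (S.vyL t) (Iic (S.h t)) (S.h t) := by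
  refine (S.hasDeriv_yL t ht).congr_of_eventuallyEq ?_ (S.ext_eq ht (S.h_mem_Icc ht))
  filter_upwards [mem_nhdsWithin_of_mem_nhds (Ioo_mem_nhds (S.h_in t ht).1 (S.h_in t ht).2)]
    with x hx using S.ext_eq ht (Ioo_subset_Icc_self hx)

lemma ext_hasDerivWithinAt_right {t : ℝ} (ht : 0 ≤ t) :
    HasDerivWithinAt (S.ext t) (S.vyR t) (Ici (S.h t)) (S.h t) := by
  refine (S.hasDeriv_yR t ht).congr_of_eventuallyEq ?_ (S.ext_eq ht (S.h_mem_Icc ht))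
  filter_upwards [mem_nhdsWithin_of_mem_nhds (Ioo_mem_nhds (S.h_in t ht).1 (S.h_in t ht).2)]
    with x hx using S.ext_eq ht (Ioo_subset_Icc_self hx)

lemma ext_h_hasDerivAt {t : ℝ} (ht : 0 < t) :
    HasDerivAt (fun s => S.ext s (S.h s)) (deriv (deriv S.h) t) t := by
  refine (S.deriv_h_hasDerivAt t).congr_of_eventuallyEq ?_
  filter_upwards [lt_mem_nhds ht] with s hs using S.ext_h hs.le

lemma exists_bound_left : ∃ M, 0 ≤ M ∧ ∀ y ∈ Ico (-1) (S.h 0), |S.vy 0 y| ≤ M := by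
  have hc : ContinuousOn (Function.update (S.vy 0) (S.h 0) (S.vyL 0)) (Icc (-1) (S.h 0)) := by
    have hlt := (S.h_in 0 le_rfl).1
    rw [continuousOn_update_iff, Icc_sdiff_right]
    refine ⟨S.vy_contL 0 le_rfl, fun _ => ?_⟩
    rw [nhdsWithin_Ico_eq_nhdsLT hlt]
    exact S.vy_limL 0 le_rfl
  obtain ⟨M, hM⟩ := isCompact_Icc.exists_bound_of_continuousOn hc
  refine ⟨|M|, abs_nonneg _, fun y hy => ?_⟩
  have := hM y (Ico_subset_Icc_self hy)
  rw [Function.update_of_ne hy.2.ne] at this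
  exact this.trans (le_abs_self _)

lemma exists_bound_right : ∃ M, 0 ≤ M ∧ ∀ y ∈ Ioc (S.h 0) 1, |S.vy 0 y| ≤ M := by
  have hc : ContinuousOn (Function.update (S.vy 0) (S.h 0) (S.vyR 0)) (Icc (S.h 0) 1) := by
    have hlt := (S.h_in 0 le_rfl).2
    rw [continuousOn_update_iff, Icc_sdiff_left]
    refine ⟨S.vy_contR 0 le_rfl, fun _ => ?_⟩
    rw [nhdsWithin_Ioc_eq_nhdsGT hlt]
    exact S.vy_limR 0 le_rfl
  obtain ⟨M, hM⟩ := isCompact_Icc.exists_bound_of_continuousOn hc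
  refine ⟨|M|, abs_nonneg _, fun y hy => ?_⟩
  have := hM y (Ioc_subset_Icc_self hy)
  rw [Function.update_of_ne hy.1.ne'] at this
  exact this.trans (le_abs_self _)

lemma exists_bound (T : ℝ) : ∃ N, 0 ≤ N ∧ ∀ t ∈ Icc 0 T, ∀ y, |S.ext t y| ≤ N := by
  obtain ⟨N, hN⟩ := (isCompact_Icc.prod isCompact_Icc).exists_bound_of_continuousOn
    (s := Icc 0 T ×ˢ Icc (-1 : ℝ) 1) S.continuous_ext.continuousOn
  refine ⟨|N|, abs_nonneg _, fun t ht y => ?_⟩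
  rw [← S.ext_clamp]
  exact (hN (t, _) ⟨ht, clamp_mem y⟩).trans (le_abs_self _)

lemma exists_lip {T : ℝ} (hT : 0 ≤ T) :
    ∃ M, 0 ≤ M ∧ ∀ t ∈ Icc 0 T, ∀ x y, |S.ext t x - S.ext t y| ≤ M * |x - y| := by
  obtain ⟨N, hN0, hN⟩ := S.exists_bound T
  have hbd : ∀ f : ℝ → ℝ, Continuous f → ∃ G, 0 ≤ G ∧ ∀ t ∈ Icc 0 T, |f t| ≤ G := fun f hf => by
    obtain ⟨G, hG⟩ := isCompact_Icc.exists_bound_of_continuousOn (s := Icc 0 T) hf.continuousOn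
    exact ⟨|G|, abs_nonneg _, fun t ht => (hG t ht).trans (le_abs_self _)⟩
  obtain ⟨Q, hQ0, hQ⟩ := hbd _ S.continuous_deriv_h
  obtain ⟨G, hG0, hG⟩ := hbd _ S.continuous_deriv_deriv_h
  obtain ⟨a, ha, hmin⟩ := isCompact_Icc.exists_isMinOn (nonempty_Icc.2 hT)
    S.continuous_h.continuousOn
  obtain ⟨b, hb, hmax⟩ := isCompact_Icc.exists_isMaxOn (nonempty_Icc.2 hT)
    S.continuous_h.continuousOn
  have pos : ∀ {t}, t ∈ Ioc 0 T → 0 < t := fun h => h.1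
  obtain ⟨ML, hML0, hML⟩ := S.exists_bound_left
  obtain ⟨MR, hMR0, hMR⟩ := S.exists_bound_right
  obtain ⟨A, hA0, hA⟩ := exists_abs_slope_bound_between_curves (T := T) (p := fun _ => -1)
    (q := S.h) (p' := fun _ => 0) (q' := deriv S.h) (al := fun _ => 0) (be := deriv (deriv S.h))
    (vt := S.vt) (vy := S.vy) (vyy := S.vyy) (c := S.h a + 1)
    hN0 hG0 hQ0 hML0 (by linarith [(S.h_in a ha.1).1]) S.continuous_ext continuous_const
    S.continuous_h (fun t ht y _ => hN t ht y)
    (fun t ht => by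
      have := hmin ht
      simp only [mem_ofPred_eq] at this
      linarith)
    (fun t ht => ⟨le_rfl, (S.h_in t ht.1).2.le⟩)
    (fun t _ => hasDerivAt_const _ _) (fun _ _ => by simpa using hQ0)
    (fun t _ => S.h_hasDerivAt t) (fun t ht => hQ t (Ioc_subset_Icc_self ht))
    (fun t ht => (hasDerivAt_const t (0 : ℝ)).congr_of_eventuallyEq (by
      filter_upwards [lt_mem_nhds (pos ht)] with s hs using S.ext_neg_one hs.le))
    (fun _ _ => by simpa using hG0)
    (fun t ht => S.ext_h_hasDerivAt ht.1) (fun t ht => hG t (Ioc_subset_Icc_self ht))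
    (fun t ht y hy => S.ext_hasDerivAt_t ht.1 ⟨hy.1.le, hy.2.le.trans (S.h_in t ht.1.le).2.le⟩)
    (fun t ht y hy => S.ext_hasDerivAt_y ht.1.le ⟨hy.1, hy.2.trans (S.h_in t ht.1.le).2⟩ hy.2.ne)
    (fun t ht y hy => S.hasDeriv_yy t ht.1.le y ⟨hy.1, hy.2.trans (S.h_in t ht.1.le).2⟩ hy.2.ne)
    (fun t ht y hy => by
      have hy' : y ∈ Ioo (-1 : ℝ) 1 := ⟨hy.1, hy.2.trans (S.h_in t ht.1.le).2⟩
      rw [S.ext_eq ht.1.le (Ioo_subset_Icc_self hy')]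
      exact S.pde t ht.1.le y hy' hy.2.ne)
    (fun x y h1 h2 h3 => abs_sub_le_of_abs_deriv_le (f' := S.vy 0)
      (continuous_slice S.continuous_ext 0).continuousOn
      (fun z hz => S.ext_hasDerivAt_y le_rfl ⟨hz.1, hz.2.trans (S.h_in 0 le_rfl).2⟩ hz.2.ne)
      (fun z hz => hML z (Ioo_subset_Ico_self hz)) h1 h2 h3)
  obtain ⟨A', hA'0, hA'⟩ := exists_abs_slope_bound_between_curves (T := T) (q := fun _ => 1)
    (p := S.h) (q' := fun _ => 0) (p' := deriv S.h) (be := fun _ => 0) (al := deriv (deriv S.h))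
    (vt := S.vt) (vy := S.vy) (vyy := S.vyy) (c := 1 - S.h b)
    hN0 hG0 hQ0 hMR0 (by linarith [(S.h_in b hb.1).2]) S.continuous_ext S.continuous_h
    continuous_const (fun t ht y _ => hN t ht y)
    (fun t ht => by
      have := hmax ht
      simp only [mem_ofPred_eq] at this
      linarith)
    (fun t ht => ⟨(S.h_in t ht.1).1.le, le_rfl⟩)
    (fun t _ => S.h_hasDerivAt t) (fun t ht => hQ t (Ioc_subset_Icc_self ht))
    (fun t _ => hasDerivAt_const _ _) (fun _ _ => by simpa using hQ0)
    (fun t ht => S.ext_h_hasDerivAt ht.1) (fun t ht => hG t (Ioc_subset_Icc_self ht))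
    (fun t ht => (hasDerivAt_const t (0 : ℝ)).congr_of_eventuallyEq (by
      filter_upwards [lt_mem_nhds (pos ht)] with s hs using S.ext_one hs.le))
    (fun _ _ => by simpa using hG0)
    (fun t ht y hy => S.ext_hasDerivAt_t ht.1 ⟨(S.h_in t ht.1.le).1.le.trans hy.1.le, hy.2.le⟩)
    (fun t ht y hy => S.ext_hasDerivAt_y ht.1.le ⟨(S.h_in t ht.1.le).1.trans hy.1, hy.2⟩ hy.1.ne')
    (fun t ht y hy => S.hasDeriv_yy t ht.1.le y ⟨(S.h_in t ht.1.le).1.trans hy.1, hy.2⟩ hy.1.ne')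
    (fun t ht y hy => by
      have hy' : y ∈ Ioo (-1 : ℝ) 1 := ⟨(S.h_in t ht.1.le).1.trans hy.1, hy.2⟩
      rw [S.ext_eq ht.1.le (Ioo_subset_Icc_self hy')]
      exact S.pde t ht.1.le y hy' hy.1.ne')
    (fun x y h1 h2 h3 => abs_sub_le_of_abs_deriv_le (f' := S.vy 0)
      (continuous_slice S.continuous_ext 0).continuousOn
      (fun z hz => S.ext_hasDerivAt_y le_rfl ⟨(S.h_in 0 le_rfl).1.trans hz.1, hz.2⟩ hz.1.ne')
      (fun z hz => hMR z (Ioo_subset_Ioc_self hz)) h1 h2 h3)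
  have key : ∀ t ∈ Icc 0 T, ∀ x y, -1 ≤ y → y ≤ x → x ≤ 1 →
      |S.ext t x - S.ext t y| ≤ max A A' * (x - y) := by
    intro t ht x y h1 h2 h3
    have mA := le_max_left A A'
    have mA' := le_max_right A A'
    rcases le_total x (S.h t) with hx | hx
    · exact (hA t ht x y h1 h2 hx).trans (mul_le_mul_of_nonneg_right mA (by linarith))
    rcases le_total (S.h t) y with hy | hy
    · exact (hA' t ht x y hy h2 h3).trans (mul_le_mul_of_nonneg_right mA' (by linarith))
    have e1 := (hA t ht _ y h1 hy le_rfl).trans (mul_le_mul_of_nonneg_right mA (by linarith))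
    have e2 := (hA' t ht x _ le_rfl hx h3).trans (mul_le_mul_of_nonneg_right mA' (by linarith))
    have := abs_sub_le (S.ext t x) (S.ext t (S.h t)) (S.ext t y)
    linarith
  refine ⟨max A A', hA0.trans (le_max_left _ _), fun t ht x y => ?_⟩
  wlog hyx : y ≤ x generalizing x y
  · rw [abs_sub_comm, abs_sub_comm x]
    exact this y x (not_le.1 hyx).le
  rw [← S.ext_clamp t x, ← S.ext_clamp t y, abs_of_nonneg (by linarith : 0 ≤ x - y)]
  refine (key t ht _ _ (clamp_mem y).1 (by gcongr) (clamp_mem x).2).trans ?_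
  refine mul_le_mul_of_nonneg_left ?_ (hA0.trans (le_max_left _ _))
  rcases max_cases (-1) (min x 1) with h1 | h1 <;> rcases max_cases (-1) (min y 1) with h2 | h2 <;>
    rcases min_cases x 1 with h3 | h3 <;> rcases min_cases y 1 with h4 | h4 <;> linarith

end FluidParticleSol

lemma HasDerivAt.comp_neg_arg {f : ℝ → ℝ} {f' x : ℝ} (hf : HasDerivAt f f' (-x)) :
    HasDerivAt (fun y => f (-y)) (-f') x :=
  (hf.comp x (hasDerivAt_neg x)).congr_deriv (by ring)

lemma IsLeftSolution.intervalIntegrable_evolution {v vt vy vyy : ℝ → ℝ → ℝ} {h g vl : ℝ → ℝ}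
    {σ T N M : ℝ} (S : IsLeftSolution v vt vy vyy h g vl σ T N M) {f f' f'' : ℝ → ℝ}
    (hf : Continuous f) (hf' : Continuous f') (hf'' : Continuous f'') {t₁ t₂ : ℝ}
    (h₁ : 0 < t₁) (h₁₂ : t₁ ≤ t₂) (h₂ : t₂ < T) :
    IntervalIntegrable (fun s => f (h s) * vl s - f' (h s) * v s (h s) -
      σ * (f (h s) * (v s (h s) ^ 2 / 2)) + g s * (f (h s) * v s (h s)) +
      ∫ x in (-1)..h s, (f'' x * v s x + σ * (f' x * (v s x ^ 2 / 2)))) volume t₁ t₂ := by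
  have hv := S.cont
  have hg := S.g_cont
  have hh := S.h_cont
  have hp : Continuous fun p : ℝ × ℝ =>
      ∫ x in (-1)..p.2, (f'' x * v p.1 x + σ * (f' x * (v p.1 x ^ 2 / 2))) :=
    continuous_primitive_param
      (f := fun s x => f'' x * v s x + σ * (f' x * (v s x ^ 2 / 2))) (by fun_prop) (-1)
  have hp2 : Continuous fun s =>
      ∫ x in (-1)..h s, (f'' x * v s x + σ * (f' x * (v s x ^ 2 / 2))) :=
    hp.comp (continuous_id.prodMk hh)
  have hv2 : Continuous fun s => v s (h s) := hv.comp (continuous_id.prodMk hh)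
  have c1 : Continuous fun s => f (h s) := hf.comp hh
  have c2 : Continuous fun s => f' (h s) := hf'.comp hh
  refine IntervalIntegrable.add (IntervalIntegrable.add (IntervalIntegrable.sub
    (IntervalIntegrable.sub ?_ ?_) ?_) ?_) (hp2.intervalIntegrable _ _)
  · exact (S.intervalIntegrable_slope h₁ h₁₂ h₂).continuousOn_mul c1.continuousOn
  all_goals exact Continuous.intervalIntegrable (by fun_prop) _ _

namespace FluidParticleSol

variable {K h₁ : ℝ} (S : FluidParticleSol K h₁)

lemma isLeftSolution {T N M : ℝ} (hN : ∀ t ∈ Icc 0 T, ∀ y, |S.ext t y| ≤ N)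
    (hM : ∀ t ∈ Icc 0 T, ∀ x y, |S.ext t x - S.ext t y| ≤ M * |x - y|) :
    IsLeftSolution S.ext S.vt S.vy S.vyy S.h (deriv S.h) S.vyL 1 T N M where
  cont := S.continuous_ext
  h_cont := S.continuous_h
  g_cont := S.continuous_deriv_h
  abs_σ := by simp
  h_deriv t _ := S.h_hasDerivAt t
  h_mem t ht := S.h_in t ht.1.le
  bound t ht := hN t (Ioo_subset_Icc_self ht)
  lip t ht := hM t (Ioo_subset_Icc_self ht)
  left t ht := S.ext_neg_one ht.1.le
  deriv_t t ht y hy :=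
    S.ext_hasDerivAt_t ht.1 ⟨hy.1.le, hy.2.le.trans (S.h_in t ht.1.le).2.le⟩
  deriv_y t ht y hy :=
    S.ext_hasDerivAt_y ht.1.le ⟨hy.1, hy.2.trans (S.h_in t ht.1.le).2⟩ hy.2.ne
  deriv_yy t ht y hy :=
    S.hasDeriv_yy t ht.1.le y ⟨hy.1, hy.2.trans (S.h_in t ht.1.le).2⟩ hy.2.ne
  pde t ht y hy := by
    have hy' : y ∈ Ioo (-1 : ℝ) 1 := ⟨hy.1, hy.2.trans (S.h_in t ht.1.le).2⟩
    rw [S.ext_eq ht.1.le (Ioo_subset_Icc_self hy'), one_mul]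
    exact S.pde t ht.1.le y hy' hy.2.ne
  deriv_left t ht := S.ext_hasDerivWithinAt_left ht.1.le

lemma isLeftSolution_reflect {T N M : ℝ} (hN : ∀ t ∈ Icc 0 T, ∀ y, |S.ext t y| ≤ N)
    (hM : ∀ t ∈ Icc 0 T, ∀ x y, |S.ext t x - S.ext t y| ≤ M * |x - y|) :
    IsLeftSolution (fun t y => S.ext t (-y)) (fun t y => S.vt t (-y)) (fun t y => -S.vy t (-y))
      (fun t y => S.vyy t (-y)) (fun t => -S.h t) (fun t => -deriv S.h t) (fun t => -S.vyR t)
      (-1) T N M := by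
  have hI : ∀ t ∈ Ioo 0 T, ∀ y ∈ Ioo (-1) (-S.h t), -y ∈ Ioo (-1 : ℝ) 1 ∧ -y ≠ S.h t :=
    fun t ht y hy => ⟨⟨by linarith [(S.h_in t ht.1.le).1, hy.2], by linarith [hy.1]⟩,
      by linarith [hy.2] |> fun h : S.h t < -y => h.ne'⟩
  refine ⟨?_, ?_, ?_, ?_, ?_, ?_, ?_, ?_, ?_, ?_, ?_, ?_, ?_, ?_⟩
  · exact S.continuous_ext.comp (continuous_fst.prodMk continuous_snd.neg)
  · exact S.continuous_h.neg
  · exact S.continuous_deriv_h.neg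
  · simp
  · exact fun t _ => (S.h_hasDerivAt t).neg
  · exact fun t ht => ⟨by linarith [(S.h_in t ht.1.le).2], by linarith [(S.h_in t ht.1.le).1]⟩
  · exact fun t ht y => hN t (Ioo_subset_Icc_self ht) _
  · intro t ht x y
    have := hM t (Ioo_subset_Icc_self ht) (-x) (-y)
    rwa [show -x - -y = -(x - y) by ring, abs_neg] at this
  · intro t ht
    simpa using S.ext_one ht.1.le
  · exact fun t ht y hy => S.ext_hasDerivAt_t ht.1 (Ioo_subset_Icc_self (hI t ht y hy).1)
  · intro t ht y hy
    exact (S.ext_hasDerivAt_y ht.1.le (hI t ht y hy).1 (hI t ht y hy).2).comp_neg_arg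
  · intro t ht y hy
    simpa using (S.hasDeriv_yy t ht.1.le _ (hI t ht y hy).1 (hI t ht y hy).2).comp_neg_arg.fun_neg
  · intro t ht y hy
    have := S.pde t ht.1.le _ (hI t ht y hy).1 (hI t ht y hy).2
    rw [S.ext_eq ht.1.le (Ioo_subset_Icc_self (hI t ht y hy).1)]
    linarith
  · intro t ht
    have h1 : HasDerivWithinAt (S.ext t) (S.vyR t) (Ici (S.h t)) (-(-S.h t)) := by
      rw [neg_neg]
      exact S.ext_hasDerivWithinAt_right ht.1.le
    have := h1.scomp (-S.h t) (hasDerivAt_neg (-S.h t)).hasDerivWithinAt (s := Iic (-S.h t))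
      (fun x hx => by
        simp only [mem_Iic] at hx
        simp only [mem_Ici]
        linarith)
    simpa [Function.comp_def] using this

/-- The jump of the spatial derivative across the particle. -/
noncomputable def jump (t : ℝ) : ℝ := deriv (deriv S.h) t - K * (h₁ - S.h t)

lemma jump_eq {t : ℝ} (ht : 0 ≤ t) : S.jump t = S.vyR t - S.vyL t := by
  rw [jump, S.ode2 t ht]; ring

lemma continuous_jump : Continuous S.jump := by
  have h1 := S.continuous_deriv_deriv_h
  have h2 := S.continuous_h
  unfold jump
  fun_prop

lemma integral_test_sub {φ φ' φ'' : ℝ → ℝ} (hφ : ∀ x, HasDerivAt φ (φ' x) x)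
    (hφ' : ∀ x, HasDerivAt φ' (φ'' x) x) (hφ'' : Continuous φ'') (hl : φ (-1) = 0)
    (hr : φ 1 = 0) {t₁ t₂ : ℝ} (h1 : 0 < t₁) (h12 : t₁ ≤ t₂) :
    (∫ x in (-1)..1, φ x * S.ext t₂ x) - (∫ x in (-1)..1, φ x * S.ext t₁ x) =
    ∫ s in t₁..t₂, ((∫ x in (-1)..1, (φ'' x * S.ext s x + φ' x * (S.ext s x ^ 2 / 2))) -
      φ (S.h s) * S.jump s) := by
  obtain ⟨N, -, hN⟩ := S.exists_bound (t₂ + 1)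
  obtain ⟨M, -, hM⟩ := S.exists_lip (T := t₂ + 1) (by linarith)
  have hLs := S.isLeftSolution hN hM
  have hRs := S.isLeftSolution_reflect hN hM
  have hφc : Continuous φ := continuous_iff_continuousAt.2 fun x => (hφ x).continuousAt
  have hφc' : Continuous φ' := continuous_iff_continuousAt.2 fun x => (hφ' x).continuousAt
  have hv := S.continuous_ext
  have hh := S.continuous_h
  have hg := S.continuous_deriv_h
  have eL := hLs.evolution hφ hφ' hφ'' hl h1 h12 (by linarith)
  have eR := hRs.evolution (f := fun x => φ (-x)) (f' := fun x => -φ' (-x))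
    (f'' := fun x => φ'' (-x))
    (fun x => (hφ (-x)).comp_neg_arg) (fun x => by simpa using (hφ' (-x)).comp_neg_arg.fun_neg)
    (by fun_prop) (by simpa using hr) h1 h12 (by linarith)
  have hvs : ∀ t, Continuous (S.ext t) := continuous_slice hv
  have split : ∀ (F : ℝ → ℝ) (a : ℝ), Continuous F →
      (∫ x in (-1)..a, F x) + (∫ x in (-1)..(-a), F (-x)) = ∫ x in (-1)..1, F x := by
    intro F a hF
    rw [intervalIntegral.integral_comp_neg (fun x => F x), neg_neg, neg_neg]
    exact intervalIntegral.integral_add_adjacent_intervals (hF.intervalIntegrable _ _)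
      (hF.intervalIntegrable _ _)
  have s1 := split (fun x => φ x * S.ext t₁ x) (S.h t₁) (hφc.mul (hvs t₁))
  have s2 := split (fun x => φ x * S.ext t₂ x) (S.h t₂) (hφc.mul (hvs t₂))
  have e : (∫ x in (-1)..1, φ x * S.ext t₂ x) - (∫ x in (-1)..1, φ x * S.ext t₁ x) =
      ((∫ x in (-1)..S.h t₂, φ x * S.ext t₂ x) - ∫ x in (-1)..S.h t₁, φ x * S.ext t₁ x) +
      ((∫ x in (-1)..(-S.h t₂), φ (-x) * S.ext t₂ (-x)) -
        ∫ x in (-1)..(-S.h t₁), φ (-x) * S.ext t₁ (-x)) := by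
    rw [← s1, ← s2]; ring
  rw [e, eL, eR, ← intervalIntegral.integral_add]
  · refine intervalIntegral.integral_congr fun s hs => ?_
    rw [uIcc_of_le h12] at hs
    have s3 := split (fun x => φ'' x * S.ext s x + φ' x * (S.ext s x ^ 2 / 2)) (S.h s) (by
      have := hvs s
      fun_prop)
    simp only [neg_neg]
    rw [← s3, S.jump_eq (h1.le.trans hs.1)]
    simp only [mul_neg, neg_mul, one_mul, neg_neg, mul_comm]
    ring
  · exact hLs.intervalIntegrable_evolution hφc hφc' hφ'' h1 h12 (by linarith)
  · exact hRs.intervalIntegrable_evolution (f := fun x => φ (-x)) (f' := fun x => -φ' (-x))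
      (f'' := fun x => φ'' (-x)) (by fun_prop) (by fun_prop) (by fun_prop) h1 h12 (by linarith)

lemma hasDerivAt_integral_test {φ φ' φ'' : ℝ → ℝ} (hφ : ∀ x, HasDerivAt φ (φ' x) x)
    (hφ' : ∀ x, HasDerivAt φ' (φ'' x) x) (hφ'' : Continuous φ'') (hl : φ (-1) = 0)
    (hr : φ 1 = 0) {t : ℝ} (ht : 0 < t) :
    HasDerivAt (fun s => ∫ x in (-1)..1, φ x * S.ext s x)
      ((∫ x in (-1)..1, (φ'' x * S.ext t x + φ' x * (S.ext t x ^ 2 / 2))) -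
        φ (S.h t) * S.jump t) t := by
  have hφc : Continuous φ := continuous_iff_continuousAt.2 fun x => (hφ x).continuousAt
  have hφc' : Continuous φ' := continuous_iff_continuousAt.2 fun x => (hφ' x).continuousAt
  have hv := S.continuous_ext
  have hh := S.continuous_h
  have hj := S.continuous_jump
  have hc : Continuous fun s => (∫ x in (-1)..1, (φ'' x * S.ext s x +
      φ' x * (S.ext s x ^ 2 / 2))) - φ (S.h s) * S.jump s := by
    refine Continuous.sub ?_ (by fun_prop)
    exact intervalIntegral.continuous_parametric_intervalIntegral_of_continuous'
      (f := fun s x => φ'' x * S.ext s x + φ' x * (S.ext s x ^ 2 / 2)) (by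
        simp only [Function.uncurry_def]
        fun_prop) _ _
  refine ((hasDerivAt_primitive hc (t / 2) t).const_add
    (∫ x in (-1)..1, φ x * S.ext (t / 2) x)).congr_of_eventuallyEq ?_
  filter_upwards [lt_mem_nhds (by linarith : t / 2 < t)] with s hs
  rw [← S.integral_test_sub hφ hφ' hφ'' hl hr (by linarith) hs.le]
  ring

end FluidParticleSol

lemma exists_polynomial_near_in_mean {θ : ℝ → ℝ} (hθ : IntervalIntegrable θ volume (-1) 1)
    (h0 : ∫ x in (-1)..1, θ x = 0) {ε : ℝ} (hε : 0 < ε) :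
    ∃ p : Polynomial ℝ, ∫ x in (-1)..1, |p.eval x - θ x| ≤ ε ∧
      ∫ x in (-1)..1, p.eval x = 0 := by
  have hI : (-1 : ℝ) ≤ 1 := by norm_num
  have hθ' : Integrable θ (volume.restrict (Ioc (-1) 1)) :=
    (intervalIntegrable_iff_integrableOn_Ioc_of_le hI).1 hθ
  obtain ⟨g, -, hg, hgc, -⟩ := hθ'.exists_hasCompactSupport_integral_sub_le
    (by positivity : 0 < ε / 4)
  rw [← intervalIntegral.integral_of_le hI] at hg
  obtain ⟨p, hp⟩ := exists_polynomial_near_of_continuousOn (-1) 1 g hgc.continuousOn (ε / 8)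
    (by positivity)
  have ip : ∀ q : Polynomial ℝ, IntervalIntegrable (fun x => q.eval x) volume (-1) 1 :=
    fun q => q.continuous.intervalIntegrable _ _
  have ig := hgc.intervalIntegrable (μ := volume) (-1) 1
  have e1 : ∫ x in (-1)..1, |p.eval x - θ x| ≤ ε / 2 := by
    have := intervalIntegral.integral_mono_on hI ((ip p).sub hθ).abs
      ((intervalIntegrable_const (c := ε / 8)).add (hθ.sub ig).norm) (fun x hx => by
        have h1 := (hp x hx).le
        have h2 := abs_sub_le (p.eval x) (g x) (θ x)
        rw [abs_sub_comm (g x)] at h2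
        simp only [Real.norm_eq_abs] at *
        linarith)
    rw [intervalIntegral.integral_add (by simp) (hθ.sub ig).norm] at this
    simp only [intervalIntegral.integral_const, smul_eq_mul] at this
    linarith
  set c : ℝ := (∫ x in (-1)..1, p.eval x) / 2 with hc
  have hcb : |c| ≤ ε / 4 := by
    have h1 : ∫ x in (-1)..1, p.eval x = ∫ x in (-1)..1, (p.eval x - θ x) := by
      rw [intervalIntegral.integral_sub (ip p) hθ, h0, sub_zero]
    have h2 := intervalIntegral.abs_integral_le_integral_abs (μ := volume)
      (f := fun x => p.eval x - θ x) hI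
    rw [← h1] at h2
    rw [hc, abs_div, abs_two]
    linarith
  refine ⟨p - Polynomial.C c, ?_, ?_⟩
  · have := intervalIntegral.integral_mono_on hI ((ip (p - Polynomial.C c)).sub hθ).abs
      ((intervalIntegrable_const (c := |c|)).add ((ip p).sub hθ).abs) (fun x hx => by
        simp only [Polynomial.eval_sub, Polynomial.eval_C]
        have := abs_sub (p.eval x - θ x) c
        rw [show p.eval x - c - θ x = p.eval x - θ x - c by ring]
        linarith)
    rw [intervalIntegral.integral_add (by simp) ((ip p).sub hθ).abs] at this
    simp only [intervalIntegral.integral_const, smul_eq_mul] at this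
    linarith
  · simp only [Polynomial.eval_sub, Polynomial.eval_C]
    rw [intervalIntegral.integral_sub (ip p) (by simp)]
    simp only [intervalIntegral.integral_const, smul_eq_mul, hc]
    ring

lemma IntervalIntegrable.mul_of_abs_le {q F : ℝ → ℝ} {a b C : ℝ}
    (hq : IntervalIntegrable q volume a b) (hF : Measurable F) (hC : ∀ x, |F x| ≤ C) :
    IntervalIntegrable (fun x => q x * F x) volume a b := by
  refine (hq.norm.mul_const C).mono_fun
    (hq.aestronglyMeasurable_restrict_uIoc.mul hF.aestronglyMeasurable)
    (Eventually.of_forall fun x => ?_)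
  have hC0 : 0 ≤ C := (abs_nonneg _).trans (hC x)
  simp only [norm_mul, Real.norm_eq_abs, abs_abs, abs_of_nonneg hC0]
  exact mul_le_mul_of_nonneg_left (hC x) (abs_nonneg _)

lemma abs_integral_mul_le {q F : ℝ → ℝ} {a b C : ℝ} (hab : a ≤ b)
    (hq : IntervalIntegrable q volume a b) (hC : ∀ x, |F x| ≤ C) :
    |∫ x in a..b, q x * F x| ≤ C * ∫ x in a..b, |q x| := by
  have := intervalIntegral.norm_integral_le_of_norm_le (μ := volume) (f := fun x => q x * F x)
    (g := fun x => C * |q x|) hab (Eventually.of_forall fun x _ => by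
      rw [norm_mul, mul_comm]
      exact mul_le_mul_of_nonneg_right (hC x) (norm_nonneg _)) (hq.abs.const_mul C)
  rwa [intervalIntegral.integral_const_mul] at this

namespace FluidParticleSol

variable {K h₁ : ℝ} (S : FluidParticleSol K h₁)

lemma ext_hasDerivAt_deriv {t y : ℝ} (ht : 0 ≤ t) (hy : y ∈ Ioo (-1 : ℝ) 1) (hne : y ≠ S.h t) :
    HasDerivAt (S.ext t) (deriv (S.ext t) y) y :=
  (S.ext_hasDerivAt_y ht hy hne).differentiableAt.hasDerivAt

lemma abs_deriv_ext_le {t M : ℝ} (hM0 : 0 ≤ M)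
    (hM : ∀ x y, |S.ext t x - S.ext t y| ≤ M * |x - y|) (y : ℝ) : |deriv (S.ext t) y| ≤ M :=
  norm_deriv_le_of_lip' (f := S.ext t) hM0 (Eventually.of_forall fun x => hM x y)

lemma exists_deriv_bound {t : ℝ} (ht : 0 ≤ t) : ∃ M, 0 ≤ M ∧ ∀ y, |deriv (S.ext t) y| ≤ M := by
  obtain ⟨M, hM0, hM⟩ := S.exists_lip ht
  exact ⟨M, hM0, S.abs_deriv_ext_le hM0 (hM t ⟨ht, le_rfl⟩)⟩

lemma intervalIntegrable_deriv_ext {t : ℝ} (ht : 0 ≤ t) (a b : ℝ) :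
    IntervalIntegrable (deriv (S.ext t)) volume a b := by
  obtain ⟨M, -, hM⟩ := S.exists_deriv_bound ht
  have := (intervalIntegrable_const (c := (1 : ℝ)) (a := a) (b := b)
    (μ := volume)).mul_of_abs_le (measurable_deriv (S.ext t)) hM
  simpa using this

/-- Integration by parts against the extended velocity. -/
lemma integral_deriv_mul_ext {F F' : ℝ → ℝ} {a b t : ℝ} (ht : 0 ≤ t) (hab : a ≤ b) (ha : -1 ≤ a)
    (hb : b ≤ 1) (hF : ∀ x, HasDerivAt F (F' x) x) (hF' : Continuous F') :
    ∫ x in a..b, (F' x * S.ext t x + F x * deriv (S.ext t) x) =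
      F b * S.ext t b - F a * S.ext t a := by
  have hFc : Continuous F := continuous_iff_continuousAt.2 fun x => (hF x).continuousAt
  have hv := continuous_slice S.continuous_ext t
  refine integral_eq_of_hasDerivAt_off_countable_of_le (fun x => F x * S.ext t x) _ hab
    (countable_singleton (S.h t)) (hFc.mul hv).continuousOn (fun x hx => ?_) ?_
  · exact (hF x).mul (S.ext_hasDerivAt_deriv ht ⟨ha.trans_lt hx.1.1, hx.1.2.trans_le hb⟩ hx.2)
  · exact ((hF'.mul hv).intervalIntegrable _ _).add
      ((S.intervalIntegrable_deriv_ext ht a b).continuousOn_mul hFc.continuousOn)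

lemma hasDerivAt_integral_test_of_integrable {θ : ℝ → ℝ}
    (hθ : IntervalIntegrable θ volume (-1) 1) (h0 : ∫ x in (-1)..1, θ x = 0) {t : ℝ}
    (ht : 0 < t) :
    HasDerivAt (fun s => ∫ y in (-1)..1, (∫ x in (-1)..y, θ x) * S.ext s y)
      (-(∫ x in (-1)..1, θ x * (deriv (S.ext t) x - S.ext t x ^ 2 / 2)) -
        (∫ x in (-1)..S.h t, θ x) * S.jump t) t := by
  have hI : (-1 : ℝ) ≤ 1 := by norm_num
  have hT : (0 : ℝ) ≤ t + 1 := by linarith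
  obtain ⟨N, hN0, hN⟩ := S.exists_bound (t + 1)
  obtain ⟨M, hM0, hM⟩ := S.exists_lip hT
  obtain ⟨J, hJ⟩ := isCompact_Icc.exists_bound_of_continuousOn (s := Icc 0 (t + 1))
    S.continuous_jump.continuousOn
  have hJ0 : 0 ≤ J := (norm_nonneg _).trans (hJ 0 ⟨le_rfl, hT⟩)
  have hFm : ∀ s, Measurable fun x => deriv (S.ext s) x - S.ext s x ^ 2 / 2 := fun s =>
    (measurable_deriv _).sub
      (((continuous_slice S.continuous_ext s).measurable.pow_const 2).div_const 2)
  have hFb : ∀ s ∈ Icc 0 (t + 1), ∀ x, |deriv (S.ext s) x - S.ext s x ^ 2 / 2| ≤ M + N ^ 2 / 2 := by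
    intro s hs x
    have h1 := S.abs_deriv_ext_le hM0 (hM s hs) x
    have h2 : S.ext s x ^ 2 ≤ N ^ 2 := sq_le_sq' (abs_le.1 (hN s hs x)).1 (abs_le.1 (hN s hs x)).2
    refine (abs_sub _ _).trans ?_
    rw [abs_of_nonneg (by positivity : 0 ≤ S.ext s x ^ 2 / 2)]
    linarith
  have hex : ∀ ε : ℝ, ∃ p : Polynomial ℝ, 0 < ε → ∫ x in (-1)..1, |p.eval x - θ x| ≤ ε ∧
      ∫ x in (-1)..1, p.eval x = 0 := fun ε => by
    by_cases hε : 0 < ε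
    · obtain ⟨p, hp⟩ := exists_polynomial_near_in_mean hθ h0 hε
      exact ⟨p, fun _ => hp⟩
    · exact ⟨0, fun h => absurd h hε⟩
  choose p hp using hex
  have ip : ∀ q : Polynomial ℝ, ∀ a b, IntervalIntegrable (fun x => q.eval x) volume a b :=
    fun q a b => q.continuous.intervalIntegrable a b
  have iq : ∀ ε, IntervalIntegrable (fun x => (p ε).eval x - θ x) volume (-1) 1 :=
    fun ε => (ip _ _ _).sub hθ
  have hsub : ∀ z ∈ Icc (-1 : ℝ) 1, uIcc (-1) z ⊆ uIcc (-1 : ℝ) 1 := fun z hz => by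
    rw [uIcc_of_le hz.1, uIcc_of_le hI]
    exact Icc_subset_Icc_right hz.2
  have hprim : ∀ ε, 0 < ε → ∀ z ∈ Icc (-1 : ℝ) 1,
      |(∫ x in (-1)..z, (p ε).eval x) - ∫ x in (-1)..z, θ x| ≤ ε := by
    intro ε hε z hz
    rw [← intervalIntegral.integral_sub (ip _ _ _) (hθ.mono_set (hsub z hz))]
    refine (intervalIntegral.abs_integral_le_integral_abs hz.1).trans ?_
    refine le_trans ?_ (hp ε hε).1
    exact intervalIntegral.integral_mono_interval le_rfl hz.1 hz.2
      (Eventually.of_forall fun x => abs_nonneg _) (iq ε).abs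
  refine hasDerivAt_of_tendstoUniformlyOn (l := 𝓝[>] (0 : ℝ)) (s := Ioo 0 (t + 1)) isOpen_Ioo
    (f := fun ε s => ∫ y in (-1)..1, (∫ x in (-1)..y, (p ε).eval x) * S.ext s y)
    (f' := fun ε s => -(∫ x in (-1)..1, (p ε).eval x * (deriv (S.ext s) x - S.ext s x ^ 2 / 2)) -
        (∫ x in (-1)..S.h s, (p ε).eval x) * S.jump s)
    (g' := fun s => -(∫ x in (-1)..1, θ x * (deriv (S.ext s) x - S.ext s x ^ 2 / 2)) -
        (∫ x in (-1)..S.h s, θ x) * S.jump s) ?_ ?_ ?_ ⟨ht, by linarith⟩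
  · rw [Metric.tendstoUniformlyOn_iff]
    intro η hη
    have hlim : Tendsto (fun ε : ℝ => (M + N ^ 2 / 2) * ε + ε * J) (𝓝[>] 0) (𝓝 0) := by
      have : Continuous fun ε : ℝ => (M + N ^ 2 / 2) * ε + ε * J := by fun_prop
      simpa using (this.tendsto 0).mono_left (nhdsWithin_le_nhds (s := Ioi 0))
    filter_upwards [hlim.eventually (gt_mem_nhds hη), self_mem_nhdsWithin] with ε h1 (hε : 0 < ε)
      s hs
    have hs' := Ioo_subset_Icc_self hs
    refine lt_of_le_of_lt ?_ h1
    have b1 := abs_integral_mul_le hI (iq ε) (hFb s hs')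
    have b2 := mul_le_mul_of_nonneg_left (hp ε hε).1 (by positivity : 0 ≤ M + N ^ 2 / 2)
    have b3 := mul_le_mul (hprim ε hε (S.h s) (S.h_mem_Icc hs.1.le)) (hJ s hs') (norm_nonneg _)
      hε.le
    rw [Real.norm_eq_abs, ← abs_mul] at b3
    simp only [sub_mul] at b1
    rw [intervalIntegral.integral_sub ((ip _ _ _).mul_of_abs_le (hFm s) (hFb s hs'))
      (hθ.mul_of_abs_le (hFm s) (hFb s hs'))] at b1
    rw [dist_comm, Real.dist_eq]
    rw [sub_mul] at b3
    rw [abs_le] at b1 b3 ⊢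
    constructor <;> linarith [b1.1, b1.2, b3.1, b3.2]
  · filter_upwards [self_mem_nhdsWithin] with ε (hε : 0 < ε) s hs
    have hd := S.hasDerivAt_integral_test (φ := fun y => ∫ x in (-1)..y, (p ε).eval x)
      (fun x => hasDerivAt_primitive (p ε).continuous (-1) x) (fun x => (p ε).hasDerivAt x)
      (p ε).derivative.continuous (by simp) (hp ε hε).2 hs.1
    refine hd.congr_deriv ?_
    have hparts := S.integral_deriv_mul_ext hs.1.le hI le_rfl le_rfl
      (fun x => (p ε).hasDerivAt x) (p ε).derivative.continuous
    rw [S.ext_one hs.1.le, S.ext_neg_one hs.1.le, mul_zero, mul_zero, sub_zero] at hparts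
    have hv := continuous_slice S.continuous_ext s
    have hpc := (p ε).continuous
    have hpc' := (p ε).derivative.continuous
    have i1 : IntervalIntegrable (fun x => (p ε).derivative.eval x * S.ext s x +
        (p ε).eval x * (S.ext s x ^ 2 / 2)) volume (-1) 1 :=
      Continuous.intervalIntegrable (by fun_prop) _ _
    have i2 : IntervalIntegrable (fun x => (p ε).eval x *
        (deriv (S.ext s) x - S.ext s x ^ 2 / 2)) volume (-1) 1 :=
      (ip _ _ _).mul_of_abs_le (hFm s) (hFb s (Ioo_subset_Icc_self hs))
    have e : (∫ x in (-1)..1, ((p ε).derivative.eval x * S.ext s x +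
        (p ε).eval x * (S.ext s x ^ 2 / 2))) = -∫ x in (-1)..1, (p ε).eval x *
        (deriv (S.ext s) x - S.ext s x ^ 2 / 2) := by
      rw [eq_neg_iff_add_eq_zero, ← intervalIntegral.integral_add i1 i2, ← hparts]
      refine intervalIntegral.integral_congr fun x _ => ?_
      ring
    rw [e]
  · intro s hs
    have hθc : ContinuousOn (fun y => ∫ x in (-1)..y, θ x) (Icc (-1) 1) := by
      have := intervalIntegral.continuousOn_primitive_interval' hθ left_mem_uIcc
      rwa [uIcc_of_le hI] at this
    have hv := continuous_slice S.continuous_ext s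
    have hpr : ∀ ε, Continuous fun y => ∫ x in (-1)..y, (p ε).eval x :=
      fun ε => continuous_primitive (p ε).continuous (-1)
    have j1 : IntervalIntegrable (fun y => (∫ x in (-1)..y, θ x) * S.ext s y) volume (-1) 1 :=
      ContinuousOn.intervalIntegrable (by
        rw [uIcc_of_le hI]
        exact hθc.mul hv.continuousOn)
    rw [tendsto_iff_dist_tendsto_zero]
    have hlim : Tendsto (fun ε : ℝ => ε * N * 2) (𝓝[>] 0) (𝓝 0) := by
      have : Continuous fun ε : ℝ => ε * N * 2 := by fun_prop
      simpa using (this.tendsto 0).mono_left (nhdsWithin_le_nhds (s := Ioi 0))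
    refine squeeze_zero' (Eventually.of_forall fun _ => dist_nonneg) ?_ hlim
    filter_upwards [self_mem_nhdsWithin] with ε (hε : 0 < ε)
    have j2 : IntervalIntegrable (fun y => (∫ x in (-1)..y, (p ε).eval x) * S.ext s y)
        volume (-1) 1 := ((hpr ε).mul hv).intervalIntegrable _ _
    rw [Real.dist_eq, ← intervalIntegral.integral_sub j2 j1]
    have := intervalIntegral.norm_integral_le_of_norm_le_const (a := (-1 : ℝ)) (b := 1)
      (C := ε * N) (f := fun y => (∫ x in (-1)..y, (p ε).eval x) * S.ext s y -
        (∫ x in (-1)..y, θ x) * S.ext s y) (fun y hy => by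
          rw [uIoc_of_le hI] at hy
          rw [← sub_mul, norm_mul]
          exact mul_le_mul (hprim ε hε y (Ioc_subset_Icc_self hy))
            (hN s (Ioo_subset_Icc_self hs) y) (norm_nonneg _) hε.le)
    rw [show |(1 : ℝ) - -1| = 2 by norm_num] at this
    exact this

end FluidParticleSol

namespace FluidParticleSol

variable {K h₁ : ℝ} (S : FluidParticleSol K h₁)

lemma integral_comp_ext_mul_deriv {φ φ' : ℝ → ℝ} {a b t : ℝ} (ht : 0 ≤ t) (hab : a ≤ b)
    (ha : -1 ≤ a) (hb : b ≤ 1) (hφ : ∀ x, HasDerivAt φ (φ' x) x) (hφ' : Continuous φ') :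
    ∫ x in a..b, φ' (S.ext t x) * deriv (S.ext t) x = φ (S.ext t b) - φ (S.ext t a) := by
  have hφc : Continuous φ := continuous_iff_continuousAt.2 fun x => (hφ x).continuousAt
  have hv := continuous_slice S.continuous_ext t
  refine integral_eq_of_hasDerivAt_off_countable_of_le (fun x => φ (S.ext t x)) _ hab
    (countable_singleton (S.h t)) (hφc.comp hv).continuousOn (fun x hx => ?_) ?_
  · exact (hφ _).comp x
      (S.ext_hasDerivAt_deriv ht ⟨ha.trans_lt hx.1.1, hx.1.2.trans_le hb⟩ hx.2)
  · exact (S.intervalIntegrable_deriv_ext ht a b).continuousOn_mul (hφ'.comp hv).continuousOn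

lemma integral_deriv_ext {a b t : ℝ} (ht : 0 ≤ t) (hab : a ≤ b) (ha : -1 ≤ a) (hb : b ≤ 1) :
    ∫ x in a..b, deriv (S.ext t) x = S.ext t b - S.ext t a := by
  simpa using S.integral_comp_ext_mul_deriv (φ := fun x => x) (φ' := fun _ => 1) ht hab ha hb
    (fun x => hasDerivAt_id x) continuous_const

lemma intervalIntegrable_sq_deriv_ext {t : ℝ} (ht : 0 ≤ t) (a b : ℝ) :
    IntervalIntegrable (fun x => deriv (S.ext t) x ^ 2) volume a b := by
  obtain ⟨M, -, hM⟩ := S.exists_deriv_bound ht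
  simpa [sq] using (S.intervalIntegrable_deriv_ext ht a b).mul_of_abs_le
    (measurable_deriv (S.ext t)) hM

/-- Total energy of the fluid, the particle and the feedback spring. -/
noncomputable def energy (s : ℝ) : ℝ :=
  (∫ y in (-1)..1, S.ext s y ^ 2) + deriv S.h s ^ 2 + K * (S.h s - h₁) ^ 2

/-- Viscous dissipation rate on an interval. -/
noncomputable def dissipation (t a b : ℝ) : ℝ := ∫ x in a..b, deriv (S.ext t) x ^ 2

lemma exists_energy_majorant {t : ℝ} (ht : 0 < t) :
    ∃ G : ℝ → ℝ, HasDerivAt G (-2 * S.dissipation t (-1) 1) t ∧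
      ∀ s, S.energy t - S.energy s ≤ G t - G s := by
  have hI : (-1 : ℝ) ≤ 1 := by norm_num
  have hv := fun s => continuous_slice S.continuous_ext s
  have hw := S.intervalIntegrable_deriv_ext ht.le
  have hw2 := S.intervalIntegrable_sq_deriv_ext ht.le
  have hh := S.h_mem_Icc ht.le
  have h0 : ∫ x in (-1)..1, deriv (S.ext t) x = 0 := by
    rw [S.integral_deriv_ext ht.le hI le_rfl le_rfl, S.ext_one ht.le, S.ext_neg_one ht.le, sub_zero]
  have hL := S.hasDerivAt_integral_test_of_integrable (hw (-1) 1) h0 ht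
  have e1 : (fun s => ∫ y in (-1)..1, (∫ x in (-1)..y, deriv (S.ext t) x) * S.ext s y) =
      fun s => ∫ y in (-1)..1, S.ext t y * S.ext s y := by
    funext s
    refine intervalIntegral.integral_congr fun y hy => ?_
    rw [uIcc_of_le hI] at hy
    rw [S.integral_deriv_ext ht.le hy.1 le_rfl hy.2, S.ext_neg_one ht.le, sub_zero]
  have e2 : ∫ x in (-1)..S.h t, deriv (S.ext t) x = deriv S.h t := by
    rw [S.integral_deriv_ext ht.le hh.1 le_rfl hh.2, S.ext_neg_one ht.le, sub_zero, S.ext_h ht.le]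
  have e3 : ∫ x in (-1)..1, deriv (S.ext t) x * (deriv (S.ext t) x - S.ext t x ^ 2 / 2) =
      S.dissipation t (-1) 1 := by
    have h3 := S.integral_comp_ext_mul_deriv (φ := fun x => x ^ 3 / 6) (φ' := fun x => x ^ 2 / 2)
      ht.le hI le_rfl le_rfl
      (fun x => ((hasDerivAt_pow 3 x).div_const 6).congr_deriv (by push_cast; ring))
      (by fun_prop)
    rw [S.ext_one ht.le, S.ext_neg_one ht.le, sub_self] at h3
    have hi : IntervalIntegrable (fun x => S.ext t x ^ 2 / 2 * deriv (S.ext t) x) volume (-1) 1 :=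
      (hw (-1) 1).continuousOn_mul (((hv t).pow 2).div_const 2).continuousOn
    rw [dissipation, ← sub_zero (∫ x in (-1)..1, deriv (S.ext t) x ^ 2), ← h3,
      ← intervalIntegral.integral_sub (hw2 (-1) 1) hi]
    refine intervalIntegral.integral_congr fun x _ => ?_
    ring
  rw [e1, e2, e3] at hL
  have hd := ((hL.const_mul 2).fun_add ((S.deriv_h_hasDerivAt t).fun_pow 2)).fun_add
    ((((S.h_hasDerivAt t).sub_const h₁).fun_pow 2).const_mul K)
  refine ⟨_, hd.congr_deriv ?_, fun s => ?_⟩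
  · rw [jump]
    push_cast
    ring
  · have i1 : IntervalIntegrable (fun y => S.ext t y ^ 2) volume (-1) 1 :=
      ((hv t).pow 2).intervalIntegrable _ _
    have i2 : IntervalIntegrable (fun y => S.ext s y ^ 2) volume (-1) 1 :=
      ((hv s).pow 2).intervalIntegrable _ _
    have i3 : ∀ r, IntervalIntegrable (fun y => S.ext t y * S.ext r y) volume (-1) 1 :=
      fun r => ((hv t).mul (hv r)).intervalIntegrable _ _
    have := intervalIntegral.integral_mono_on hI (i1.sub i2)
      (((i3 t).sub (i3 s)).const_mul 2) (fun y _ => by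
        nlinarith [sq_nonneg (S.ext t y - S.ext s y)])
    rw [intervalIntegral.integral_sub i1 i2, intervalIntegral.integral_const_mul,
      intervalIntegral.integral_sub (i3 t) (i3 s)] at this
    simp only [energy]
    linarith

end FluidParticleSol

lemma hasDerivAt_along_curve_of_frozen {F F₂ : ℝ → ℝ → ℝ} {z : ℝ → ℝ} {t z' d : ℝ}
    (h₁ : HasDerivAt (fun s => F s (z t)) d t)
    (h₂ : ∀ᶠ p : ℝ × ℝ in 𝓝 (t, z t), HasDerivAt (F p.1) (F₂ p.1 p.2) p.2)
    (c₂ : ContinuousAt (fun p : ℝ × ℝ => F₂ p.1 p.2) (t, z t)) (hz : HasDerivAt z z' t) :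
    HasDerivAt (fun s => F s (z s)) (d + F₂ t (z t) * z') t := by
  set φ := F₂ t (z t) with hφ
  have hr : HasDerivAt (fun s => F s (z s) - F s (z t) - φ * (z s - z t)) 0 t := by
    rw [hasDerivAt_iff_isLittleO]
    have ho : (fun s => F s (z s) - F s (z t) - φ * (z s - z t)) =o[𝓝 t]
        fun s => z s - z t := by
      rw [Asymptotics.isLittleO_iff]
      intro ε hε
      have h3 : ∀ᶠ p : ℝ × ℝ in 𝓝 (t, z t), |F₂ p.1 p.2 - φ| ≤ ε := by
        filter_upwards [c₂.eventually (Metric.closedBall_mem_nhds _ hε)] with p hp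
        exact hp
      obtain ⟨δ, hδ, hball⟩ := Metric.eventually_nhds_iff_ball.1 (h₂.and h3)
      filter_upwards [Metric.ball_mem_nhds t hδ,
        hz.continuousAt.preimage_mem_nhds (Metric.ball_mem_nhds (z t) hδ)] with s hs hzs
      have key := (convex_ball (z t) δ).norm_image_sub_le_of_norm_hasDerivWithin_le
        (f := fun y => F s y - φ * y) (f' := fun y => F₂ s y - φ) (C := ε)
        (x := z t) (y := z s)
        (fun y hy => by
          have hp := hball (s, y) (by rw [← ball_prod_same]; exact ⟨hs, hy⟩)
          exact (hp.1.fun_sub ((hasDerivAt_id' y).const_mul φ)).congr_deriv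
            (by ring) |>.hasDerivWithinAt)
        (fun y hy => (hball (s, y) (by rw [← ball_prod_same]; exact ⟨hs, hy⟩)).2)
        (Metric.mem_ball_self hδ) hzs
      rw [show F s (z s) - F s (z t) - φ * (z s - z t) =
        F s (z s) - φ * z s - (F s (z t) - φ * z t) by ring]
      exact key
    refine (ho.trans_isBigO hz.isBigO_sub).congr_left fun s => ?_
    simp
  refine ((hr.fun_add h₁).fun_add ((hz.sub_const (z t)).const_mul φ)).congr_deriv (by ring)
    |>.congr_of_eventuallyEq (Eventually.of_forall fun s => ?_)
  simp only
  ring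

/-- Derivative of the tent function with apex `1` at `z` that vanishes at `-1` and `1`. -/
noncomputable def tentSlope (z x : ℝ) : ℝ := if x ≤ z then (1 + z)⁻¹ else -(1 - z)⁻¹

lemma measurable_tentSlope (z : ℝ) : Measurable (tentSlope z) :=
  Measurable.ite measurableSet_Iic measurable_const measurable_const

lemma abs_tentSlope_le (z x : ℝ) : |tentSlope z x| ≤ |(1 + z)⁻¹| + |(1 - z)⁻¹| := by
  rw [tentSlope]
  split_ifs
  · linarith [abs_nonneg (1 - z)⁻¹]
  · rw [abs_neg]
    linarith [abs_nonneg (1 + z)⁻¹]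

lemma intervalIntegrable_tentSlope (z a b : ℝ) :
    IntervalIntegrable (tentSlope z) volume a b := by
  have := (intervalIntegrable_const (c := (1 : ℝ)) (a := a) (b := b)
    (μ := volume)).mul_of_abs_le (measurable_tentSlope z) (abs_tentSlope_le z)
  simpa using this

lemma integral_tentSlope_mul_left {z a b : ℝ} (hab : a ≤ b) (hb : b ≤ z) (f : ℝ → ℝ) :
    ∫ x in a..b, tentSlope z x * f x = (1 + z)⁻¹ * ∫ x in a..b, f x := by
  rw [← intervalIntegral.integral_const_mul]
  refine intervalIntegral.integral_congr_ae (Eventually.of_forall fun x hx => ?_)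
  rw [uIoc_of_le hab] at hx
  rw [tentSlope, if_pos (hx.2.trans hb)]

lemma integral_tentSlope_mul_right {z a b : ℝ} (hab : a ≤ b) (ha : z ≤ a) (f : ℝ → ℝ) :
    ∫ x in a..b, tentSlope z x * f x = -(1 - z)⁻¹ * ∫ x in a..b, f x := by
  rw [← intervalIntegral.integral_const_mul]
  refine intervalIntegral.integral_congr_ae (Eventually.of_forall fun x hx => ?_)
  rw [uIoc_of_le hab] at hx
  rw [tentSlope, if_neg (not_le.2 (ha.trans_lt hx.1))]

lemma integral_tentSlope_of_le {z y : ℝ} (hy : -1 ≤ y) (hyz : y ≤ z) :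
    ∫ x in (-1)..y, tentSlope z x = (1 + z)⁻¹ * (1 + y) := by
  have := integral_tentSlope_mul_left hy hyz fun _ => 1
  simp only [mul_one, intervalIntegral.integral_const, smul_eq_mul] at this
  rw [this]
  ring

lemma integral_tentSlope_of_ge {z y : ℝ} (hz : z ∈ Ioo (-1 : ℝ) 1) (hzy : z ≤ y) :
    ∫ x in (-1)..y, tentSlope z x = (1 - z)⁻¹ * (1 - y) := by
  rw [← intervalIntegral.integral_add_adjacent_intervals (intervalIntegrable_tentSlope z (-1) z)
    (intervalIntegrable_tentSlope z z y), integral_tentSlope_of_le hz.1.le le_rfl]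
  have := integral_tentSlope_mul_right hzy le_rfl fun _ => 1
  simp only [mul_one, intervalIntegral.integral_const, smul_eq_mul] at this
  have h1 : 1 + z ≠ 0 := by linarith [hz.1]
  have h2 : 1 - z ≠ 0 := by linarith [hz.2]
  rw [this]
  field_simp
  ring

namespace FluidParticleSol

variable {K h₁ : ℝ} (S : FluidParticleSol K h₁)

/-- First moment of the velocity on the left of `z` about the left wall. -/
noncomputable def momentLeft (s z : ℝ) : ℝ := ∫ x in (-1)..z, (1 + x) * S.ext s x

/-- First moment of the velocity on the right of `z` about the right wall. -/
noncomputable def momentRight (s z : ℝ) : ℝ := ∫ x in z..1, (1 - x) * S.ext s x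

/-- Average of the velocity against the tent function with apex at `z`. -/
noncomputable def tentMoment (s z : ℝ) : ℝ :=
  S.momentLeft s z / (1 + z) + S.momentRight s z / (1 - z)

lemma continuous_momentLeft : Continuous fun p : ℝ × ℝ => S.momentLeft p.1 p.2 := by
  have hv := S.continuous_ext
  exact continuous_primitive_param (f := fun s x => (1 + x) * S.ext s x) (by fun_prop) (-1)

lemma momentRight_eq : S.momentRight = fun s z => -∫ x in (1)..z, (1 - x) * S.ext s x := by
  funext s z
  rw [momentRight, intervalIntegral.integral_symm]

lemma continuous_momentRight : Continuous fun p : ℝ × ℝ => S.momentRight p.1 p.2 := by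
  have hv := S.continuous_ext
  rw [momentRight_eq]
  exact (continuous_primitive_param (f := fun s x => (1 - x) * S.ext s x) (by fun_prop) 1).neg

lemma tentMoment_hasDerivAt_apex (s : ℝ) {z : ℝ} (hz : z ∈ Ioo (-1 : ℝ) 1) :
    HasDerivAt (S.tentMoment s)
      (S.momentRight s z / (1 - z) ^ 2 - S.momentLeft s z / (1 + z) ^ 2) z := by
  have hv := continuous_slice S.continuous_ext s
  have h1 : 1 + z ≠ 0 := by linarith [hz.1]
  have h2 : 1 - z ≠ 0 := by linarith [hz.2]
  have d1 : HasDerivAt (S.momentLeft s) ((1 + z) * S.ext s z) z :=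
    hasDerivAt_primitive (f := fun x => (1 + x) * S.ext s x) (by fun_prop) (-1) z
  have d2 : HasDerivAt (S.momentRight s) (-((1 - z) * S.ext s z)) z := by
    rw [momentRight_eq]
    exact (hasDerivAt_primitive (f := fun x => (1 - x) * S.ext s x) (by fun_prop) 1 z).fun_neg
  refine ((d1.fun_div ((hasDerivAt_id' z).const_add 1) h1).fun_add
    (d2.fun_div ((hasDerivAt_id' z).const_sub 1) h2)).congr_deriv ?_
  field_simp
  ring

lemma tentMoment_eq_integral (s : ℝ) {z : ℝ} (hz : z ∈ Ioo (-1 : ℝ) 1) :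
    S.tentMoment s z = ∫ y in (-1)..1, (∫ x in (-1)..y, tentSlope z x) * S.ext s y := by
  have hv := continuous_slice S.continuous_ext s
  have hθ : Continuous fun y => ∫ x in (-1)..y, tentSlope z x :=
    intervalIntegral.continuous_primitive (fun a b => intervalIntegrable_tentSlope z a b) (-1)
  have hc : Continuous fun y => (∫ x in (-1)..y, tentSlope z x) * S.ext s y := hθ.mul hv
  rw [← intervalIntegral.integral_add_adjacent_intervals (hc.intervalIntegrable (-1) z)
    (hc.intervalIntegrable z 1), tentMoment, momentLeft, momentRight, div_eq_inv_mul,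
    div_eq_inv_mul, ← intervalIntegral.integral_const_mul, ← intervalIntegral.integral_const_mul]
  congr 1
  · refine intervalIntegral.integral_congr fun y hy => ?_
    rw [uIcc_of_le hz.1.le] at hy
    simp only [integral_tentSlope_of_le hy.1 hy.2]
    ring
  · refine intervalIntegral.integral_congr fun y hy => ?_
    rw [uIcc_of_le hz.2.le] at hy
    simp only [integral_tentSlope_of_ge hz hy.1]
    ring

lemma tentMoment_hasDerivAt_time {t : ℝ} (ht : 0 < t) :
    HasDerivAt (fun s => S.tentMoment s (S.h t))
      (-(deriv S.h t / (1 + S.h t)) - deriv S.h t / (1 - S.h t) +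
        ((∫ x in (-1)..S.h t, S.ext t x ^ 2) / (1 + S.h t) -
          (∫ x in (S.h t)..1, S.ext t x ^ 2) / (1 - S.h t)) / 2 - S.jump t) t := by
  have hz := S.h_in t ht.le
  have hv := continuous_slice S.continuous_ext t
  have h0 : ∫ x in (-1)..1, tentSlope (S.h t) x = 0 := by
    rw [integral_tentSlope_of_ge hz hz.2.le]
    ring
  have hd := S.hasDerivAt_integral_test_of_integrable
    (intervalIntegrable_tentSlope (S.h t) (-1) 1) h0 ht
  simp only [← S.tentMoment_eq_integral _ hz] at hd
  refine hd.congr_deriv ?_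
  have hF : ∀ a b, IntervalIntegrable (fun x => deriv (S.ext t) x - S.ext t x ^ 2 / 2)
      volume a b := fun a b => (S.intervalIntegrable_deriv_ext ht.le a b).sub
        (((hv.pow 2).div_const 2).intervalIntegrable a b)
  have hθF : ∀ a b, IntervalIntegrable (fun x => tentSlope (S.h t) x *
      (deriv (S.ext t) x - S.ext t x ^ 2 / 2)) volume a b := fun a b => by
    have := (hF a b).mul_of_abs_le (measurable_tentSlope (S.h t)) (abs_tentSlope_le (S.h t))
    simpa only [mul_comm] using this
  have h1 : 1 + S.h t ≠ 0 := by linarith [hz.1]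
  rw [← intervalIntegral.integral_add_adjacent_intervals (hθF (-1) (S.h t)) (hθF (S.h t) 1),
    integral_tentSlope_mul_left hz.1.le le_rfl, integral_tentSlope_mul_right hz.2.le le_rfl,
    integral_tentSlope_of_le hz.1.le le_rfl, inv_mul_cancel₀ h1]
  have hsq : ∀ a b, IntervalIntegrable (fun x => S.ext t x ^ 2 / 2) volume a b :=
    fun a b => ((hv.pow 2).div_const 2).intervalIntegrable a b
  rw [intervalIntegral.integral_sub (S.intervalIntegrable_deriv_ext ht.le _ _) (hsq _ _),
    intervalIntegral.integral_sub (S.intervalIntegrable_deriv_ext ht.le _ _) (hsq _ _),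
    S.integral_deriv_ext ht.le hz.1.le le_rfl hz.2.le,
    S.integral_deriv_ext ht.le hz.2.le hz.1.le le_rfl, S.ext_one ht.le, S.ext_neg_one ht.le,
    S.ext_h ht.le, intervalIntegral.integral_div, intervalIntegral.integral_div]
  ring

lemma tentMoment_hasDerivAt {t : ℝ} (ht : 0 < t) :
    HasDerivAt (fun s => S.tentMoment s (S.h s))
      (-(deriv S.h t / (1 + S.h t)) - deriv S.h t / (1 - S.h t) +
        ((∫ x in (-1)..S.h t, S.ext t x ^ 2) / (1 + S.h t) -
          (∫ x in (S.h t)..1, S.ext t x ^ 2) / (1 - S.h t)) / 2 - S.jump t +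
        (S.momentRight t (S.h t) / (1 - S.h t) ^ 2 -
          S.momentLeft t (S.h t) / (1 + S.h t) ^ 2) * deriv S.h t) t := by
  have hz := S.h_in t ht.le
  have h1 : 1 + S.h t ≠ 0 := by linarith [hz.1]
  have h2 : 1 - S.h t ≠ 0 := by linarith [hz.2]
  refine hasDerivAt_along_curve_of_frozen (F := S.tentMoment) (F₂ := fun s z =>
    S.momentRight s z / (1 - z) ^ 2 - S.momentLeft s z / (1 + z) ^ 2)
    (S.tentMoment_hasDerivAt_time ht) ?_ ?_ (S.h_hasDerivAt t)
  · filter_upwards [continuousAt_snd.preimage_mem_nhds (isOpen_Ioo.mem_nhds hz)] with p hp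
    exact S.tentMoment_hasDerivAt_apex p.1 hp
  · have c1 := S.continuous_momentLeft
    have c2 := S.continuous_momentRight
    exact (c2.continuousAt.div (by fun_prop) (pow_ne_zero 2 h2)).sub
      (c1.continuousAt.div (by fun_prop) (pow_ne_zero 2 h1))

end FluidParticleSol

lemma sq_integral_le {w : ℝ → ℝ} {a b : ℝ} (hab : a ≤ b) (hw : IntervalIntegrable w volume a b)
    (hw2 : IntervalIntegrable (fun x => w x ^ 2) volume a b) :
    (∫ x in a..b, w x) ^ 2 ≤ (b - a) * ∫ x in a..b, w x ^ 2 := by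
  rcases hab.eq_or_lt with rfl | hlt
  · simp
  have hpos : 0 < b - a := by linarith
  set I := ∫ x in a..b, w x with hI
  have h1 : 0 ≤ ∫ x in a..b, (w x ^ 2 - (2 * (I / (b - a)) * w x - (I / (b - a)) ^ 2)) :=
    intervalIntegral.integral_nonneg hab fun x _ => by
      nlinarith [sq_nonneg (w x - I / (b - a))]
  rw [intervalIntegral.integral_sub hw2 ((hw.const_mul _).sub intervalIntegrable_const),
    intervalIntegral.integral_sub (hw.const_mul _) intervalIntegrable_const,
    intervalIntegral.integral_const_mul, intervalIntegral.integral_const, ← hI, smul_eq_mul] at h1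
  have h2 : (b - a) * (2 * (I / (b - a)) * I - (b - a) * (I / (b - a)) ^ 2) = I ^ 2 := by
    field_simp
    ring
  nlinarith [mul_nonneg hpos.le h1]

lemma abs_mul_integral_le {W f : ℝ → ℝ} {a b c P : ℝ} (hab : a ≤ b) (hW : Continuous W)
    (hW0 : ∀ x ∈ Icc a b, 0 ≤ W x) (hf : ∀ x ∈ Icc a b, |c * f x| ≤ P) :
    |c * ∫ x in a..b, W x * f x| ≤ P * ∫ x in a..b, W x := by
  rw [← intervalIntegral.integral_const_mul, ← intervalIntegral.integral_const_mul]
  refine intervalIntegral.norm_integral_le_of_norm_le (μ := volume)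
    (f := fun x => c * (W x * f x)) (g := fun x => P * W x) hab
    (Eventually.of_forall fun x hx => ?_) ((hW.const_mul P).intervalIntegrable _ _)
  have hx' := Ioc_subset_Icc_self hx
  rw [Real.norm_eq_abs, show c * (W x * f x) = W x * (c * f x) by ring, abs_mul,
    abs_of_nonneg (hW0 x hx'), mul_comm P]
  exact mul_le_mul_of_nonneg_left (hf x hx') (hW0 x hx')

lemma abs_mul_le_of_sq_le {x y P : ℝ} (hx : x ^ 2 ≤ P) (hy : y ^ 2 ≤ P) : |x * y| ≤ P := by
  rw [abs_le]
  constructor <;> nlinarith [sq_nonneg (x - y), sq_nonneg (x + y)]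

namespace FluidParticleSol

variable {K h₁ : ℝ} (S : FluidParticleSol K h₁)

lemma dissipation_nonneg (t : ℝ) {a b : ℝ} (hab : a ≤ b) : 0 ≤ S.dissipation t a b :=
  intervalIntegral.integral_nonneg hab fun _ _ => sq_nonneg _

lemma dissipation_add {t : ℝ} (ht : 0 ≤ t) (a b c : ℝ) :
    S.dissipation t a b + S.dissipation t b c = S.dissipation t a c :=
  intervalIntegral.integral_add_adjacent_intervals (S.intervalIntegrable_sq_deriv_ext ht a b)
    (S.intervalIntegrable_sq_deriv_ext ht b c)

lemma sq_ext_sub_le {t a b : ℝ} (ht : 0 ≤ t) (hab : a ≤ b) (ha : -1 ≤ a) (hb : b ≤ 1) :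
    (S.ext t b - S.ext t a) ^ 2 ≤ (b - a) * S.dissipation t a b := by
  rw [← S.integral_deriv_ext ht hab ha hb]
  exact sq_integral_le hab (S.intervalIntegrable_deriv_ext ht a b)
    (S.intervalIntegrable_sq_deriv_ext ht a b)

lemma sq_ext_le_left {t z y : ℝ} (ht : 0 ≤ t) (hz : z ≤ 1) (hy : y ∈ Icc (-1) z) :
    S.ext t y ^ 2 ≤ (1 + z) * S.dissipation t (-1) z := by
  have h1 := S.sq_ext_sub_le ht hy.1 le_rfl (hy.2.trans hz)
  rw [S.ext_neg_one ht, sub_zero] at h1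
  have h2 := S.dissipation_add ht (-1) y z
  have h3 := S.dissipation_nonneg t hy.1
  have h4 := S.dissipation_nonneg t hy.2
  nlinarith [hy.1, hy.2]

lemma sq_ext_le_right {t z y : ℝ} (ht : 0 ≤ t) (hz : -1 ≤ z) (hy : y ∈ Icc z 1) :
    S.ext t y ^ 2 ≤ (1 - z) * S.dissipation t z 1 := by
  have h1 := S.sq_ext_sub_le ht hy.2 (hz.trans hy.1) le_rfl
  rw [S.ext_one ht, zero_sub, neg_sq] at h1
  have h2 := S.dissipation_add ht z y 1
  have h3 := S.dissipation_nonneg t hy.1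
  have h4 := S.dissipation_nonneg t hy.2
  nlinarith [hy.1, hy.2]

lemma integral_sq_div_left {t z : ℝ} (ht : 0 ≤ t) (hz : z ∈ Ioo (-1 : ℝ) 1) :
    (∫ x in (-1)..z, S.ext t x ^ 2) / (1 + z) / 2 ∈ Icc 0 (S.dissipation t (-1) z) := by
  have h1 : 0 < 1 + z := by linarith [hz.1]
  have hv := continuous_slice S.continuous_ext t
  have h2 : 0 ≤ ∫ x in (-1)..z, S.ext t x ^ 2 :=
    intervalIntegral.integral_nonneg hz.1.le fun _ _ => sq_nonneg _
  refine ⟨by positivity, ?_⟩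
  have h3 := intervalIntegral.integral_mono_on hz.1.le
    ((hv.pow 2).intervalIntegrable (μ := volume) (-1) z) intervalIntegrable_const
    (fun x hx => S.sq_ext_le_left ht hz.2.le hx)
  rw [intervalIntegral.integral_const, smul_eq_mul] at h3
  have h4 := S.dissipation_nonneg t hz.1.le
  rw [div_div, div_le_iff₀ (by positivity)]
  refine h3.trans ?_
  nlinarith [hz.2, mul_nonneg (mul_nonneg h1.le h4) (by linarith [hz.2] : 0 ≤ 1 - z)]

lemma integral_sq_div_right {t z : ℝ} (ht : 0 ≤ t) (hz : z ∈ Ioo (-1 : ℝ) 1) :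
    (∫ x in z..1, S.ext t x ^ 2) / (1 - z) / 2 ∈ Icc 0 (S.dissipation t z 1) := by
  have h1 : 0 < 1 - z := by linarith [hz.2]
  have hv := continuous_slice S.continuous_ext t
  have h2 : 0 ≤ ∫ x in z..1, S.ext t x ^ 2 :=
    intervalIntegral.integral_nonneg hz.2.le fun _ _ => sq_nonneg _
  refine ⟨by positivity, ?_⟩
  have h3 := intervalIntegral.integral_mono_on hz.2.le
    ((hv.pow 2).intervalIntegrable (μ := volume) z 1) intervalIntegrable_const
    (fun x hx => S.sq_ext_le_right ht hz.1.le hx)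
  rw [intervalIntegral.integral_const, smul_eq_mul] at h3
  have h4 := S.dissipation_nonneg t hz.2.le
  rw [div_div, div_le_iff₀ (by positivity)]
  refine h3.trans ?_
  nlinarith [hz.1, mul_nonneg (mul_nonneg h1.le h4) (by linarith [hz.1] : 0 ≤ 1 + z)]

lemma abs_momentLeft_le {t : ℝ} (ht : 0 ≤ t) :
    |deriv S.h t * S.momentLeft t (S.h t) / (1 + S.h t) ^ 2| ≤
      S.dissipation t (-1) (S.h t) := by
  have hz := S.h_in t ht
  have h1 : 0 < 1 + S.h t := by linarith [hz.1]
  have hg := S.sq_ext_le_left ht hz.2.le ⟨hz.1.le, le_rfl⟩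
  rw [S.ext_h ht] at hg
  have h2 := abs_mul_integral_le (W := fun x => 1 + x) (f := S.ext t) hz.1.le (by fun_prop)
    (fun x hx => by linarith [hx.1])
    (fun x hx => abs_mul_le_of_sq_le hg (S.sq_ext_le_left ht hz.2.le hx))
  have e : ∫ x in (-1)..S.h t, (1 + x) = (1 + S.h t) ^ 2 / 2 := by
    rw [intervalIntegral.integral_add (by simp) (by simp)]
    simp only [intervalIntegral.integral_const, integral_id, smul_eq_mul]
    ring
  rw [e] at h2
  have h4 := S.dissipation_nonneg t hz.1.le
  rw [abs_div, abs_of_pos (pow_pos h1 2), div_le_iff₀ (pow_pos h1 2)]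
  refine h2.trans ?_
  nlinarith [mul_nonneg (mul_nonneg (pow_pos h1 2).le h4) (by linarith [hz.2] : 0 ≤ 1 - S.h t)]

lemma abs_momentRight_le {t : ℝ} (ht : 0 ≤ t) :
    |deriv S.h t * S.momentRight t (S.h t) / (1 - S.h t) ^ 2| ≤ S.dissipation t (S.h t) 1 := by
  have hz := S.h_in t ht
  have h1 : 0 < 1 - S.h t := by linarith [hz.2]
  have hg := S.sq_ext_le_right ht hz.1.le ⟨le_rfl, hz.2.le⟩
  rw [S.ext_h ht] at hg
  have h2 := abs_mul_integral_le (W := fun x => 1 - x) (f := S.ext t) hz.2.le (by fun_prop)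
    (fun x hx => by linarith [hx.2])
    (fun x hx => abs_mul_le_of_sq_le hg (S.sq_ext_le_right ht hz.1.le hx))
  have e : ∫ x in S.h t..1, (1 - x) = (1 - S.h t) ^ 2 / 2 := by
    rw [intervalIntegral.integral_sub (by simp) (by simp)]
    simp only [intervalIntegral.integral_const, integral_id, smul_eq_mul]
    ring
  rw [e] at h2
  have h4 := S.dissipation_nonneg t hz.2.le
  rw [abs_div, abs_of_pos (pow_pos h1 2), div_le_iff₀ (pow_pos h1 2)]
  refine h2.trans ?_
  nlinarith [mul_nonneg (mul_nonneg (pow_pos h1 2).le h4) (by linarith [hz.1] : 0 ≤ 1 + S.h t)]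

/-- Logarithm of the ratio of the distances of the particle to the two walls. -/
noncomputable def logRatio (s : ℝ) : ℝ := log (1 + S.h s) - log (1 - S.h s)

/-- Log-ratio corrected by the particle velocity and the tent moment of the fluid. -/
noncomputable def correctedLogRatio (s : ℝ) : ℝ :=
  S.logRatio s + deriv S.h s + S.tentMoment s (S.h s)

lemma exists_correctedLogRatio_deriv {t : ℝ} (ht : 0 < t) :
    ∃ z', HasDerivAt S.correctedLogRatio z' t ∧ |z'| ≤ 2 * K + 2 * S.dissipation t (-1) 1 := by
  have hz := S.h_in t ht.le
  have h1 : 1 + S.h t ≠ 0 := by linarith [hz.1]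
  have h2 : 1 - S.h t ≠ 0 := by linarith [hz.2]
  have hd := S.h_hasDerivAt t
  have dl := (((hd.const_add 1).log h1).fun_sub ((hd.const_sub 1).log h2)).fun_add
    (S.deriv_h_hasDerivAt t) |>.fun_add (S.tentMoment_hasDerivAt ht)
  refine ⟨_, dl, ?_⟩
  have b1 := S.integral_sq_div_left ht.le hz
  have b2 := S.integral_sq_div_right ht.le hz
  have b3 := abs_le.1 (S.abs_momentLeft_le ht.le)
  have b4 := abs_le.1 (S.abs_momentRight_le ht.le)
  have b5 := S.dissipation_add ht.le (-1) (S.h t) 1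
  have b6 : |K * (h₁ - S.h t)| ≤ 2 * K := by
    rw [abs_mul, abs_of_nonneg S.hK, mul_comm 2]
    refine mul_le_mul_of_nonneg_left ?_ S.hK
    rw [abs_le]
    constructor <;> linarith [S.hh₁.1, S.hh₁.2, hz.1, hz.2]
  rw [abs_le] at b6
  set A := (∫ x in (-1)..S.h t, S.ext t x ^ 2) / (1 + S.h t)
  set B := (∫ x in (S.h t)..1, S.ext t x ^ 2) / (1 - S.h t)
  set P := deriv S.h t * S.momentLeft t (S.h t) / (1 + S.h t) ^ 2 with hP
  set Q := deriv S.h t * S.momentRight t (S.h t) / (1 - S.h t) ^ 2 with hQ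
  have e : deriv S.h t / (1 + S.h t) - -deriv S.h t / (1 - S.h t) + deriv (deriv S.h) t +
      (-(deriv S.h t / (1 + S.h t)) - deriv S.h t / (1 - S.h t) + (A - B) / 2 - S.jump t +
        (S.momentRight t (S.h t) / (1 - S.h t) ^ 2 -
          S.momentLeft t (S.h t) / (1 + S.h t) ^ 2) * deriv S.h t) =
      K * (h₁ - S.h t) + (A / 2 - B / 2) + (Q - P) := by
    rw [jump, hP, hQ]
    ring
  rw [e, abs_le]
  constructor <;> linarith [b1.1, b1.2, b2.1, b2.2, b3.1, b3.2, b4.1, b4.2, b6.1, b6.2]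

end FluidParticleSol

namespace FluidParticleSol

variable {K h₁ : ℝ} (S : FluidParticleSol K h₁)

lemma continuous_energy : Continuous S.energy := by
  have hv := S.continuous_ext
  have h1 : Continuous fun z : ℝ × ℝ => ∫ y in (-1)..z.2, S.ext z.1 y ^ 2 :=
    continuous_primitive_param (f := fun s y => S.ext s y ^ 2) (by fun_prop) (-1)
  have h2 : Continuous fun s => ∫ y in (-1)..1, S.ext s y ^ 2 :=
    h1.comp (continuous_id.prodMk continuous_const)
  have h3 := S.continuous_h
  have h4 := S.continuous_deriv_h
  exact (h2.add (h4.pow 2)).add (((h3.sub continuous_const).pow 2).const_mul K)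

lemma continuousOn_correctedLogRatio : ContinuousOn S.correctedLogRatio (Ici 0) := by
  have hh := S.continuous_h
  have h1 : ∀ t ∈ Ici (0 : ℝ), 1 + S.h t ≠ 0 := fun t ht => by linarith [(S.h_in t ht).1]
  have h2 : ∀ t ∈ Ici (0 : ℝ), 1 - S.h t ≠ 0 := fun t ht => by linarith [(S.h_in t ht).2]
  have c1 : ContinuousOn (fun t => 1 + S.h t) (Ici 0) := by fun_prop
  have c2 : ContinuousOn (fun t => 1 - S.h t) (Ici 0) := by fun_prop
  have c3 : Continuous fun t => S.momentLeft t (S.h t) :=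
    S.continuous_momentLeft.comp (continuous_id.prodMk hh)
  have c4 : Continuous fun t => S.momentRight t (S.h t) :=
    S.continuous_momentRight.comp (continuous_id.prodMk hh)
  exact (((c1.log h1).sub (c2.log h2)).add S.continuous_deriv_h.continuousOn).add
    ((c3.continuousOn.div c1 h1).add (c4.continuousOn.div c2 h2))

lemma mul_correctedLogRatio_add_energy_le {lam T : ℝ} (hlam : |lam| ≤ 1) (hT : 0 ≤ T) :
    lam * (S.correctedLogRatio T - S.correctedLogRatio 0) + S.energy T ≤
      S.energy 0 + |lam| * (2 * K * T) := by
  have key := le_of_backward_slope_nonpos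
    (f := fun s => lam * S.correctedLogRatio s + S.energy s - |lam| * (2 * K * s)) hT
    (((S.continuousOn_correctedLogRatio.mono fun x hx => mem_Ici.2 hx.1).const_mul lam).add
      S.continuous_energy.continuousOn |>.sub (Continuous.continuousOn (by fun_prop)))
    (fun t ht η hη => by
      obtain ⟨G, hG, hGle⟩ := S.exists_energy_majorant ht.1
      obtain ⟨z', hz, hz'⟩ := S.exists_correctedLogRatio_deriv ht.1
      have hd := ((hz.const_mul lam).fun_add hG).fun_sub
        (((hasDerivAt_id' t).const_mul (2 * K)).const_mul |lam|)
      have hneg : lam * z' + -2 * S.dissipation t (-1) 1 - |lam| * (2 * K * 1) ≤ 0 := by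
        have h1 : lam * z' ≤ |lam| * |z'| := by
          rw [← abs_mul]
          exact le_abs_self _
        have h2 := mul_le_mul_of_nonneg_left hz' (abs_nonneg lam)
        have h3 := S.dissipation_nonneg t (by norm_num : (-1 : ℝ) ≤ 1)
        nlinarith
      filter_upwards [hd.eventually_abs_backward_sub_le hη, self_mem_nhdsWithin] with δ h1
        (hδ : 0 < δ)
      have h2 := hGle (t - δ)
      have h3 := (abs_le.1 h1).2
      have h4 := mul_nonpos_of_nonneg_of_nonpos hδ.le hneg
      linarith)
  linarith

lemma energy_le {t : ℝ} (ht : 0 ≤ t) : S.energy t ≤ S.energy 0 := by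
  simpa using S.mul_correctedLogRatio_add_energy_le (lam := 0) (by simp) ht

lemma integral_sq_ext_nonneg (t : ℝ) : 0 ≤ ∫ y in (-1)..1, S.ext t y ^ 2 :=
  intervalIntegral.integral_nonneg (by norm_num) fun _ _ => sq_nonneg _

lemma integral_sq_ext_le_energy (t : ℝ) : ∫ y in (-1)..1, S.ext t y ^ 2 ≤ S.energy t := by
  rw [energy]
  linarith [sq_nonneg (deriv S.h t), mul_nonneg S.hK (sq_nonneg (S.h t - h₁))]

lemma energy_nonneg (t : ℝ) : 0 ≤ S.energy t :=
  (S.integral_sq_ext_nonneg t).trans (S.integral_sq_ext_le_energy t)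

lemma abs_deriv_h_le {t : ℝ} (ht : 0 ≤ t) : |deriv S.h t| ≤ √(S.energy 0) := by
  refine Real.abs_le_sqrt (le_trans ?_ (S.energy_le ht))
  rw [energy]
  linarith [S.integral_sq_ext_nonneg t, mul_nonneg S.hK (sq_nonneg (S.h t - h₁))]

lemma abs_tentMoment_le {t : ℝ} (ht : 0 ≤ t) :
    |S.tentMoment t (S.h t)| ≤ 2 * √(S.energy 0) := by
  have hI : (-1 : ℝ) ≤ 1 := by norm_num
  have hz := S.h_in t ht
  have hv := continuous_slice S.continuous_ext t
  set ψ : ℝ → ℝ := fun y => ∫ x in (-1)..y, tentSlope (S.h t) x with hψ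
  have hψc : Continuous ψ :=
    intervalIntegral.continuous_primitive (fun a b => intervalIntegrable_tentSlope _ a b) (-1)
  have hψ1 : ∀ y ∈ Icc (-1 : ℝ) 1, ψ y ^ 2 ≤ 1 := by
    intro y hy
    have h1 : 0 < 1 + S.h t := by linarith [hz.1]
    have h2 : 0 < 1 - S.h t := by linarith [hz.2]
    refine (sq_le_one_iff_abs_le_one _).2 (abs_le.2 ?_)
    simp only [hψ]
    rcases le_total y (S.h t) with h | h
    · rw [integral_tentSlope_of_le hy.1 h, ← div_eq_inv_mul, div_le_one h1]
      exact ⟨by linarith [div_nonneg (by linarith [hy.1] : 0 ≤ 1 + y) h1.le], by linarith⟩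
    · rw [integral_tentSlope_of_ge hz h, ← div_eq_inv_mul, div_le_one h2]
      exact ⟨by linarith [div_nonneg (by linarith [hy.2] : 0 ≤ 1 - y) h2.le], by linarith⟩
  have i1 : IntervalIntegrable (fun y => ψ y * S.ext t y) volume (-1) 1 :=
    (hψc.mul hv).intervalIntegrable _ _
  have i2 : IntervalIntegrable (fun y => (ψ y * S.ext t y) ^ 2) volume (-1) 1 :=
    ((hψc.mul hv).pow 2).intervalIntegrable _ _
  have h1 := sq_integral_le hI i1 i2
  have h2 : ∫ y in (-1)..1, (ψ y * S.ext t y) ^ 2 ≤ ∫ y in (-1)..1, S.ext t y ^ 2 :=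
    intervalIntegral.integral_mono_on hI i2 ((hv.pow 2).intervalIntegrable _ _) fun y hy => by
      nlinarith [hψ1 y hy, sq_nonneg (S.ext t y)]
  have h3 := (S.integral_sq_ext_le_energy t).trans (S.energy_le ht)
  rw [S.tentMoment_eq_integral t hz]
  have h4 : |(∫ y in (-1)..1, ψ y * S.ext t y) / 2| ≤ √(S.energy 0) := by
    refine Real.abs_le_sqrt ?_
    nlinarith [S.energy_nonneg 0]
  rw [abs_div, abs_two] at h4
  linarith

lemma abs_logRatio_sub_le {t : ℝ} (ht : 0 ≤ t) :
    |S.logRatio t - S.logRatio 0| ≤ S.energy 0 + 6 * √(S.energy 0) + 2 * K * t := by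
  have h1 := S.mul_correctedLogRatio_add_energy_le (lam := 1) (by simp) ht
  have h2 := S.mul_correctedLogRatio_add_energy_le (lam := -1) (by simp) ht
  simp only [abs_one, abs_neg] at h1 h2
  have h3 := S.energy_nonneg t
  have a1 := abs_le.1 (S.abs_deriv_h_le ht)
  have a2 := abs_le.1 (S.abs_deriv_h_le le_rfl)
  have a3 := abs_le.1 (S.abs_tentMoment_le ht)
  have a4 := abs_le.1 (S.abs_tentMoment_le le_rfl)
  simp only [correctedLogRatio] at h1 h2
  rw [abs_le]
  constructor <;> linarith [a1.1, a1.2, a2.1, a2.2, a3.1, a3.2, a4.1, a4.2]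

end FluidParticleSol

lemma le_one_sub_of_log_ratio_le {x y c : ℝ} (hx : x ∈ Ioo (-1 : ℝ) 1) (hy : y ∈ Ioo (-1 : ℝ) 1)
    (h : log (1 + y) - log (1 - y) ≤ log (1 + x) - log (1 - x) + c) :
    y ≤ 1 - 2 / (1 + max 2 ((1 + x) / (1 - x)) * exp c) := by
  have x1 : 0 < 1 + x := by linarith [hx.1]
  have x2 : 0 < 1 - x := by linarith [hx.2]
  have y1 : 0 < 1 + y := by linarith [hy.1]
  have y2 : 0 < 1 - y := by linarith [hy.2]
  rw [← log_div y1.ne' y2.ne', ← log_div x1.ne' x2.ne'] at h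
  have h1 := exp_le_exp.2 h
  rw [exp_add, exp_log (div_pos y1 y2), exp_log (div_pos x1 x2), div_le_iff₀ y2] at h1
  have h2 : (1 + x) / (1 - x) * exp c ≤ max 2 ((1 + x) / (1 - x)) * exp c :=
    mul_le_mul_of_nonneg_right (le_max_right _ _) (exp_pos c).le
  have h3 := mul_le_mul_of_nonneg_right h2 y2.le
  have h4 : 0 < max 2 ((1 + x) / (1 - x)) * exp c :=
    (mul_pos (div_pos x1 x2) (exp_pos c)).trans_le h2
  have h5 : 2 / (1 + max 2 ((1 + x) / (1 - x)) * exp c) ≤ 1 - y := by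
    rw [div_le_iff₀ (by linarith)]
    linarith
  linarith

/-- Explicit lower and upper bounds `-1 + κ₁(t) ≤ h(t) ≤ 1 - κ₂(t)` for the particle position. -/
theorem particle_bounds {K h₁ : ℝ} (S : FluidParticleSol K h₁) (E₀ C : ℝ) (κ₁ κ₂ : ℝ → ℝ)
    (hE₀ : E₀ = (∫ y in (-1 : ℝ)..1, (S.v 0 y) ^ 2) + (deriv S.h 0) ^ 2
        + K * (S.h 0 - h₁) ^ 2)
    (hC : C = 10 * (E₀ + Real.sqrt E₀))
    (hκ₁ : ∀ t, κ₁ t = 2 / (1 + max 2 ((1 - S.h 0) / (1 + S.h 0)) * Real.exp (C + 2 * K * t)))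
    (hκ₂ : ∀ t, κ₂ t = 2 / (1 + max 2 ((1 + S.h 0) / (1 - S.h 0)) * Real.exp (C + 2 * K * t)))
    (t : ℝ) (ht : 0 ≤ t) :
    -1 + κ₁ t ≤ S.h t ∧ S.h t ≤ 1 - κ₂ t := by
  have hE : S.energy 0 = E₀ := by
    rw [hE₀, FluidParticleSol.energy]
    congr 2
    refine intervalIntegral.integral_congr fun y hy => ?_
    rw [uIcc_of_le (by norm_num)] at hy
    simp only [S.ext_eq le_rfl hy]
  have hpos := S.energy_nonneg 0
  have hmain := S.abs_logRatio_sub_le ht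
  rw [hE] at hpos hmain
  have hbound : |S.logRatio t - S.logRatio 0| ≤ C + 2 * K * t := by
    rw [hC]
    linarith [Real.sqrt_nonneg E₀]
  rw [abs_le] at hbound
  simp only [FluidParticleSol.logRatio] at hbound
  have h0 := S.h_in 0 le_rfl
  have h1 := S.h_in t ht
  have upper := le_one_sub_of_log_ratio_le h0 h1 (c := C + 2 * K * t) (by linarith [hbound.2])
  have lower := le_one_sub_of_log_ratio_le (x := -S.h 0) (y := -S.h t) (c := C + 2 * K * t)
    ⟨by linarith [h0.2], by linarith [h0.1]⟩ ⟨by linarith [h1.2], by linarith [h1.1]⟩ (by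
      simp only [sub_neg_eq_add, ← sub_eq_add_neg]
      linarith [hbound.1])
  simp only [sub_neg_eq_add, ← sub_eq_add_neg] at lower
  rw [← hκ₂ t] at upper
  rw [← hκ₁ t] at lower
  exact ⟨by linarith, upper⟩
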